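/- Let n ≥ 6 and let f be any quadratic form with rational coefficients in n+1 variables of signature (n,1). Then every group that is abstractly commensurable with O(f,ℤ) is noncoherent. In particular O(f,ℤ) itself is noncoherent. -/

import Mathlib

namespace Paper

open Matrix

/-- Value at `x` of the quadratic form with Gram matrix `Q`. -/
def qeval {m : ℕ} {R : Type*} [CommRing R] (Q : Matrix (Fin m) (Fin m) R) (x : Fin m → R) : R :=
  x ⬝ᵥ (Q *ᵥ x)

/-- The polar bilinear form `B(x,y) = (f(x+y) - f(x) - f(y))/2` of the quadratic form
with Gram matrix `Q`. -/
def qpolar {m : ℕ} {K : Type*} [Field K] (Q : Matrix (Fin m) (Fin m) K) (x y : Fin m → K) : K :=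
  (qeval Q (x + y) - qeval Q x - qeval Q y) / 2

/-- A real quadratic form (given by its Gram matrix `Q`) has signature `(r,s)`:
`r + s = m` and it is linearly equivalent over `ℝ` to
`x_1^2 + ... + x_r^2 - x_{r+1}^2 - ... - x_m^2`. -/
def RealSignature {m : ℕ} (Q : Matrix (Fin m) (Fin m) ℝ) (r s : ℕ) : Prop :=
  r + s = m ∧ ∃ T : Matrix (Fin m) (Fin m) ℝ, T.det ≠ 0 ∧
    ∀ x : Fin m → ℝ, qeval Q (T *ᵥ x) = ∑ i : Fin m, (if (i : ℕ) < r then (x i)^2 else -(x i)^2)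

/-- A rational quadratic form has signature `(r,s)` if it does as a real quadratic form. -/
def HasSignature {m : ℕ} (Q : Matrix (Fin m) (Fin m) ℚ) (r s : ℕ) : Prop :=
  RealSignature (Q.map (Rat.cast : ℚ → ℝ)) r s

/-- The rational quadratic form `F` (in `n` variables) represents the rational quadratic
form `G` (in `k` variables): after a linear change of coordinates over `ℚ`,
`F(x_1,...,x_n) = G(x_1,...,x_k) + H(x_{k+1},...,x_n)` for some rational quadratic form `H`. -/
def Represents {n k : ℕ} (F : Matrix (Fin n) (Fin n) ℚ) (G : Matrix (Fin k) (Fin k) ℚ) : Prop :=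
  ∃ (m : ℕ) (hm : n = k + m) (H : Matrix (Fin m) (Fin m) ℚ) (T : Matrix (Fin n) (Fin n) ℚ),
    T.det ≠ 0 ∧ ∀ (x : Fin k → ℚ) (y : Fin m → ℚ),
      qeval F (T *ᵥ (Fin.append x y ∘ Fin.cast hm)) = qeval G x + qeval H y

/-- The group `O(f, A)` of matrices in `GL(m, A)` preserving the quadratic form `f`
(with Gram matrix `Q` over `K ⊇ A`): those `M` with `f(Mx) = f(x)` for all `x`. -/
def ortho {m : ℕ} (A : Type*) [CommRing A] {K : Type*} [Field K] [Algebra A K]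
    (Q : Matrix (Fin m) (Fin m) K) : Subgroup (GL (Fin m) A) where
  carrier := { M | ∀ x : Fin m → K,
      qeval Q (((M : Matrix (Fin m) (Fin m) A).map (algebraMap A K)) *ᵥ x) = qeval Q x }
  one_mem' := by
    intro x
    have h1 : ((1 : GL (Fin m) A) : Matrix (Fin m) (Fin m) A).map (algebraMap A K) = 1 := by
      simp [Matrix.map_one]
    rw [h1, Matrix.one_mulVec]
  mul_mem' := by
    intro a b ha hb x
    have h : ((a * b : GL (Fin m) A) : Matrix (Fin m) (Fin m) A).map (algebraMap A K)
        = ((a : Matrix (Fin m) (Fin m) A).map (algebraMap A K)) *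
          ((b : Matrix (Fin m) (Fin m) A).map (algebraMap A K)) := by
      rw [Units.val_mul, Matrix.map_mul]
    rw [h, ← Matrix.mulVec_mulVec, ha, hb]
  inv_mem' := by
    intro a ha x
    set M := ((a : Matrix (Fin m) (Fin m) A).map (algebraMap A K)) with hM
    set N := (((a⁻¹ : GL (Fin m) A) : Matrix (Fin m) (Fin m) A).map (algebraMap A K)) with hN
    have hMN : M * N = 1 := by
      rw [hM, hN, ← Matrix.map_mul]
      have : (a : Matrix (Fin m) (Fin m) A) * ((a⁻¹ : GL (Fin m) A) : Matrix (Fin m) (Fin m) A)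
          = 1 := a.mul_inv
      rw [this]
      simp [Matrix.map_one]
    have ha' : ∀ y : Fin m → K, qeval Q (M *ᵥ y) = qeval Q y := ha
    calc qeval Q (N *ᵥ x) = qeval Q (M *ᵥ (N *ᵥ x)) := (ha' (N *ᵥ x)).symm
      _ = qeval Q ((M * N) *ᵥ x) := by rw [Matrix.mulVec_mulVec]
      _ = qeval Q x := by rw [hMN, Matrix.one_mulVec]

/-- `O(f, ℤ)` for a rational quadratic form `f` with Gram matrix `Q`. -/
abbrev OZ {m : ℕ} (Q : Matrix (Fin m) (Fin m) ℚ) : Subgroup (GL (Fin m) ℤ) := ortho ℤ Q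

/-- A group is finitely presented: it is a quotient of a finitely generated free group by
the normal closure of a finite set of relators. -/
def IsFinitelyPresented (G : Type*) [Group G] : Prop :=
  ∃ (n : ℕ) (rels : Set (FreeGroup (Fin n))), rels.Finite ∧ Nonempty (PresentedGroup rels ≃* G)

/-- A group is coherent if each of its finitely generated subgroups is finitely presented. -/
def IsCoherent (G : Type*) [Group G] : Prop :=
  ∀ H : Subgroup G, Group.FG H → IsFinitelyPresented H

/-- Two groups are abstractly commensurable if they contain isomorphic
subgroups of finite index. -/
def AbstractlyCommensurable (G H : Type*) [Group G] [Group H] : Prop :=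
  ∃ (G' : Subgroup G) (H' : Subgroup H), G'.FiniteIndex ∧ H'.FiniteIndex ∧ Nonempty (G' ≃* H')

/-- The form `q₃ = -x₀² + x₁² + x₂² + x₃²`. -/
def q3 : Matrix (Fin 4) (Fin 4) ℚ := Matrix.diagonal ![-1, 1, 1, 1]

universe u

section GroupTheory

/-- The double of `A` along `C`. -/
abbrev Dbl {A : Type*} [Group A] (C : Subgroup A) : Type _ :=
  Monoid.PushoutI (fun _ : Bool => C.subtype)

/-- inclusion of a factor -/
abbrev Dbl.i {A : Type*} [Group A] (C : Subgroup A) (b : Bool) : A →* Dbl C :=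
  Monoid.PushoutI.of (φ := fun _ : Bool => C.subtype) b

theorem Dbl.i_eq {A : Type*} [Group A] (C : Subgroup A) (b b' : Bool) {c : A} (hc : c ∈ C) :
    Dbl.i C b c = Dbl.i C b' c := by
  have h1 := Monoid.PushoutI.of_apply_eq_base (fun _ : Bool => C.subtype) b ⟨c, hc⟩
  have h2 := Monoid.PushoutI.of_apply_eq_base (fun _ : Bool => C.subtype) b' ⟨c, hc⟩
  exact h1.trans h2.symm

theorem Dbl.mem_of_i_eq {A : Type*} [Group A] (C : Subgroup A) {c : A}
    (h : Dbl.i C false c = Dbl.i C true c) : c ∈ C := by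
  have hinj : ∀ i : Bool, Function.Injective ((fun _ : Bool => C.subtype) i) :=
    fun _ => C.subtype_injective
  have h1 : Dbl.i C false c ∈ (Dbl.i C false).range ⊓ (Dbl.i C true).range :=
    ⟨⟨c, rfl⟩, ⟨c, h.symm⟩⟩
  rw [Monoid.PushoutI.inf_of_range_eq_base_range hinj (by decide)] at h1
  obtain ⟨d, hd⟩ := h1
  rw [← Monoid.PushoutI.of_apply_eq_base (fun _ : Bool => C.subtype) false d] at hd
  have := Monoid.PushoutI.of_injective hinj false hd
  rw [← this]; exact d.2

/-- lifting from the double -/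
def Dbl.lift {A : Type*} [Group A] (C : Subgroup A) {K : Type*} [Group K] (f : Bool → A →* K)
    (hf : ∀ c ∈ C, f false c = f true c) : Dbl C →* K :=
  Monoid.PushoutI.lift f ((f false).comp C.subtype) (by
    intro b; ext ⟨c, hc⟩
    cases b
    · rfl
    · exact (hf c hc).symm)

theorem Dbl.lift_i {A : Type*} [Group A] (C : Subgroup A) {K : Type*} [Group K] (f : Bool → A →* K)
    (hf : ∀ c ∈ C, f false c = f true c) (b : Bool) (a : A) :
    Dbl.lift C f hf (Dbl.i C b a) = f b a :=
  Monoid.PushoutI.lift_of _ _ _ _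

theorem Dbl.hom_ext {A : Type*} [Group A] (C : Subgroup A) {K : Type*} [Group K]
    {f g : Dbl C →* K} (h : ∀ b a, f (Dbl.i C b a) = g (Dbl.i C b a)) : f = g :=
  Monoid.PushoutI.hom_ext_nonempty (fun b => MonoidHom.ext (h b))

/-- transition maps -/
def Dbl.tr {A : Type*} [Group A] {C C' : Subgroup A} (h : C ≤ C') : Dbl C →* Dbl C' :=
  Dbl.lift C (Dbl.i C') (fun _ hc => Dbl.i_eq C' _ _ (h hc))

theorem Dbl.tr_i {A : Type*} [Group A] {C C' : Subgroup A} (h : C ≤ C') (b : Bool) (a : A) :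
    Dbl.tr h (Dbl.i C b a) = Dbl.i C' b a := Dbl.lift_i _ _ _ _ _

theorem Dbl.tr_tr {A : Type*} [Group A] {C C' C'' : Subgroup A} (h : C ≤ C') (h' : C' ≤ C'')
    (x : Dbl C) : Dbl.tr h' (Dbl.tr h x) = Dbl.tr (h.trans h') x := by
  have : (Dbl.tr h').comp (Dbl.tr h) = Dbl.tr (h.trans h') :=
    Dbl.hom_ext _ (fun b a => by simp [Dbl.tr_i])
  exact DFunLike.congr_fun this x

/-- the elements dying at a finite stage -/
def Dbl.dying {A : Type*} [Group A] (C : Subgroup A) : Subgroup (Dbl (⊥ : Subgroup A)) where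
  carrier := {x | ∃ C' : Subgroup A, C' ≤ C ∧ C'.FG ∧ Dbl.tr (bot_le : ⊥ ≤ C') x = 1}
  one_mem' := ⟨⊥, bot_le, ⟨∅, by simp⟩, map_one _⟩
  mul_mem' := by
    rintro x y ⟨C1, h1, f1, e1⟩ ⟨C2, h2, f2, e2⟩
    refine ⟨C1 ⊔ C2, sup_le h1 h2, f1.sup f2, ?_⟩
    rw [map_mul, ← Dbl.tr_tr bot_le (le_sup_left : C1 ≤ C1 ⊔ C2),
      ← Dbl.tr_tr bot_le (le_sup_right : C2 ≤ C1 ⊔ C2), e1, e2]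
    simp
  inv_mem' := by
    rintro x ⟨C1, h1, f1, e1⟩
    exact ⟨C1, h1, f1, by rw [map_inv, e1, inv_one]⟩

instance Dbl.dying_normal {A : Type*} [Group A] (C : Subgroup A) : (Dbl.dying C).Normal where
  conj_mem := by
    rintro x ⟨C1, h1, f1, e1⟩ g
    exact ⟨C1, h1, f1, by rw [map_mul, map_mul, e1]; simp⟩

theorem Dbl.mem_dying {A : Type*} [Group A] (C : Subgroup A) {x : Dbl (⊥ : Subgroup A)}
    (hx : Dbl.tr (bot_le : ⊥ ≤ C) x = 1) : x ∈ Dbl.dying C := by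
  let p := QuotientGroup.mk' (Dbl.dying C)
  let s : Dbl C →* Dbl (⊥ : Subgroup A) ⧸ Dbl.dying C :=
    Dbl.lift C (fun b => p.comp (Dbl.i ⊥ b)) (by
      intro c hc
      show p _ = p _
      refine (QuotientGroup.eq).2 ⟨Subgroup.closure {c}, ?_, ⟨{c}, by simp⟩, ?_⟩
      · simpa using hc
      · rw [map_mul, map_inv, Dbl.tr_i, Dbl.tr_i,
          Dbl.i_eq _ false true (Subgroup.subset_closure (Set.mem_singleton c))]
        simp)
  have hs : s.comp (Dbl.tr bot_le) = p :=
    Dbl.hom_ext _ (fun b a => by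
      show s (Dbl.tr bot_le (Dbl.i ⊥ b a)) = p (Dbl.i ⊥ b a)
      rw [Dbl.tr_i]; exact Dbl.lift_i _ _ _ _ _)
  have h2 : p x = 1 := by
    rw [← hs]; show s _ = 1
    rw [hx, map_one]
  exact (QuotientGroup.eq_one_iff x).1 h2

theorem Dbl.finite_dying {A : Type*} [Group A] (C : Subgroup A) {T : Set (Dbl (⊥ : Subgroup A))}
    (hT : T.Finite) (hx : ∀ x ∈ T, Dbl.tr (bot_le : ⊥ ≤ C) x = 1) :
    ∃ C' : Subgroup A, C' ≤ C ∧ C'.FG ∧ ∀ x ∈ T, Dbl.tr (bot_le : ⊥ ≤ C') x = 1 := by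
  induction T, hT using Set.Finite.induction_on with
  | empty => exact ⟨⊥, bot_le, ⟨∅, by simp⟩, by simp⟩
  | @insert a T _ _ ih =>
    obtain ⟨C1, h1, f1, e1⟩ := ih (fun x hxT => hx x (Set.mem_insert_of_mem _ hxT))
    obtain ⟨C2, h2, f2, e2⟩ := Dbl.mem_dying C (hx a (Set.mem_insert _ _))
    refine ⟨C1 ⊔ C2, sup_le h1 h2, f1.sup f2, ?_⟩
    intro x hxx
    rcases hxx with rfl | hxx
    · rw [← Dbl.tr_tr bot_le (le_sup_right : C2 ≤ C1 ⊔ C2), e2, map_one]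
    · rw [← Dbl.tr_tr bot_le (le_sup_left : C1 ≤ C1 ⊔ C2), e1 x hxx, map_one]

theorem Dbl.tr_surjective {A : Type*} [Group A] {C C' : Subgroup A} (h : C ≤ C') :
    Function.Surjective (Dbl.tr h) := by
  intro x
  induction x using Monoid.PushoutI.induction_on with
  | of b a => exact ⟨Dbl.i C b a, Dbl.tr_i _ _ _⟩
  | base c =>
    refine ⟨Dbl.i C false c, ?_⟩
    rw [Dbl.tr_i]
    exact Monoid.PushoutI.of_apply_eq_base (fun _ : Bool => C'.subtype) false c
  | mul x y hx hy =>
    obtain ⟨x, rfl⟩ := hx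
    obtain ⟨y, rfl⟩ := hy
    exact ⟨x * y, map_mul _ _ _⟩

theorem Dbl.not_fp {A : Type*} [Group A] (hA : Group.FG A) (C : Subgroup A) (hC : ¬ C.FG) :
    ¬ IsFinitelyPresented (Dbl C) := by
  rintro ⟨n, rels, hfin, ⟨e⟩⟩
  apply hC
  obtain ⟨S, hS⟩ := hA.out
  let φ : FreeGroup (Fin n) →* Dbl C := e.toMonoidHom.comp (PresentedGroup.mk rels)
  have hφ : Function.Surjective φ := e.surjective.comp (PresentedGroup.mk_surjective rels)
  have hπ := Dbl.tr_surjective (bot_le : ⊥ ≤ C)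
  choose σ hσ using hπ
  let ψ : FreeGroup (Fin n) →* Dbl (⊥ : Subgroup A) := FreeGroup.lift (fun j => σ (φ (FreeGroup.of j)))
  have hψ : (Dbl.tr (bot_le : ⊥ ≤ C)).comp ψ = φ := by
    ext j; simp [ψ, hσ]
  have hψ' : ∀ w, Dbl.tr (bot_le : ⊥ ≤ C) (ψ w) = φ w := fun w => DFunLike.congr_fun hψ w
  choose ρ hρ using hφ
  let T : Set (Dbl (⊥ : Subgroup A)) := ψ '' rels ∪
    (fun x : Bool × A => (Dbl.i ⊥ x.1 x.2)⁻¹ * ψ (ρ (Dbl.i C x.1 x.2))) '' (Set.univ ×ˢ (S : Set A))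
  have hT : T.Finite := (hfin.image _).union ((Set.finite_univ.prod S.finite_toSet).image _)
  obtain ⟨C', hC', hfg, hd⟩ := Dbl.finite_dying C hT (by
    rintro x (⟨r, hr, rfl⟩ | ⟨⟨b, a⟩, -, rfl⟩)
    · rw [hψ']
      show e _ = 1
      rw [PresentedGroup.mk_eq_one_iff.2 (Subgroup.subset_normalClosure hr), map_one]
    · simp only [map_mul, map_inv, hψ', hρ, Dbl.tr_i]; simp)
  have hle : C ≤ C' := by
    let s0 : PresentedGroup rels →* Dbl C' :=
      QuotientGroup.lift (Subgroup.normalClosure rels) ((Dbl.tr (bot_le : ⊥ ≤ C')).comp ψ) (by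
        intro x hx
        have : Subgroup.normalClosure rels ≤ ((Dbl.tr (bot_le : ⊥ ≤ C')).comp ψ).ker :=
          Subgroup.normalClosure_le_normal (fun r hr => hd _ (Or.inl ⟨r, hr, rfl⟩))
        exact this hx)
    let s : Dbl C →* Dbl C' := s0.comp e.symm.toMonoidHom
    have hs : ∀ w, s (φ w) = Dbl.tr (bot_le : ⊥ ≤ C') (ψ w) := by
      intro w
      show s0 (e.symm (e _)) = _
      rw [e.symm_apply_apply]; rfl
    have hsi : ∀ b, s.comp (Dbl.i C b) = Dbl.i C' b := by
      intro b
      refine MonoidHom.eq_of_eqOn_dense hS ?_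
      intro a ha
      have h1 := hd _ (Or.inr ⟨(b, a), ⟨trivial, ha⟩, rfl⟩)
      simp only [map_mul, map_inv, Dbl.tr_i] at h1
      rw [← hs, hρ, inv_mul_eq_one] at h1
      exact h1.symm
    intro c hc
    apply Dbl.mem_of_i_eq
    rw [← hsi false, ← hsi true]
    show s _ = s _
    rw [Dbl.i_eq C false true hc]
  rw [le_antisymm hle hC']; exact hfg

theorem Dbl.pingpong {A : Type*} [Group A] (C : Subgroup A) {O X : Type*} [Group O] [MulAction O X]
    (ι : Bool → A →* O) (hι : ∀ c ∈ C, ι false c = ι true c)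
    (hinj : ∀ c ∈ C, ι false c = 1 → c = 1)
    (X' : Set X) (hX' : ∀ (g : O), ∀ x ∈ X', g • x ∈ X')
    (S : Bool → Set X) (hS : ∀ x ∈ X', x ∈ S false ∨ x ∈ S true)
    (x0 : X) (hx0 : x0 ∈ X') (hx0S : ∀ b, x0 ∈ S b)
    (hC : ∀ c ∈ C, ∀ b, ι b c • x0 ∈ S b)
    (hA : ∀ a ∉ C, ∀ b, ∀ x ∈ X', x ∈ S b → ι b a • x ∉ S b) :
    Function.Injective (Dbl.lift C ι hι) := by
  classical
  have hφ : ∀ i : Bool, Function.Injective ((fun _ : Bool => C.subtype) i) :=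
    fun _ => C.subtype_injective
  set L := Dbl.lift C ι hι with hL
  have key : ∀ w : Monoid.CoprodI.Word (fun _ : Bool => A),
      Monoid.PushoutI.Reduced (fun _ : Bool => C.subtype) w → ∀ b, 
      (w.fstIdx = some b → L (Monoid.PushoutI.ofCoprodI w.prod) • x0 ∉ S b) ∧
      (w.fstIdx ≠ some b → L (Monoid.PushoutI.ofCoprodI w.prod) • x0 ∈ S b) := by
    intro w
    induction w using Monoid.CoprodI.Word.consRecOn with
    | empty =>
      intro _ b
      simp [Monoid.CoprodI.Word.fstIdx, Monoid.CoprodI.Word.empty, Monoid.CoprodI.Word.prod, hx0S]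
    | cons i g w hIdx hg1 ih =>
      intro hw
      have ih' := ih (fun _ hg => hw _ (List.mem_cons_of_mem _ hg))
      have hg : g ∉ C := by
        have := hw ⟨i, g⟩ List.mem_cons_self
        simpa using this
      have h1 : L (Monoid.PushoutI.ofCoprodI (Monoid.CoprodI.Word.cons g w hIdx hg1).prod) • x0
          ∉ S i := by
        rw [Monoid.CoprodI.Word.prod_cons, map_mul, map_mul, mul_smul,
          Monoid.PushoutI.ofCoprodI_of]
        rw [show L (Monoid.PushoutI.of i g) = ι i g from Dbl.lift_i _ _ _ _ _]
        exact hA g hg i _ (hX' _ _ hx0) ((ih' i).2 hIdx)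
      have h2 : ∀ b, (Monoid.CoprodI.Word.cons g w hIdx hg1).fstIdx = some b ↔ i = b := by
        intro b; simp [Monoid.CoprodI.Word.fstIdx, Monoid.CoprodI.Word.cons]
      intro b
      rw [Ne, h2]
      constructor
      · rintro rfl; exact h1
      · intro hb
        rcases hS _ (hX' (L (Monoid.PushoutI.ofCoprodI
          (Monoid.CoprodI.Word.cons g w hIdx hg1).prod)) _ hx0) with h | h
        · cases i
          · exact absurd h h1
          · cases b
            · exact h
            · exact absurd rfl hb
        · cases i
          · cases b
            · exact absurd rfl hb
            · exact h
          · exact absurd h h1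
  rw [injective_iff_map_eq_one]
  intro x hx
  obtain ⟨d⟩ := Monoid.PushoutI.NormalWord.transversal_nonempty (fun _ : Bool => C.subtype) hφ
  obtain ⟨w, rfl⟩ : ∃ w : Monoid.PushoutI.NormalWord d, w.prod = x :=
    ⟨x • Monoid.PushoutI.NormalWord.empty, by
      rw [Monoid.PushoutI.NormalWord.prod_smul, Monoid.PushoutI.NormalWord.prod_empty, mul_one]⟩
  have hred : Monoid.PushoutI.Reduced (fun _ : Bool => C.subtype) w.toWord := by
    rintro ⟨i, g⟩ hg hr
    have hn := w.normalized i g hg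
    have h1 := w.ne_one _ hg
    apply h1
    have := (d.compl i).1 (a₁ := (⟨⟨g, hr⟩, ⟨1, d.one_mem i⟩⟩ : _ × _))
      (a₂ := (⟨⟨1, one_mem _⟩, ⟨g, hn⟩⟩ : _ × _)) (by simp)
    simpa using congrArg (fun z => ((z.1 : _) : A)) this
  have hb : L (Monoid.PushoutI.base _ w.head) = ι false w.head := by
    rw [← Monoid.PushoutI.of_apply_eq_base (fun _ : Bool => C.subtype) false]
    exact Dbl.lift_i _ _ _ _ _
  rw [Monoid.PushoutI.NormalWord.prod, map_mul, hb] at hx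
  have hb' : ∀ b, ι b (w.head : A)⁻¹ = ι false (w.head : A)⁻¹ := by
    intro b; cases b
    · rfl
    · rw [hι _ (C.inv_mem w.head.2)]
  have h3 : L (Monoid.PushoutI.ofCoprodI w.toWord.prod) = ι false (w.head : A)⁻¹ := by
    rw [map_inv]; exact eq_inv_of_mul_eq_one_right hx
  have h4 : w.toWord.fstIdx = none := by
    by_contra hne
    obtain ⟨b, hb⟩ := Option.ne_none_iff_exists'.1 hne
    apply (key _ hred b).1 hb
    rw [h3, ← hb' b]
    exact hC _ (C.inv_mem w.head.2) b
  have h5 : w.toWord = Monoid.CoprodI.Word.empty := by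
    ext1
    simpa [Monoid.CoprodI.Word.fstIdx] using h4
  rw [h5, Monoid.CoprodI.Word.prod_empty, map_one, map_one, mul_one] at hx
  have h6 : w.head = 1 := Subtype.ext (hinj _ w.head.2 hx)
  rw [Monoid.PushoutI.NormalWord.prod, h5, h6]; simp

theorem IsFinitelyPresented.equiv {G H : Type*} [Group G] [Group H] (h : IsFinitelyPresented G)
    (e : G ≃* H) : IsFinitelyPresented H := by
  obtain ⟨n, r, hr, ⟨f⟩⟩ := h
  exact ⟨n, r, hr, ⟨f.trans e⟩⟩

theorem Dbl.fg {A : Type*} [Group A] (hA : Group.FG A) (C : Subgroup A) : Group.FG (Dbl C) := by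
  obtain ⟨S, hS⟩ := hA.out
  rw [Group.fg_iff]
  refine ⟨(fun x : Bool × A => Dbl.i C x.1 x.2) '' (Set.univ ×ˢ (S : Set A)), ?_,
    (Set.finite_univ.prod S.finite_toSet).image _⟩
  rw [eq_top_iff]
  have hof : ∀ b a, Dbl.i C b a ∈ Subgroup.closure
      ((fun x : Bool × A => Dbl.i C x.1 x.2) '' (Set.univ ×ˢ (S : Set A))) := by
    intro b
    have : (⊤ : Subgroup A) ≤ (Subgroup.closure
      ((fun x : Bool × A => Dbl.i C x.1 x.2) '' (Set.univ ×ˢ (S : Set A)))).comap (Dbl.i C b) := by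
      rw [← hS, Subgroup.closure_le]
      intro a ha
      exact Subgroup.subset_closure ⟨(b, a), ⟨trivial, ha⟩, rfl⟩
    exact fun a => this trivial
  rintro x -
  induction x using Monoid.PushoutI.induction_on with
  | of b a => exact hof b a
  | base c =>
    rw [← Monoid.PushoutI.of_apply_eq_base (fun _ : Bool => C.subtype) false]
    exact hof _ _
  | mul x y hx hy => exact mul_mem hx hy

/-- A group containing an embedded non-fp double is not coherent. -/
theorem not_coherent_of_double {A O : Type*} [Group A] [Group O] (hA : Group.FG A)
    (C : Subgroup A) (hC : ¬ C.FG) (f : Dbl C →* O) (hf : Function.Injective f) :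
    ¬ IsCoherent O := by
  intro h
  have e := MonoidHom.ofInjective hf
  have := Dbl.fg hA C
  have h1 : Group.FG f.range := Group.fg_range f
  exact Dbl.not_fp hA C hC ((h _ h1).equiv e.symm)

theorem not_fg_of_finiteIndex {G : Type*} [Group G] (C C' : Subgroup G) (hle : C' ≤ C)
    (hfin : C'.relIndex C ≠ 0) (hC : ¬ C.FG) : ¬ C'.FG := by
  intro h
  apply hC
  obtain ⟨S, rfl⟩ := h
  have h3 : ((Subgroup.closure (S : Set G)).subgroupOf C).FiniteIndex := ⟨hfin⟩
  rw [Subgroup.fg_iff]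
  refine ⟨S ∪ Set.range (fun q : C ⧸ (Subgroup.closure (S : Set G)).subgroupOf C => (q.out : G)),
    le_antisymm ?_ ?_, S.finite_toSet.union (Set.finite_range _)⟩
  · rw [Subgroup.closure_le]
    rintro x (hx | ⟨q, rfl⟩)
    · exact hle (Subgroup.subset_closure hx)
    · exact q.out.2
  · intro c hc
    set q : C ⧸ (Subgroup.closure (S : Set G)).subgroupOf C := QuotientGroup.mk ⟨c, hc⟩ with hq
    have h4 : (q.out)⁻¹ * (⟨c, hc⟩ : C) ∈ (Subgroup.closure (S : Set G)).subgroupOf C := by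
      rw [← QuotientGroup.eq, QuotientGroup.out_eq']
    rw [Subgroup.mem_subgroupOf] at h4
    have h5 := Subgroup.closure_mono (Set.subset_union_left (s := (S : Set G))
      (t := Set.range (fun q : C ⧸ (Subgroup.closure (S : Set G)).subgroupOf C => (q.out : G)))) h4
    have h6 := Subgroup.subset_closure (Set.mem_union_right (S : Set G)
      (Set.mem_range_self (f := fun q : C ⧸ (Subgroup.closure (S : Set G)).subgroupOf C =>
        (q.out : G)) q))
    have := mul_mem h6 h5
    simpa using this
end GroupTheory

section Morse

theorem rtg_mono {α : Type*} {r p : α → α → Prop} (h : ∀ a b, r a b → p a b) {x y : α}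
    (hx : Relation.ReflTransGen r x y) : Relation.ReflTransGen p x y := by
  induction hx with
  | refl => exact .refl
  | tail _ h2 ih => exact ih.tail (h _ _ h2)

/-- one edge of the Cayley graph with heights in `[m, M]` -/
def MStep {G V : Type*} [Group G] (r : V → G) (h : G → ℤ) (m M : ℤ) (x y : G) : Prop :=
  ∃ v, y = x * r v ∧ m ≤ h x ∧ h x ≤ M ∧ m ≤ h y ∧ h y ≤ M

theorem MStep.mono {G V : Type*} [Group G] {r : V → G} {h : G → ℤ} {m M m' M' : ℤ} {x y : G}
    (hm : m' ≤ m) (hM : M ≤ M') (hs : MStep r h m M x y) : MStep r h m' M' x y := by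
  obtain ⟨v, h0, h1, h2, h3, h4⟩ := hs
  exact ⟨v, h0, by omega, by omega, by omega, by omega⟩

theorem morse_down {G V : Type*} [Group G] (r : V → G) (hinv : ∀ v, r v * r v = 1)
    (h : G → ℤ) (st : G → V → ℤ) (hst : ∀ g v, st g v = 1 ∨ st g v = -1)
    (h1 : ∀ g v, h (g * r v) = h g + st g v)
    (adj : V → V → Prop)
    (hadj : ∀ v w, adj v w → r v * r w = r w * r v ∧ ∀ g, st (g * r v) w = st g w)
    (hconn : ∀ g v w, st g v = -1 → st g w = -1 →
      Relation.ReflTransGen (fun a b => adj a b ∧ st g a = -1 ∧ st g b = -1) v w)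
    (m M : ℤ) (hmM : m + 1 ≤ M) (x y : G)
    (hx : h x ≤ M) (hy : h y ≤ M)
    (hc : Relation.ReflTransGen (MStep r h m (M + 1)) x y) :
    Relation.ReflTransGen (MStep r h m M) x y := by
  have key : (h y ≤ M → Relation.ReflTransGen (MStep r h m M) x y) ∧
      (h y = M + 1 → ∀ v, st y v = -1 → Relation.ReflTransGen (MStep r h m M) x (y * r v)) := by
    clear hy
    induction hc with
    | refl => exact ⟨fun _ => Relation.ReflTransGen.refl, fun h2 => by omega⟩
    | @tail y y' _ hs ih =>
      obtain ⟨v, rfl, hy1, hy2, hy3, hy4⟩ := hs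
      have hstep := h1 y v
      have hback : y * r v * r v = y := by rw [mul_assoc, hinv, mul_one]
      have hstep' := h1 (y * r v) v
      rw [hback] at hstep'
      by_cases hyM : h y ≤ M
      · have hcy := ih.1 hyM
        refine ⟨fun h2 => hcy.tail ⟨v, rfl, hy1, hyM, hy3, h2⟩, ?_⟩
        intro h2 w hw
        have hv : st (y * r v) v = -1 := by
          rcases hst (y * r v) v with h3 | h3 <;> omega
        have hyM' : h y = M := by omega
        generalize hz : y * r v = z at *
        have hch := hconn z v w hv hw
        have : Relation.ReflTransGen (MStep r h m M) (z * r v) (z * r w) := by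
          clear hw
          induction hch with
          | refl => exact Relation.ReflTransGen.refl
          | @tail a b _ hab ih2 =>
            obtain ⟨had, ha, hb⟩ := hab
            obtain ⟨hcm, hs2⟩ := hadj a b had
            have e1 := h1 z a
            have e2 := h1 z b
            have e3 := h1 (z * r a) b
            rw [hs2] at e3
            refine (ih2.tail (b := z * r a) (c := z * r a * r b)
              ⟨b, rfl, ?_, ?_, ?_, ?_⟩).tail ⟨a, ?_, ?_, ?_, ?_, ?_⟩
            all_goals try omega
            rw [mul_assoc z, hcm, mul_assoc, mul_assoc, hinv, mul_one]
        rw [hback] at this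
        exact hcy.trans this
      · have hyM1 : h y = M + 1 := by omega
        have hv : st y v = -1 := by
          rcases hst y v with h3 | h3 <;> omega
        have := ih.2 hyM1 v hv
        exact ⟨fun _ => this, fun h2 => by omega⟩
  exact key.1 hy

theorem morse_fg {G V : Type*} [Group G] [Finite V] (r : V → G) (hinv : ∀ v, r v * r v = 1)
    (hgen : Subgroup.closure (Set.range r) = ⊤)
    (h : G → ℤ) (st : G → V → ℤ) (hst : ∀ g v, st g v = 1 ∨ st g v = -1)
    (h1 : ∀ g v, h (g * r v) = h g + st g v) (h0 : h 1 = 0)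
    (adj : V → V → Prop)
    (hadj : ∀ v w, adj v w → r v * r w = r w * r v ∧ ∀ g, st (g * r v) w = st g w)
    (hconn : ∀ ε : ℤ, ∀ g v w, st g v = ε → st g w = ε →
      Relation.ReflTransGen (fun a b => adj a b ∧ st g a = ε ∧ st g b = ε) v w)
    (A : Subgroup G) (hA : ∀ a ∈ A, ∀ g, h (a * g) = h g)
    (hA' : ∀ g g', h g = h g' → st g = st g' → g * g'⁻¹ ∈ A) : A.FG := by
  have hdown := morse_down r hinv h st hst h1 adj hadj (hconn (-1))
  have hup := morse_down r hinv (fun g => - h g) (fun g v => - st g v)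
    (fun g v => by rcases hst g v with h | h <;> simp [h])
    (fun g v => by simp only [h1]; ring) adj
    (fun v w hvw => ⟨(hadj v w hvw).1, fun g => by simp only [(hadj v w hvw).2]⟩)
    (fun g v w hv hw => by
      refine rtg_mono ?_ (hconn 1 g v w (by omega) (by omega))
      rintro a b ⟨p, q, s⟩
      exact ⟨p, by omega, by omega⟩)
  -- bounded paths
  have hpath : ∀ g : G, ∃ N : ℕ, Relation.ReflTransGen (MStep r h (-N) (N + 1)) 1 g := by
    intro g
    have hg : g ∈ Subgroup.closure (Set.range r) := by rw [hgen]; trivial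
    have aux : ∀ (x : G) (v : V), (∃ N : ℕ, Relation.ReflTransGen (MStep r h (-N) (N + 1)) 1 x) →
        ∃ N : ℕ, Relation.ReflTransGen (MStep r h (-N) (N + 1)) 1 (x * r v) := by
      rintro x v ⟨N, hN⟩
      refine ⟨N + (h x).natAbs + (h (x * r v)).natAbs, ?_⟩
      refine Relation.ReflTransGen.tail (rtg_mono ?_ hN) ⟨v, rfl, ?_, ?_, ?_, ?_⟩
      · intro a b hab
        exact hab.mono (by omega) (by omega)
      all_goals omega
    induction hg using Subgroup.closure_induction_right with
    | one => exact ⟨0, Relation.ReflTransGen.refl⟩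
    | mul_right x hx y hy ih =>
      obtain ⟨v, rfl⟩ := hy
      exact aux x v ih
    | mul_inv_cancel x hx y hy ih =>
      obtain ⟨v, rfl⟩ := hy
      rw [show (r v)⁻¹ = r v from inv_eq_of_mul_eq_one_left (hinv v)]
      exact aux x v ih
  have hpath01 : ∀ g : G, h g = 0 → Relation.ReflTransGen (MStep r h 0 1) 1 g := by
    intro g hg
    obtain ⟨N, hN⟩ := hpath g
    have s1 : ∀ j : ℕ, j ≤ N → Relation.ReflTransGen (MStep r h (-N) (((N - j : ℕ) : ℤ) + 1)) 1 g := by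
      intro j
      induction j with
      | zero => intro _; simpa using hN
      | succ j ih =>
        intro hj
        apply hdown _ _ (by omega) _ _ (by omega) (by omega)
        have := ih (by omega)
        rwa [show (((N - j : ℕ) : ℤ) + 1) = (((N - (j + 1) : ℕ) : ℤ) + 1) + 1 by omega] at this
    have s2 := s1 N le_rfl
    have conv : ∀ a b : ℤ, ∀ x y, MStep r (fun g => - h g) (-b) (-a) x y ↔ MStep r h a b x y := by
      intro a b x y
      constructor <;>
      · rintro ⟨v, e0, e1, e2, e3, e4⟩
        exact ⟨v, e0, by simp_all, by simp_all, by simp_all, by simp_all⟩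
    have s3 : ∀ j : ℕ, j ≤ N → Relation.ReflTransGen (MStep r h (-((N - j : ℕ) : ℤ)) 1) 1 g := by
      intro j
      induction j with
      | zero => intro _; simpa using s2
      | succ j ih =>
        intro hj
        have := ih (by omega)
        have h5 := hup (-1) ((N - (j + 1) : ℕ) : ℤ) (by omega) 1 g (by simp [h0]) (by simp [hg])
          (rtg_mono (fun a b hab => by
            have := (conv _ _ a b).2 hab
            rwa [show - -((N - j : ℕ) : ℤ) = ((N - (j + 1) : ℕ) : ℤ) + 1 by omega] at this) this)
        refine rtg_mono (fun a b hab => ?_) h5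
        apply (conv _ _ a b).1
        simpa using hab
    simpa using s3 N le_rfl
  -- representatives
  classical
  let D := ℤ × (V → ℤ)
  let dt : G → D := fun g => (h g, st g)
  let rep : G → G := fun g => Function.invFun dt (dt g)
  have hrep : ∀ g, dt (rep g) = dt g := fun g => Function.invFun_eq ⟨g, rfl⟩
  let K : Set G := insert 1 (rep '' {g | h g = 0 ∨ h g = 1})
  have hKfin : K.Finite := by
    refine Set.Finite.insert _ ?_
    have hD : Set.Finite ((({0, 1} : Set ℤ) ×ˢ (Set.univ.pi fun _ : V => ({1, -1} : Set ℤ)))) :=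
      Set.Finite.prod (by simp) (Set.Finite.pi (fun _ => by simp))
    refine (hD.image (Function.invFun dt)).subset ?_
    rintro _ ⟨g, hg, rfl⟩
    exact ⟨dt g, ⟨by simpa using hg, fun v _ => by simpa using hst g v⟩, rfl⟩
  let S : Set G := {a | a ∈ A ∧ ∃ k ∈ K, ∃ s ∈ insert 1 (Set.range r), ∃ k' ∈ K, a = k * s * k'⁻¹}
  have hSfin : S.Finite := by
    have h2 : (insert 1 (Set.range r)).Finite := (Set.finite_range r).insert _
    refine ((hKfin.prod (h2.prod hKfin)).image (fun x : G × G × G => x.1 * x.2.1 * x.2.2⁻¹)).subset ?_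
    rintro a ⟨-, k, hk, s, hs, k', hk', rfl⟩
    exact ⟨(k, s, k'), ⟨hk, hs, hk'⟩, rfl⟩
  rw [Subgroup.fg_iff]
  refine ⟨S, le_antisymm ?_ ?_, hSfin⟩
  · rw [Subgroup.closure_le]; exact fun a ha => ha.1
  · intro a ha
    have hha : h a = 0 := by
      have := hA a ha 1
      rw [mul_one, h0] at this; exact this
    have hp := hpath01 a hha
    have hSA : Subgroup.closure S ≤ A := by rw [Subgroup.closure_le]; exact fun a ha => ha.1
    have hmain : ∃ b ∈ Subgroup.closure S, ∃ k ∈ K, a = b * k := by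
      clear ha hha
      induction hp with
      | refl => exact ⟨1, one_mem _, 1, Or.inl rfl, by simp⟩
      | @tail y z _ hs ih =>
        obtain ⟨b, hb, k, hk, rfl⟩ := ih
        obtain ⟨v, rfl, -, -, e3, e4⟩ := hs
        set z := b * k * r v with hz
        have hzr := hrep z
        have hA2 := hA' z (rep z) (congrArg Prod.fst hzr).symm (congrArg Prod.snd hzr).symm
        refine ⟨z * (rep z)⁻¹, ?_, rep z, Or.inr ⟨z, by show _ ∨ _; omega, rfl⟩, by simp⟩
        have h3 : b⁻¹ * (z * (rep z)⁻¹) ∈ S := by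
          refine ⟨A.mul_mem (A.inv_mem (hSA hb)) hA2, k, hk, r v, Or.inr ⟨v, rfl⟩, rep z,
            Or.inr ⟨z, by show _ ∨ _; omega, rfl⟩, ?_⟩
          rw [hz]; group
        have := mul_mem hb (Subgroup.subset_closure h3)
        simpa using this
    obtain ⟨b, hb, k, hk, rfl⟩ := hmain
    have hkA : k ∈ S := by
      refine ⟨?_, k, hk, 1, Or.inl rfl, 1, Or.inl rfl, by simp⟩
      have := A.mul_mem (A.inv_mem (hSA hb)) ha
      simpa using this
    exact mul_mem hb (Subgroup.subset_closure hkA)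

end Morse

section Octahedron

/-- the Lorentz form on `ℤ^4` -/
def lB (x y : Fin 4 → ℤ) : ℤ := -(x 0 * y 0) + x 1 * y 1 + x 2 * y 2 + x 3 * y 3

/-- action of matrices on vectors -/
def act (g : GL (Fin 4) ℤ) (x : Fin 4 → ℤ) : Fin 4 → ℤ := (g : Matrix (Fin 4) (Fin 4) ℤ) *ᵥ x

theorem act_mul (g k : GL (Fin 4) ℤ) (x : Fin 4 → ℤ) : act (g * k) x = act g (act k x) := by
  simp [act, Matrix.mulVec_mulVec]

theorem act_one (x : Fin 4 → ℤ) : act 1 x = x := by simp [act]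

theorem act_inv (g : GL (Fin 4) ℤ) (x : Fin 4 → ℤ) : act g⁻¹ (act g x) = x := by
  rw [← act_mul, inv_mul_cancel, act_one]

theorem act_inv' (g : GL (Fin 4) ℤ) (x : Fin 4 → ℤ) : act g (act g⁻¹ x) = x := by
  rw [← act_mul, mul_inv_cancel, act_one]

theorem act_neg (g : GL (Fin 4) ℤ) (x : Fin 4 → ℤ) : act g (-x) = -act g x := by
  simp [act, Matrix.mulVec_neg]

theorem act_add (g : GL (Fin 4) ℤ) (x y : Fin 4 → ℤ) : act g (x + y) = act g x + act g y := by
  simp [act, Matrix.mulVec_add]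

/-- the action as a permutation -/
def actE (g : GL (Fin 4) ℤ) : (Fin 4 → ℤ) ≃ (Fin 4 → ℤ) where
  toFun := act g
  invFun := act g⁻¹
  left_inv := act_inv g
  right_inv := act_inv' g

/-- `g` preserves the Lorentz form -/
def Lor (g : GL (Fin 4) ℤ) : Prop := ∀ x y, lB (act g x) (act g y) = lB x y

theorem Lor.mul {g k : GL (Fin 4) ℤ} (hg : Lor g) (hk : Lor k) : Lor (g * k) := by
  intro x y; rw [act_mul, act_mul, hg, hk]

theorem Lor.inv {g : GL (Fin 4) ℤ} (hg : Lor g) : Lor g⁻¹ := by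
  intro x y; rw [← hg, act_inv', act_inv']

theorem Lor.one : Lor 1 := by intro x y; rw [act_one, act_one]

theorem Lor.left {g : GL (Fin 4) ℤ} (hg : Lor g) (x y) : lB (act g x) y = lB x (act g⁻¹ y) := by
  rw [← hg x (act g⁻¹ y), act_inv']

/-- the eight normals of the ideal octahedron -/
def ev : Fin 8 → Fin 4 → ℤ := ![![1, 1, 1, 1], ![1, 1, 1, -1], ![1, 1, -1, 1], ![1, 1, -1, -1],
  ![1, -1, 1, 1], ![1, -1, 1, -1], ![1, -1, -1, 1], ![1, -1, -1, -1]]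

/-- reflection matrices -/
def rm (v : Fin 8) : Matrix (Fin 4) (Fin 4) ℤ :=
  Matrix.of fun i j => (if i = j then 1 else 0) - ev v i * ((![-1, 1, 1, 1] : Fin 4 → ℤ) j * ev v j)

theorem rm_sq : ∀ v, rm v * rm v = 1 := by decide

/-- reflections -/
def rv (v : Fin 8) : GL (Fin 4) ℤ := ⟨rm v, rm v, rm_sq v, rm_sq v⟩

theorem rv_sq (v : Fin 8) : rv v * rv v = 1 := Units.ext (rm_sq v)

theorem rv_inv (v : Fin 8) : (rv v)⁻¹ = rv v := inv_eq_of_mul_eq_one_left (rv_sq v)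

theorem act_rv (v : Fin 8) (x : Fin 4 → ℤ) (i : Fin 4) :
    act (rv v) x i = x i - lB x (ev v) * ev v i := by
  simp only [act, rv, rm, Matrix.mulVec, dotProduct, Fin.sum_univ_four, Matrix.of_apply, lB]
  fin_cases i <;> simp <;> ring

theorem act_rv' (v : Fin 8) (x : Fin 4 → ℤ) : act (rv v) x = x - lB x (ev v) • ev v := by
  ext i; rw [act_rv]; simp

theorem lB_ev_self : ∀ v, lB (ev v) (ev v) = 2 := by decide

theorem lB_comm (x y) : lB x y = lB y x := by simp only [lB]; ring
theorem lB_sub_left (x y z) : lB (x - y) z = lB x z - lB y z := by simp [lB]; ring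
theorem lB_add_left (x y z) : lB (x + y) z = lB x z + lB y z := by simp [lB]; ring
theorem lB_neg_left (x z) : lB (-x) z = - lB x z := by simp [lB]; ring
theorem lB_smul_left (k : ℤ) (x z) : lB (k • x) z = k * lB x z := by simp [lB]; ring
theorem lB_sub_right (x y z) : lB x (y - z) = lB x y - lB x z := by simp [lB]; ring
theorem lB_smul_right (k : ℤ) (x z) : lB x (k • z) = k * lB x z := by simp [lB]; ring

theorem rv_lor (v : Fin 8) : Lor (rv v) := by
  intro x y
  rw [act_rv', act_rv']
  simp only [lB_sub_left, lB_sub_right, lB_smul_left, lB_smul_right, lB_ev_self,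
    lB_comm (ev v) y]
  ring

/-- the reflection group -/
def Gc : Subgroup (GL (Fin 4) ℤ) := Subgroup.closure (Set.range rv)

theorem rv_mem (v : Fin 8) : rv v ∈ Gc := Subgroup.subset_closure ⟨v, rfl⟩

theorem Gc_induction {p : GL (Fin 4) ℤ → Prop} (h1 : p 1) (hr : ∀ g ∈ Gc, ∀ v, p g → p (g * rv v))
    (g : GL (Fin 4) ℤ) (hg : g ∈ Gc) : p g := by
  induction hg using Subgroup.closure_induction_right with
  | one => exact h1
  | mul_right x hx y hy ih => obtain ⟨v, rfl⟩ := hy; exact hr x hx v ih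
  | mul_inv_cancel x hx y hy ih =>
    obtain ⟨v, rfl⟩ := hy
    rw [rv_inv]; exact hr x hx v ih

theorem Gc_lor (g : GL (Fin 4) ℤ) (hg : g ∈ Gc) : Lor g :=
  Gc_induction Lor.one (fun _ _ v ih => ih.mul (rv_lor v)) g hg

/-- sign cocycle on odd classes mod 4 -/
def sg1 (a b c d : ZMod 4) : ℤ :=
  (if a = 1 then 1 else -1) *
  (if (b = a ∧ c = a ∧ d = a) ∨ (b = a ∧ c ≠ a ∧ d ≠ a) ∨ (b = a ∧ c = a ∧ d ≠ a) ∨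
    (b ≠ a ∧ c = a ∧ d = a) then 1 else -1)

/-- colour -/
def col1 (a b c d : ZMod 4) : Bool := xor (decide (b = a)) (xor (decide (c = a)) (decide (d = a)))

/-- sign of a vector -/
def sg (e : Fin 4 → ℤ) : ℤ := sg1 (e 0) (e 1) (e 2) (e 3)
/-- colour of a vector -/
def col (e : Fin 4 → ℤ) : Bool := col1 (e 0) (e 1) (e 2) (e 3)

/-- all coordinates odd -/
def od (e : Fin 4 → ℤ) : Prop := ∀ i, e i % 2 = 1

theorem odd_zmod4 {a : ℤ} (h : a % 2 = 1) : (a : ZMod 4) = 1 ∨ (a : ZMod 4) = 3 := by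
  have : a % 4 = 1 ∨ a % 4 = 3 := by omega
  rcases this with h | h
  · left
    have := (ZMod.intCast_eq_intCast_iff a 1 4).2 (by unfold Int.ModEq; omega)
    simpa using this
  · right
    have := (ZMod.intCast_eq_intCast_iff a 3 4).2 (by unfold Int.ModEq; omega)
    simpa using this

theorem od_neg {e : Fin 4 → ℤ} (h : od e) : od (-e) := by
  intro i; have := h i; simp only [Pi.neg_apply]; omega

theorem od_ev : ∀ v, od (ev v) := by
  unfold od; decide

theorem sg_neg {e : Fin 4 → ℤ} (h : od e) : sg (-e) = - sg e := by
  simp only [sg, Pi.neg_apply, Int.cast_neg]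
  rcases odd_zmod4 (h 0) with h0 | h0 <;> rcases odd_zmod4 (h 1) with h1 | h1 <;>
  rcases odd_zmod4 (h 2) with h2 | h2 <;> rcases odd_zmod4 (h 3) with h3 | h3 <;>
  rw [h0, h1, h2, h3] <;> decide

theorem sg_val (e : Fin 4 → ℤ) : sg e = 1 ∨ sg e = -1 := by
  simp only [sg, sg1]; split_ifs <;> simp

theorem od_rv {e : Fin 4 → ℤ} (h : od e) (v : Fin 8) : od (act (rv v) e) := by
  intro i
  rw [act_rv]
  have h0 := h 0
  have h1 := h 1
  have h2 := h 2
  have h3 := h 3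
  have hi := h i
  have : ∃ k, lB e (ev v) = 2 * k := by
    have : lB e (ev v) % 2 = 0 := by
      simp only [lB]; fin_cases v <;> simp [ev] <;> omega
    exact ⟨lB e (ev v) / 2, by omega⟩
  obtain ⟨k, hk⟩ := this
  rw [hk, mul_assoc, Int.sub_emod, Int.mul_emod_right, hi]; rfl

/-- sign switch -/
def sw (b c : Bool) : ℤ := if b = c then -1 else 1

theorem sw_val (b c : Bool) : sw b c = 1 ∨ sw b c = -1 := by revert b c; decide

theorem sg_rv {e : Fin 4 → ℤ} (h : od e) (v : Fin 8) :
    sg (act (rv v) e) = sw (col e) (col (ev v)) * sg e ∧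
    col (act (rv v) e) = col e := by
  simp only [sg, col, act_rv, lB, Int.cast_sub, Int.cast_mul, Int.cast_add, Int.cast_neg]
  have h0 := odd_zmod4 (h 0)
  have h1 := odd_zmod4 (h 1)
  have h2 := odd_zmod4 (h 2)
  have h3 := odd_zmod4 (h 3)
  generalize (e 0 : ZMod 4) = a at *
  generalize (e 1 : ZMod 4) = b at *
  generalize (e 2 : ZMod 4) = c at *
  generalize (e 3 : ZMod 4) = d at *
  clear h
  rcases h0 with rfl | rfl <;> rcases h1 with rfl | rfl <;>
  rcases h2 with rfl | rfl <;> rcases h3 with rfl | rfl <;>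
  revert v <;> decide

theorem Gc_char (g : GL (Fin 4) ℤ) (hg : g ∈ Gc) : ∃ χ : Bool → ℤ, (∀ c, χ c = 1 ∨ χ c = -1) ∧
    ∀ e, od e → od (act g e) ∧ col (act g e) = col e ∧ sg (act g e) = χ (col e) * sg e := by
  refine Gc_induction (p := fun g => ∃ χ : Bool → ℤ, (∀ c, χ c = 1 ∨ χ c = -1) ∧
    ∀ e, od e → od (act g e) ∧ col (act g e) = col e ∧ sg (act g e) = χ (col e) * sg e) ?_ ?_ g hg
  · exact ⟨fun _ => 1, by simp, fun e he => by simp [act_one, he]⟩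
  · rintro g - v ⟨χ, hχ, h⟩
    refine ⟨fun c => χ c * sw c (col (ev v)), ?_, ?_⟩
    · intro c; rcases hχ c with h | h <;> rcases sw_val c (col (ev v)) with h' | h' <;> simp [h, h']
    · intro e he
      obtain ⟨a, b, c⟩ := h _ (od_rv he v)
      obtain ⟨d, f⟩ := sg_rv he v
      rw [act_mul]
      refine ⟨a, b.trans f, ?_⟩
      rw [c, f, d]; ring
end Octahedron

section Height

/-- base point -/
def xo : Fin 4 → ℤ := ![1, 0, 0, 0]

/-- future timelike -/
def Tim (y : Fin 4 → ℤ) : Prop := lB y y < 0 ∧ 0 < y 0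

theorem Tim_xo : Tim xo := by unfold Tim xo; decide

theorem Tim_rv (v : Fin 8) (y : Fin 4 → ℤ) (hy : Tim y) : Tim (act (rv v) y) := by
  refine ⟨by rw [rv_lor]; exact hy.1, ?_⟩
  obtain ⟨h1, h2⟩ := hy
  rw [act_rv]
  simp only [lB] at h1 ⊢
  have e : ∀ v : Fin 8, ev v 0 = 1 ∧ ev v 1 ^ 2 = 1 ∧ ev v 2 ^ 2 = 1 ∧ ev v 3 ^ 2 = 1 := by decide
  obtain ⟨e0, e1, e2, e3⟩ := e v
  rw [e0]
  generalize ev v 1 = a at *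
  generalize ev v 2 = b at *
  generalize ev v 3 = c at *
  by_contra hc
  have h3 : 2 * y 0 ≤ y 1 * a + y 2 * b + y 3 * c := by linarith
  have h4 : (2 * y 0) ^ 2 ≤ (y 1 * a + y 2 * b + y 3 * c) ^ 2 := by
    apply pow_le_pow_left₀ (by linarith) h3
  have h5 : (y 1 * a + y 2 * b + y 3 * c) ^ 2 ≤ 3 * (y 1 ^ 2 * a ^ 2 + y 2 ^ 2 * b ^ 2 + y 3 ^ 2 * c ^ 2) := by
    nlinarith [sq_nonneg (y 1 * a - y 2 * b), sq_nonneg (y 1 * a - y 3 * c), sq_nonneg (y 2 * b - y 3 * c)]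
  rw [e1, e2, e3] at h5
  nlinarith

theorem Tim_Gc {g : GL (Fin 4) ℤ} (hg : g ∈ Gc) : ∀ y, Tim y → Tim (act g y) :=
  Gc_induction (p := fun g => ∀ y, Tim y → Tim (act g y)) (fun y hy => by rwa [act_one])
    (fun g _ v ih y hy => by rw [act_mul]; exact ih _ (Tim_rv v y hy)) g hg

theorem cross_bound {k : ℤ} {y e : Fin 4 → ℤ} (hy : Tim y) (he : lB e e = k)
    (hs : Int.sign (lB e xo) ≠ Int.sign (lB e y)) :
    (e 0) ^ 2 ≤ |k| * (y 1 ^ 2 + y 2 ^ 2 + y 3 ^ 2) := by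
  obtain ⟨h1, h2⟩ := hy
  have hp : lB e xo * lB e y ≤ 0 := by
    by_contra hc
    push Not at hc
    apply hs
    rcases pos_and_pos_or_neg_and_neg_of_mul_pos hc with ⟨ha, hb⟩ | ⟨ha, hb⟩
    · rw [Int.sign_eq_one_of_pos ha, Int.sign_eq_one_of_pos hb]
    · rw [Int.sign_eq_neg_one_of_neg ha, Int.sign_eq_neg_one_of_neg hb]
  have hx : lB e xo = - e 0 := by simp [lB, xo]
  rw [hx] at hp
  simp only [lB] at hp h1 he
  have hk := le_abs_self k
  generalize |k| = K at *
  generalize e 0 = e0 at *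
  generalize e 1 = a at *
  generalize e 2 = b at *
  generalize e 3 = c at *
  generalize y 0 = y0 at *
  generalize y 1 = p at *
  generalize y 2 = q at *
  generalize y 3 = r at *
  have hcs : (a * p + b * q + c * r) ^ 2 ≤ (a ^ 2 + b ^ 2 + c ^ 2) * (p ^ 2 + q ^ 2 + r ^ 2) := by
    nlinarith [sq_nonneg (a * q - b * p), sq_nonneg (a * r - c * p), sq_nonneg (b * r - c * q)]
  have hn : 0 ≤ p ^ 2 + q ^ 2 + r ^ 2 := by positivity
  by_cases h0 : e0 = 0
  · subst h0
    have : a ^ 2 + b ^ 2 + c ^ 2 ≤ K := by linarith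
    have : 0 ≤ K := by nlinarith [sq_nonneg a, sq_nonneg b, sq_nonneg c]
    nlinarith
  have hA : e0 ^ 2 * y0 ≤ e0 * (a * p + b * q + c * r) := by nlinarith
  have hB : (e0 ^ 2 * y0) ^ 2 ≤ (e0 * (a * p + b * q + c * r)) ^ 2 :=
    pow_le_pow_left₀ (by positivity) hA 2
  have hC : e0 ^ 2 * (e0 ^ 2 * y0 ^ 2) ≤ e0 ^ 2 * (a * p + b * q + c * r) ^ 2 := by
    linarith [hB, show (e0 ^ 2 * y0) ^ 2 = e0 ^ 2 * (e0 ^ 2 * y0 ^ 2) by ring,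
      show (e0 * (a * p + b * q + c * r)) ^ 2 = e0 ^ 2 * (a * p + b * q + c * r) ^ 2 by ring]
  have hD : e0 ^ 2 * y0 ^ 2 ≤ (a * p + b * q + c * r) ^ 2 := le_of_mul_le_mul_left hC (by positivity)
  have hE : a ^ 2 + b ^ 2 + c ^ 2 = e0 ^ 2 + k := by linarith
  rw [hE] at hcs
  have hF : p ^ 2 + q ^ 2 + r ^ 2 + 1 ≤ y0 ^ 2 := by linarith
  nlinarith [sq_nonneg e0, mul_le_mul_of_nonneg_left hF (sq_nonneg e0)]

theorem cross_finite0 (k : ℤ) {y : Fin 4 → ℤ} (hy : Tim y) :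
    {e : Fin 4 → ℤ | lB e e = k ∧ Int.sign (lB e xo) ≠ Int.sign (lB e y)}.Finite := by
  set D : ℤ := |k| * (y 1 ^ 2 + y 2 ^ 2 + y 3 ^ 2) + |k| with hD
  refine (Set.finite_Icc (fun _ : Fin 4 => -D) (fun _ => D)).subset ?_
  rintro e ⟨he, hs⟩
  have hb := cross_bound hy he hs
  have hk := le_abs_self k
  have hk0 := abs_nonneg k
  simp only [lB] at he
  have hall : ∀ i, e i ^ 2 ≤ D := by
    intro i
    fin_cases i <;> simp <;>
      nlinarith [sq_nonneg (e 1), sq_nonneg (e 2), sq_nonneg (e 3), sq_nonneg (e 0)]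
  have : ∀ i, |e i| ≤ D := fun i => by
    have h1 := hall i
    rcases abs_cases (e i) with ⟨h, _⟩ | ⟨h, _⟩ <;> rw [h] <;> nlinarith
  constructor
  · intro i; exact (abs_le.1 (this i)).1
  · intro i; exact (abs_le.1 (this i)).2

theorem cross_finite (k : ℤ) {y z : Fin 4 → ℤ} (hy : Tim y) (hz : Tim z) :
    {e : Fin 4 → ℤ | lB e e = k ∧ Int.sign (lB e y) ≠ Int.sign (lB e z)}.Finite := by
  refine ((cross_finite0 k hy).union (cross_finite0 k hz)).subset ?_
  rintro e ⟨he, hs⟩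
  by_cases h : Int.sign (lB e xo) = Int.sign (lB e y)
  · right; exact ⟨he, fun h' => hs (h ▸ h')⟩
  · left; exact ⟨he, h⟩

open Classical in
/-- weight -/
noncomputable def Wt (e : Fin 4 → ℤ) : ℤ := if od e then sg e else 0

/-- contribution of a wall -/
noncomputable def ct (w : (Fin 4 → ℤ) → ℤ) (y z e : Fin 4 → ℤ) : ℤ :=
  if lB e e = 2 then w e * (Int.sign (lB e z) - Int.sign (lB e y)) else 0

/-- signed crossing number -/
noncomputable def hh (w : (Fin 4 → ℤ) → ℤ) (y z : Fin 4 → ℤ) : ℤ := ∑ᶠ e, ct w y z e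

theorem ct_supp (w) {y z : Fin 4 → ℤ} (hy : Tim y) (hz : Tim z) :
    (Function.support (ct w y z)).Finite := by
  refine (cross_finite 2 hy hz).subset ?_
  intro e he
  rw [Function.mem_support, ct] at he
  split_ifs at he with h
  · refine ⟨h, fun h' => he ?_⟩
    rw [h']; simp
  · simp at he

theorem hh_add (w) {x y z : Fin 4 → ℤ} (hx : Tim x) (hy : Tim y) (hz : Tim z) :
    hh w x z = hh w x y + hh w y z := by
  unfold hh
  rw [← finsum_add_distrib (ct_supp w hx hy) (ct_supp w hy hz)]
  apply finsum_congr
  intro e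
  unfold ct
  split_ifs <;> ring

theorem hh_self (w) (x : Fin 4 → ℤ) : hh w x x = 0 := by
  unfold hh ct; simp

theorem hh_act (w) {g : GL (Fin 4) ℤ} (hg : Lor g) (y z : Fin 4 → ℤ) :
    hh w (act g y) (act g z) = hh (fun e => w (act g e)) y z := by
  unfold hh
  rw [← finsum_comp_equiv (actE g)]
  apply finsum_congr
  intro e
  show ct w (act g y) (act g z) (act g e) = _
  simp only [ct, hg _ _]

theorem sq_le_three {b : ℤ} (h : b ^ 2 ≤ 3) : -2 < b ∧ b < 2 := by constructor <;> nlinarith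

theorem cross_arith {s0 s1 s2 s3 a b c d : ℤ} (E0 : s0 = 1) (E1 : s1 = 1 ∨ s1 = -1)
    (E2 : s2 = 1 ∨ s2 = -1) (E3 : s3 = 1 ∨ s3 = -1) (o0 : a % 2 = 1) (o1 : b % 2 = 1)
    (o2 : c % 2 = 1) (o3 : d % 2 = 1) (hpos : 0 < a)
    (he : -(a * a) + b * b + c * c + d * d = 2) (h1 : 2 * a ≤ b * s1 + c * s2 + d * s3) :
    a = s0 ∧ b = s1 ∧ c = s2 ∧ d = s3 := by
  have q1 : s1 ^ 2 = 1 := by rcases E1 with rfl | rfl <;> norm_num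
  have q2 : s2 ^ 2 = 1 := by rcases E2 with rfl | rfl <;> norm_num
  have q3 : s3 ^ 2 = 1 := by rcases E3 with rfl | rfl <;> norm_num
  have h4 : (2 * a) ^ 2 ≤ (b * s1 + c * s2 + d * s3) ^ 2 := pow_le_pow_left₀ (by linarith) h1 2
  have h5 : (b * s1 + c * s2 + d * s3) ^ 2 ≤ 3 * (b ^ 2 * s1 ^ 2 + c ^ 2 * s2 ^ 2 + d ^ 2 * s3 ^ 2) := by
    linarith [sq_nonneg (b * s1 - c * s2), sq_nonneg (b * s1 - d * s3), sq_nonneg (c * s2 - d * s3)]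
  rw [q1, q2, q3] at h5
  have h6 : a ^ 2 ≤ 6 := by linarith
  have h7 : a < 3 := by nlinarith
  have h8 : a = 1 := by omega
  subst h8
  obtain ⟨hb1, hb2⟩ := sq_le_three (b := b) (by linarith [sq_nonneg c, sq_nonneg d])
  obtain ⟨hc1, hc2⟩ := sq_le_three (b := c) (by linarith [sq_nonneg b, sq_nonneg d])
  obtain ⟨hd1, hd2⟩ := sq_le_three (b := d) (by linarith [sq_nonneg c, sq_nonneg b])
  clear h4 h5 h6 q1 q2 q3 he
  rcases E1 with rfl | rfl <;> rcases E2 with rfl | rfl <;> rcases E3 with rfl | rfl <;> omega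

theorem cross_rv (v : Fin 8) (e : Fin 4 → ℤ) (ho : od e) (he : lB e e = 2)
    (hs : Int.sign (lB e (act (rv v) xo)) ≠ Int.sign (lB e xo)) : e = ev v ∨ e = -ev v := by
  have main : ∀ e : Fin 4 → ℤ, od e → lB e e = 2 → 0 < e 0 →
      Int.sign (lB e (act (rv v) xo)) ≠ Int.sign (lB e xo) → e = ev v := by
    clear hs he ho e
    intro e ho he hpos hs
    have hx : lB e xo = - e 0 := by simp [lB, xo]
    have hv : ∀ v : Fin 8, ∀ i, act (rv v) xo i = xo i + ev v i := by decide
    have hy : lB e (act (rv v) xo) = - (2 * e 0) + e 1 * ev v 1 + e 2 * ev v 2 + e 3 * ev v 3 := by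
      have e0 : ∀ v : Fin 8, ev v 0 = 1 := by decide
      simp only [lB, hv, e0]; simp [xo]; ring
    rw [hx, Int.sign_eq_neg_one_of_neg (show -e 0 < 0 by linarith), hy] at hs
    have h1 : 2 * e 0 ≤ e 1 * ev v 1 + e 2 * ev v 2 + e 3 * ev v 3 := by
      by_contra hc
      exact hs (Int.sign_eq_neg_one_of_neg (by linarith))
    have E : ∀ v : Fin 8, ev v 0 = 1 ∧ (ev v 1 = 1 ∨ ev v 1 = -1) ∧ (ev v 2 = 1 ∨ ev v 2 = -1) ∧
      (ev v 3 = 1 ∨ ev v 3 = -1) := by decide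
    obtain ⟨E0, E1, E2, E3⟩ := E v
    have o0 := ho 0
    have o1 := ho 1
    have o2 := ho 2
    have o3 := ho 3
    simp only [lB] at he
    have key : e 0 = ev v 0 ∧ e 1 = ev v 1 ∧ e 2 = ev v 2 ∧ e 3 = ev v 3 := by
      exact cross_arith E0 E1 E2 E3 o0 o1 o2 o3 hpos he h1
    obtain ⟨k0, k1, k2, k3⟩ := key
    ext i; fin_cases i <;> assumption
  have o0 := ho 0
  rcases lt_trichotomy (e 0) 0 with h | h | h
  · right
    have := main (-e) (od_neg ho) (by rw [lB_neg_left, lB_comm, lB_neg_left, he]; norm_num)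
      (by simpa using h) (by rw [lB_neg_left, lB_neg_left, Int.sign_neg, Int.sign_neg]; simpa using hs)
    rw [← this, neg_neg]
  · omega
  · left; exact main e ho he h hs

end Height

section KernelGroup

theorem Wt_neg (e : Fin 4 → ℤ) : Wt (-e) = - Wt e := by
  unfold Wt
  by_cases h : od e
  · rw [if_pos h, if_pos (od_neg h), sg_neg h]
  · rw [if_neg h, if_neg (fun h' => h (by simpa using od_neg h'))]; rfl

theorem ev_ne_neg : ∀ v, ev v ≠ - ev v := by decide

theorem hh_step {g : GL (Fin 4) ℤ} (hg : g ∈ Gc) (v : Fin 8) :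
    hh Wt (act g xo) (act (g * rv v) xo) = 4 * sg (act g (ev v)) := by
  obtain ⟨χ, -, hχ⟩ := Gc_char g hg
  rw [act_mul, hh_act _ (Gc_lor g hg), hh]
  rw [finsum_eq_sum_of_support_subset (s := {ev v, -ev v})]
  · rw [Finset.sum_pair (ev_ne_neg v)]
    have h1 : lB (ev v) (act (rv v) xo) = 1 := by revert v; decide
    have h2 : lB (ev v) xo = -1 := by revert v; decide
    have h3 : lB (-ev v) (-ev v) = 2 := by revert v; decide
    have h4 : Wt (act g (ev v)) = sg (act g (ev v)) := by
      rw [Wt, if_pos (hχ _ (od_ev v)).1]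
    simp only [ct, lB_ev_self, h3, if_true, lB_neg_left, h1, h2, act_neg, Wt_neg, h4]
    simp; ring
  · intro e he
    rw [Function.mem_support, ct] at he
    split_ifs at he with h
    · have hs : Int.sign (lB e (act (rv v) xo)) ≠ Int.sign (lB e xo) := by
        intro h'; apply he; rw [h']; simp
      have ho : od e := by
        by_contra hc
        apply he
        rw [Wt, if_neg, zero_mul]
        intro h'
        apply hc
        obtain ⟨χ', -, hχ'⟩ := Gc_char g⁻¹ (inv_mem hg)
        simpa [act_inv] using (hχ' _ h').1
      simpa using cross_rv v e ho h hs
    · exact absurd rfl he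

theorem hh_dvd {g : GL (Fin 4) ℤ} (hg : g ∈ Gc) : 4 ∣ hh Wt xo (act g xo) := by
  refine Gc_induction (p := fun g => 4 ∣ hh Wt xo (act g xo)) ?_ ?_ g hg
  · rw [act_one, hh_self]; exact dvd_zero _
  · intro g hg v ih
    rw [hh_add Wt Tim_xo (Tim_Gc hg _ Tim_xo) (Tim_Gc (mul_mem hg (rv_mem v)) _ Tim_xo), hh_step hg]
    exact dvd_add ih (dvd_mul_right _ _)

/-- weight preserving elements -/
def Gam : Subgroup (GL (Fin 4) ℤ) where
  carrier := {g | g ∈ Gc ∧ ∀ e, Wt (act g e) = Wt e}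
  one_mem' := ⟨one_mem _, fun e => by rw [act_one]⟩
  mul_mem' := fun {a b} ha hb => ⟨mul_mem ha.1 hb.1, fun e => by rw [act_mul, ha.2, hb.2]⟩
  inv_mem' := fun {a} ha => ⟨inv_mem ha.1, fun e => by rw [← ha.2, act_inv']⟩

theorem hh_Gam {g : GL (Fin 4) ℤ} (hg : g ∈ Gam) (y z : Fin 4 → ℤ) :
    hh Wt (act g y) (act g z) = hh Wt y z := by
  rw [hh_act _ (Gc_lor g hg.1)]; simp only [hg.2]

/-- height -/
noncomputable def ht (g : GL (Fin 4) ℤ) : ℤ := hh Wt xo (act g xo)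

theorem ht_mul {a g : GL (Fin 4) ℤ} (ha : a ∈ Gam) (hg : g ∈ Gc) : ht (a * g) = ht a + ht g := by
  unfold ht
  rw [hh_add Wt Tim_xo (Tim_Gc ha.1 _ Tim_xo) (Tim_Gc (mul_mem ha.1 hg) _ Tim_xo), act_mul,
    hh_Gam ha]

theorem ht_one : ht 1 = 0 := by unfold ht; rw [act_one, hh_self]

theorem ht_inv {a : GL (Fin 4) ℤ} (ha : a ∈ Gam) : ht a⁻¹ = - ht a := by
  have := ht_mul ha (inv_mem ha.1)
  rw [mul_inv_cancel, ht_one] at this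
  linarith

/-- the kernel -/
noncomputable def A0 : Subgroup (GL (Fin 4) ℤ) where
  carrier := {g | g ∈ Gam ∧ ht g = 0}
  one_mem' := ⟨one_mem _, ht_one⟩
  mul_mem' := fun {a b} ha hb => ⟨mul_mem ha.1 hb.1, by rw [ht_mul ha.1 hb.1.1, ha.2, hb.2]; rfl⟩
  inv_mem' := fun {a} ha => ⟨inv_mem ha.1, by rw [ht_inv ha.1, ha.2]; rfl⟩

theorem rm_comm : ∀ v w, lB (ev v) (ev w) = 0 → rm v * rm w = rm w * rm v := by decide

theorem rv_comm (v w : Fin 8) (h : lB (ev v) (ev w) = 0) : rv v * rv w = rv w * rv v :=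
  Units.ext (rm_comm v w h)

/-- status with given character values -/
def stb (x y : Bool) (v : Fin 8) : Bool :=
  xor (bif col (ev v) then x else y) (decide (sg (ev v) = 1))

theorem conn_dec : ∀ x y ε : Bool, ∀ v w : Fin 8, stb x y v = ε → stb x y w = ε →
    ∃ a, stb x y a = ε ∧ (v = a ∨ lB (ev v) (ev a) = 0) ∧ ∃ b, stb x y b = ε ∧
      (a = b ∨ lB (ev a) (ev b) = 0) ∧ (b = w ∨ lB (ev b) (ev w) = 0) := by
  decide +kernel

theorem sgn_ext {a b : ℤ} (ha : a = 1 ∨ a = -1) (hb : b = 1 ∨ b = -1)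
    (h : decide (a = 1) = decide (b = 1)) : a = b := by
  rcases ha with rfl | rfl <;> rcases hb with rfl | rfl <;> simp_all

theorem stb_spec {χ : Bool → ℤ} (hχ : ∀ c, χ c = 1 ∨ χ c = -1) (v : Fin 8) :
    decide (χ (col (ev v)) * sg (ev v) = 1) = stb (! decide (χ true = 1)) (! decide (χ false = 1)) v := by
  unfold stb
  cases col (ev v)
  · rcases hχ false with h | h <;> rcases sg_val (ev v) with h' | h' <;> simp [h, h']
  · rcases hχ true with h | h <;> rcases sg_val (ev v) with h' | h' <;> simp [h, h']

/-- connectivity of the ascending and descending links -/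
theorem conn_sg {g : GL (Fin 4) ℤ} (hg : g ∈ Gc) (ε : ℤ) (v w : Fin 8)
    (hv : sg (act g (ev v)) = ε) (hw : sg (act g (ev w)) = ε) :
    Relation.ReflTransGen (fun a b => lB (ev a) (ev b) = 0 ∧ sg (act g (ev a)) = ε ∧
      sg (act g (ev b)) = ε) v w := by
  obtain ⟨χ, h1, h2⟩ := Gc_char g hg
  have hε : ε = 1 ∨ ε = -1 := hv ▸ sg_val _
  have hst : ∀ v, sg (act g (ev v)) = ε ↔
      stb (! decide (χ true = 1)) (! decide (χ false = 1)) v = decide (ε = 1) := by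
    intro v
    rw [← stb_spec h1, ← (h2 _ (od_ev v)).2.2]
    constructor
    · rintro rfl; rfl
    · exact sgn_ext (sg_val _) hε
  obtain ⟨a, ha, hva, b, hb, hab, hbw⟩ := conn_dec _ _ _ v w ((hst v).1 hv) ((hst w).1 hw)
  rw [← hst] at ha hb
  have step : ∀ a b, sg (act g (ev a)) = ε → sg (act g (ev b)) = ε → (a = b ∨ lB (ev a) (ev b) = 0) →
      Relation.ReflTransGen (fun a b => lB (ev a) (ev b) = 0 ∧ sg (act g (ev a)) = ε ∧
      sg (act g (ev b)) = ε) a b := by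
    rintro a b ha hb (rfl | h)
    · exact .refl
    · exact .single ⟨h, ha, hb⟩
  exact ((step _ _ hv ha hva).trans (step _ _ ha hb hab)).trans (step _ _ hb hw hbw)

theorem A0_le_Gc : A0 ≤ Gc := fun _ h => h.1.1

theorem mem_Gam_of_sg {g k : GL (Fin 4) ℤ} (hg : g ∈ Gc) (hk : k ∈ Gc)
    (h : ∀ v, sg (act g (ev v)) = sg (act k (ev v))) : g * k⁻¹ ∈ Gam := by
  obtain ⟨χ, h1, h2⟩ := Gc_char g hg
  obtain ⟨χ', h1', h2'⟩ := Gc_char k hk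
  obtain ⟨χi, -, h2i⟩ := Gc_char k⁻¹ (inv_mem hk)
  have hχ : χ = χ' := by
    have h0 := h 0
    have h01 := h 1
    rw [(h2 _ (od_ev _)).2.2, (h2' _ (od_ev _)).2.2] at h0 h01
    have c0 : col (ev 0) = true := by decide
    have c1 : col (ev 1) = false := by decide
    have s0 : sg (ev 0) = 1 := by decide
    have s1 : sg (ev 1) = 1 ∨ sg (ev 1) = -1 := by decide
    rw [c0, s0] at h0
    rw [c1] at h01
    funext c
    cases c
    · rcases s1 with s1 | s1 <;> rw [s1] at h01 <;> linarith
    · linarith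
  refine ⟨mul_mem hg (inv_mem hk), fun e => ?_⟩
  have hgo : ∀ e, od (act g e) → od e := fun e he => by
    obtain ⟨χ', -, hχ'⟩ := Gc_char g⁻¹ (inv_mem hg)
    simpa [act_inv] using (hχ' _ he).1
  by_cases ho : od e
  · have hi := (h2i e ho).1
    rw [Wt, Wt, if_pos ho, act_mul, if_pos (h2 _ hi).1, (h2 _ hi).2.2, hχ, ← (h2' _ hi).2.2, act_inv']
  · rw [Wt, Wt, if_neg ho, if_neg]
    intro h'
    rw [act_mul] at h'
    apply ho
    have := (h2' _ (hgo _ h')).1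
    rwa [act_inv'] at this

theorem fg_map {G K : Type*} [Group G] [Group K] (f : G →* K) {H : Subgroup G} (h : H.FG) :
    (H.map f).FG := by
  classical
  obtain ⟨S, hS⟩ := h
  exact ⟨S.image f, by rw [Finset.coe_image, ← MonoidHom.map_closure, hS]⟩

theorem A0_fg : A0.FG := by
  have key : (A0.subgroupOf Gc).FG := by
    refine morse_fg (V := Fin 8) (G := Gc) (fun v => ⟨rv v, rv_mem v⟩) (fun v => Subtype.ext (rv_sq v))
      ?_ (fun g => ht g / 4) (fun g v => sg (act g (ev v))) (fun g v => sg_val _) ?_ ?_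
      (fun v w => lB (ev v) (ev w) = 0) ?_ ?_ _ ?_ ?_
    · have := Subgroup.closure_closure_coe_preimage (k := Set.range rv)
      refine Eq.trans ?_ this
      congr 1
      ext ⟨x, hx⟩
      simp [Subtype.ext_iff]
      rfl
    · rintro ⟨g, hg⟩ v
      show ht (g * rv v) / 4 = ht g / 4 + sg (act g (ev v))
      unfold ht
      rw [hh_add Wt Tim_xo (Tim_Gc hg _ Tim_xo) (Tim_Gc (mul_mem hg (rv_mem v)) _ Tim_xo), hh_step hg]
      omega
    · show ht 1 / 4 = 0
      rw [ht_one]; rfl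
    · intro v w h
      refine ⟨Subtype.ext (rv_comm v w h), ?_⟩
      rintro ⟨g, hg⟩
      show sg (act (g * rv v) (ev w)) = sg (act g (ev w))
      rw [act_mul, act_rv', lB_comm, h, zero_smul, sub_zero]
    · rintro ε ⟨g, hg⟩ v w hv hw
      exact conn_sg hg ε v w hv hw
    · rintro ⟨a, ha⟩ hA ⟨g, hg⟩
      rw [Subgroup.mem_subgroupOf] at hA
      show ht (a * g) / 4 = ht g / 4
      rw [ht_mul hA.1 hg, hA.2, zero_add]
    · rintro ⟨g, hg⟩ ⟨k, hk⟩ h1 h2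
      rw [Subgroup.mem_subgroupOf]
      have hG := mem_Gam_of_sg hg hk (fun v => congrFun h2 v)
      refine ⟨hG, ?_⟩
      have := ht_mul hG hk
      rw [inv_mul_cancel_right] at this
      change ht g / 4 = ht k / 4 at h1
      have d1 : 4 ∣ ht g := hh_dvd hg
      have d2 : 4 ∣ ht k := hh_dvd hk
      show ht (g * k⁻¹) = 0
      omega
  have h2 := fg_map Gc.subtype key
  rwa [Subgroup.subgroupOf_map_subtype, inf_eq_left.2 A0_le_Gc] at h2

end KernelGroup

section NotFG

/-- the fixed spacelike vector -/
def e1 : Fin 4 → ℤ := ![0, 1, 1, 1]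
/-- auxiliary vector of norm 6 -/
def e6 : Fin 4 → ℤ := ![0, 1, 1, -2]

/-- matrix of the symmetry -/
def taum : Matrix (Fin 4) (Fin 4) ℤ := !![1, 0, 0, 0; 0, 0, -1, 0; 0, -1, 0, 0; 0, 0, 0, -1]
theorem taum_sq : taum * taum = 1 := by decide
/-- the symmetry -/
def tau : GL (Fin 4) ℤ := ⟨taum, taum, taum_sq, taum_sq⟩

theorem act_tau (x : Fin 4 → ℤ) : act tau x = ![x 0, - x 2, - x 1, - x 3] := by
  ext i
  simp only [act, tau, taum, Matrix.mulVec, dotProduct, Fin.sum_univ_four]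
  fin_cases i <;> simp

theorem tau_lor : Lor tau := by
  intro x y
  rw [act_tau, act_tau]; simp [lB]; ring

theorem od_tau {e : Fin 4 → ℤ} (h : od e) : od (act tau e) := by
  rw [act_tau]
  intro i
  have h0 := h 0
  have h1 := h 1
  have h2 := h 2
  have h3 := h 3
  fin_cases i <;> simp <;> omega

theorem Wt_tau (e : Fin 4 → ℤ) : Wt (act tau e) = - Wt e := by
  by_cases h : od e
  · rw [Wt, Wt, if_pos h, if_pos (od_tau h), act_tau]
    have h0 := odd_zmod4 (h 0)
    have h1 := odd_zmod4 (h 1)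
    have h2 := odd_zmod4 (h 2)
    have h3 := odd_zmod4 (h 3)
    simp only [sg, Matrix.cons_val, Int.cast_neg]
    generalize (e 0 : ZMod 4) = a at *
    generalize (e 1 : ZMod 4) = b at *
    generalize (e 2 : ZMod 4) = c at *
    generalize (e 3 : ZMod 4) = d at *
    rcases h0 with rfl | rfl <;> rcases h1 with rfl | rfl <;>
    rcases h2 with rfl | rfl <;> rcases h3 with rfl | rfl <;> decide
  · rw [Wt, Wt, if_neg h, if_neg, neg_zero]
    intro h'
    have := od_tau h'
    rw [← act_mul] at this
    rw [show tau * tau = 1 from Units.ext taum_sq, act_one] at this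
    exact h this

theorem hh_neg (w) (y z : Fin 4 → ℤ) : hh (fun e => - w e) y z = - hh w y z := by
  unfold hh
  rw [← finsum_neg_distrib]
  apply finsum_congr
  intro e
  unfold ct
  split_ifs <;> ring

theorem ht_fix {g : GL (Fin 4) ℤ} (hg : g ∈ Gam) (h1 : act g e1 = e1) (h6 : act g e6 = e6) :
    ht g = 0 := by
  have l := Gc_lor g hg.1
  have o1 : lB e1 (act g xo) = 0 := by rw [← h1, l]; decide
  have o6 : lB e6 (act g xo) = 0 := by rw [← h6, l]; decide
  have hfix : act tau (act g xo) = act g xo := by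
    rw [act_tau]
    generalize act g xo = y at *
    simp [lB, e1, e6] at o1 o6
    ext i; fin_cases i <;> simp <;> linarith
  have hx : act tau xo = xo := by decide
  have := hh_act Wt tau_lor xo (act g xo)
  rw [hfix, hx] at this
  simp only [Wt_tau] at this
  rw [hh_neg] at this
  unfold ht
  linarith

theorem ht_step {g : GL (Fin 4) ℤ} (hg : g ∈ Gc) (v : Fin 8) :
    ht (g * rv v) = ht g + 4 * sg (act g (ev v)) := by
  unfold ht
  rw [hh_add Wt Tim_xo (Tim_Gc hg _ Tim_xo) (Tim_Gc (mul_mem hg (rv_mem v)) _ Tim_xo), hh_step hg]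

/-- word in the generators -/
def wd : List (Fin 8) → GL (Fin 4) ℤ → GL (Fin 4) ℤ
  | [], g => g
  | v :: l, g => wd l (g * rv v)

/-- height change along a word -/
def wh : List (Fin 8) → GL (Fin 4) ℤ → ℤ
  | [], _ => 0
  | v :: l, g => 4 * sg (act g (ev v)) + wh l (g * rv v)

theorem wd_mem (l : List (Fin 8)) : ∀ g ∈ Gc, wd l g ∈ Gc := by
  induction l with
  | nil => intro g hg; exact hg
  | cons v l ih => intro g hg; exact ih _ (mul_mem hg (rv_mem v))

theorem ht_wd (l : List (Fin 8)) : ∀ g ∈ Gc, ht (wd l g) = ht g + wh l g := by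
  induction l with
  | nil => intro g hg; simp [wd, wh]
  | cons v l ih =>
    intro g hg
    rw [wd, wh, ih _ (mul_mem hg (rv_mem v)), ht_step hg]; ring

theorem wd_Gam (l : List (Fin 8)) (h : ∀ v, sg (act (wd l 1) (ev v)) = sg (ev v)) :
    wd l 1 ∈ Gam := by
  have := mem_Gam_of_sg (wd_mem l 1 (one_mem _)) (one_mem Gc) (fun v => by rw [h, act_one])
  simpa using this

/-- stabilizer -/
noncomputable def C0 : Subgroup (GL (Fin 4) ℤ) where
  carrier := {g | g ∈ A0 ∧ act g e1 = e1}
  one_mem' := ⟨one_mem _, act_one _⟩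
  mul_mem' := fun {a b} ha hb => ⟨mul_mem ha.1 hb.1, by rw [act_mul, hb.2, ha.2]⟩
  inv_mem' := fun {a} ha => ⟨inv_mem ha.1, by nth_rw 1 [← ha.2]; rw [act_inv]⟩

/-- stabilizer in the big group -/
noncomputable def Ct : Subgroup (GL (Fin 4) ℤ) where
  carrier := {g | g ∈ Gam ∧ act g e1 = e1}
  one_mem' := ⟨one_mem _, act_one _⟩
  mul_mem' := fun {a b} ha hb => ⟨mul_mem ha.1 hb.1, by rw [act_mul, hb.2, ha.2]⟩
  inv_mem' := fun {a} ha => ⟨inv_mem ha.1, by nth_rw 1 [← ha.2]; rw [act_inv]⟩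

theorem C0_le : C0 ≤ Ct := fun _ h => ⟨h.1.1, h.2⟩

theorem ht_Ct {a b : GL (Fin 4) ℤ} (ha : a ∈ Ct) (hb : b ∈ Ct) : ht (a * b) = ht a + ht b :=
  ht_mul ha.1 hb.1.1

theorem C0_conj {t c : GL (Fin 4) ℤ} (ht' : t ∈ Ct) (hc : c ∈ C0) : t * c * t⁻¹ ∈ C0 := by
  have h1 : t * c * t⁻¹ ∈ Ct := mul_mem (mul_mem ht' (C0_le hc)) (inv_mem ht')
  refine ⟨⟨h1.1, ?_⟩, h1.2⟩
  rw [ht_Ct (mul_mem ht' (C0_le hc)) (inv_mem ht'), ht_Ct ht' (C0_le hc), ht_inv ht'.1, hc.1.2]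
  ring

/-- the hyperbolic translation -/
def tt : GL (Fin 4) ℤ := wd [1, 3, 4, 6] 1
/-- first witness -/
def w1 : GL (Fin 4) ℤ := wd [2, 6, 5, 3, 4, 6] 1
/-- second witness -/
def w2 : GL (Fin 4) ℤ := wd [1, 3, 4, 2, 1, 5] 1

theorem tt_mem : tt ∈ Ct := ⟨wd_Gam _ (by decide +kernel), by decide +kernel⟩

theorem tt_ht : ht tt = 8 := by
  rw [tt, ht_wd _ _ (one_mem _), ht_one]; decide +kernel

theorem w1_mem : w1 ∈ C0 := by
  refine ⟨⟨wd_Gam _ (by decide +kernel), ?_⟩, by decide +kernel⟩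
  show ht (wd _ _) = 0
  rw [ht_wd _ _ (one_mem _), ht_one]; decide +kernel

theorem w2_mem : w2 ∈ C0 := by
  refine ⟨⟨wd_Gam _ (by decide +kernel), ?_⟩, by decide +kernel⟩
  show ht (wd _ _) = 0
  rw [ht_wd _ _ (one_mem _), ht_one]; decide +kernel

theorem w1_e6 : e6 + act w1 e6 = ![288, 26, -214, 188] := by decide +kernel
theorem w2_e6 : -(e6 + act w2 e6) = ![288, 214, -26, -188] := by decide +kernel

theorem Tim_neg {x y : Fin 4 → ℤ} (hx : Tim x) (hy : Tim y) : lB x y < 0 := by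
  obtain ⟨h1, h2⟩ := hx
  obtain ⟨h3, h4⟩ := hy
  simp only [lB] at *
  generalize x 0 = x0 at *
  generalize x 1 = a at *
  generalize x 2 = b at *
  generalize x 3 = c at *
  generalize y 0 = y0 at *
  generalize y 1 = p at *
  generalize y 2 = q at *
  generalize y 3 = r at *
  by_contra hc
  have hA : x0 * y0 ≤ a * p + b * q + c * r := by linarith
  have hB : (x0 * y0) ^ 2 ≤ (a * p + b * q + c * r) ^ 2 := pow_le_pow_left₀ (by positivity) hA 2
  have hcs : (a * p + b * q + c * r) ^ 2 ≤ (a ^ 2 + b ^ 2 + c ^ 2) * (p ^ 2 + q ^ 2 + r ^ 2) := by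
    linarith [sq_nonneg (a * q - b * p), sq_nonneg (a * r - c * p), sq_nonneg (b * r - c * q)]
  have h5 : (a ^ 2 + b ^ 2 + c ^ 2) * (p ^ 2 + q ^ 2 + r ^ 2) < x0 ^ 2 * y0 ^ 2 := by
    apply mul_lt_mul'' <;> first | positivity | linarith
  nlinarith

theorem ht_zpow (k : ℤ) : ht (tt ^ k) = 8 * k := by
  have hn : ∀ n : ℕ, ht (tt ^ n) = 8 * n := by
    intro n
    induction n with
    | zero => simp [ht_one]
    | succ n ih => rw [pow_succ, ht_Ct (pow_mem tt_mem n) tt_mem, ih, tt_ht]; push_cast; ring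
  cases k with
  | ofNat n => simpa using hn n
  | negSucc n =>
    rw [zpow_negSucc, ht_inv (pow_mem tt_mem _).1, hn]; rw [Int.negSucc_eq]; push_cast; ring

theorem C0_not_fg : ¬ C0.FG := by
  rintro ⟨S, hS⟩
  have hSm : ∀ s ∈ S, s ∈ C0 := fun s hs => hS ▸ Subgroup.subset_closure hs
  have hGc : ∀ c ∈ C0, c ∈ Gc := fun c hc => hc.1.1.1
  have hTim : ∀ c ∈ C0, Tim (act c xo) := fun c hc => Tim_Gc (hGc c hc) _ Tim_xo
  set Bd : Set (Fin 4 → ℤ) := ⋃ s ∈ S, ({e | lB e e = 6 ∧ Int.sign (lB e xo) ≠ Int.sign (lB e (act s xo))}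
    ∪ {e | lB e e = 6 ∧ Int.sign (lB e xo) ≠ Int.sign (lB e (act s⁻¹ xo))}) with hBd
  have hfin : Bd.Finite := by
    apply Set.Finite.biUnion S.finite_toSet
    intro s hs
    exact (cross_finite 6 Tim_xo (hTim s (hSm s hs))).union
      (cross_finite 6 Tim_xo (hTim _ (inv_mem (hSm s hs))))
  have hk : ∃ k : ℕ, ∀ c ∈ C0, act (tt ^ k * c) e6 ∉ Bd := by
    by_contra hc
    push Not at hc
    choose c hc1 hc2 using hc
    have : Function.Injective (fun k => act (tt ^ k * c k) e6) := by
      intro k l hkl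
      have hkl' : act (tt ^ k * c k) e6 = act (tt ^ l * c l) e6 := hkl
      have hm : ∀ k, tt ^ k * c k ∈ Ct := fun k => mul_mem (pow_mem tt_mem k) (C0_le (hc1 k))
      have h0 := ht_fix (g := (tt ^ l * c l)⁻¹ * (tt ^ k * c k)) (mul_mem (inv_mem (hm l)) (hm k)).1
        (mul_mem (inv_mem (hm l)) (hm k)).2 (by rw [act_mul, hkl', act_inv])
      have hh : ∀ k, ht (tt ^ k * c k) = 8 * k := fun k => by
        rw [ht_Ct (pow_mem tt_mem k) (C0_le (hc1 k)), (hc1 k).1.2]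
        have := ht_zpow k
        rw [zpow_natCast] at this
        rw [this, add_zero]
      rw [ht_Ct (inv_mem (hm l)) (hm k), ht_inv (hm l).1, hh, hh] at h0
      omega
    exact Set.infinite_range_of_injective this (hfin.subset (by rintro _ ⟨k, rfl⟩; exact hc2 k))
  obtain ⟨k, hk⟩ := hk
  have hkm : tt ^ k ∈ Ct := pow_mem tt_mem k
  set u := act (tt ^ k) e6 with hu
  have hl : ∀ c ∈ C0, Lor c := fun c hc => Gc_lor c (hGc c hc)
  have hnb : ∀ c ∈ C0, act c u ∉ Bd := by
    intro c hc
    have := hk _ (C0_conj (inv_mem hkm) hc)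
    rwa [inv_inv, ← mul_assoc, mul_inv_cancel_left, act_mul] at this
  have hn6 : ∀ c ∈ C0, lB (act c u) (act c u) = 6 := by
    intro c hc
    rw [hl c hc, hu, Gc_lor _ hkm.1.1]; decide
  have hs1 : ∀ s ∈ S, ∀ c ∈ C0, Int.sign (lB (act c u) xo) = Int.sign (lB (act c u) (act s xo)) := by
    intro s hs c hc
    by_contra h
    exact hnb c hc (Set.mem_biUnion hs (Or.inl ⟨hn6 c hc, h⟩))
  have hs2 : ∀ s ∈ S, ∀ c ∈ C0, Int.sign (lB (act c u) xo) = Int.sign (lB (act c u) (act s⁻¹ xo)) := by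
    intro s hs c hc
    by_contra h
    exact hnb c hc (Set.mem_biUnion hs (Or.inr ⟨hn6 c hc, h⟩))
  have hconst : ∀ c ∈ C0, Int.sign (lB u (act c xo)) = Int.sign (lB u xo) := by
    intro c hc
    rw [← hS] at hc
    induction hc using Subgroup.closure_induction_right with
    | one => rw [act_one]
    | mul_right x hx y hy ih =>
      have hx' : x⁻¹ ∈ C0 := inv_mem (hS ▸ hx)
      rw [← ih, act_mul, lB_comm, lB_comm u, (hl x (hS ▸ hx)).left, (hl x (hS ▸ hx)).left, lB_comm,
        lB_comm xo]
      exact (hs1 y hy _ hx').symm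
    | mul_inv_cancel x hx y hy ih =>
      have hx' : x⁻¹ ∈ C0 := inv_mem (hS ▸ hx)
      rw [← ih, act_mul, lB_comm, lB_comm u, (hl x (hS ▸ hx)).left, (hl x (hS ▸ hx)).left, lB_comm,
        lB_comm xo]
      exact (hs2 y hy _ hx').symm
  set y := act (tt ^ k)⁻¹ xo with hy
  have hyT : Tim y := Tim_Gc (inv_mem hkm.1.1) _ Tim_xo
  have hc : ∀ c ∈ C0, Int.sign (lB (act c e6) y) = Int.sign (lB u xo) := by
    intro c hc
    have hc' := C0_conj hkm hc
    rw [← hconst _ (inv_mem hc'), hy, ← (Gc_lor _ hkm.1.1).left, ← (hl _ (hc')).left,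
      hu, ← act_mul, ← act_mul, inv_mul_cancel_right]
  have a0 := hc 1 (one_mem _)
  have a1 := hc _ w1_mem
  have a2 := hc _ w2_mem
  rw [act_one] at a0
  have b1 : lB (e6 + act w1 e6) y < 0 := by
    apply Tim_neg _ hyT
    rw [w1_e6]; unfold Tim; decide
  have b2 : lB (-(e6 + act w2 e6)) y < 0 := by
    apply Tim_neg _ hyT
    rw [w2_e6]; unfold Tim; decide
  rw [lB_neg_left] at b2
  rw [lB_add_left] at b1 b2
  rw [← a0] at a1 a2
  rcases lt_trichotomy (lB e6 y) 0 with h | h | h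
  · rw [Int.sign_eq_neg_one_of_neg h, Int.sign_eq_neg_one_iff_neg] at a2; linarith
  · rw [h, Int.sign_zero, Int.sign_eq_zero_iff_zero] at a2; linarith
  · rw [Int.sign_eq_one_of_pos h, Int.sign_eq_one_iff_pos] at a1; linarith

end NotFG

section Embedding

/-- data of an isometric embedding of `q3` -/
structure Emb {m : ℕ} (F : Matrix (Fin m) (Fin m) ℚ) where
  U : Matrix (Fin m) (Fin 4) ℚ
  P : Matrix (Fin 4) (Fin m) ℚ
  PU : P * U = 1
  UF : Uᵀ * F = q3 * P

theorem q3_sq : q3 * q3 = 1 := by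
  unfold q3
  rw [Matrix.diagonal_mul_diagonal]
  rw [← Matrix.diagonal_one]
  congr 1; ext i; fin_cases i <;> simp

theorem q3_symm : q3ᵀ = q3 := by unfold q3; rw [Matrix.diagonal_transpose]

/-- construct from an isometry -/
def Emb.mk' {m : ℕ} {F : Matrix (Fin m) (Fin m) ℚ} (U : Matrix (Fin m) (Fin 4) ℚ)
    (hU : Uᵀ * F * U = q3) : Emb F where
  U := U
  P := q3 * Uᵀ * F
  PU := by rw [Matrix.mul_assoc, Matrix.mul_assoc, ← Matrix.mul_assoc Uᵀ, hU, q3_sq]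
  UF := by rw [Matrix.mul_assoc q3, ← Matrix.mul_assoc q3, q3_sq, Matrix.one_mul]

variable {m : ℕ} {F : Matrix (Fin m) (Fin m) ℚ}

theorem Emb.FU (E : Emb F) (hF : F.IsSymm) : F * E.U = E.Pᵀ * q3 := by
  have := congrArg Matrix.transpose E.UF
  rwa [Matrix.transpose_mul, Matrix.transpose_mul, Matrix.transpose_transpose, hF.eq, q3_symm] at this

/-- integer matrices to rational ones -/
def mq {k : ℕ} : Matrix (Fin k) (Fin k) ℤ →+* Matrix (Fin k) (Fin k) ℚ := (Int.castRingHom ℚ).mapMatrix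

theorem mq_inj {k : ℕ} : Function.Injective (mq (k := k)) := by
  intro a b h
  ext i j
  have := congrFun (congrFun h i) j
  simpa [mq] using this

/-- extension by the identity on the complement -/
def Emb.mat (E : Emb F) : Matrix (Fin 4) (Fin 4) ℤ →* Matrix (Fin m) (Fin m) ℚ where
  toFun M := 1 + E.U * (mq M - 1) * E.P
  map_one' := by simp
  map_mul' M N := by
    have h : E.U * (mq M - 1) * E.P * (E.U * (mq N - 1) * E.P) =
        E.U * ((mq M - 1) * (mq N - 1)) * E.P := by
      calc _ = E.U * (mq M - 1) * (E.P * E.U) * (mq N - 1) * E.P := by simp only [Matrix.mul_assoc]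
        _ = _ := by rw [E.PU]; simp only [Matrix.mul_assoc, Matrix.mul_one]
    rw [Matrix.add_mul, Matrix.mul_add, Matrix.mul_add, h, Matrix.one_mul, Matrix.one_mul, Matrix.mul_one]
    have h2 : mq (M * N) - 1 = (mq M - 1) + (mq N - 1) + (mq M - 1) * (mq N - 1) := by
      rw [map_mul]; noncomm_ring
    rw [h2, Matrix.mul_add, Matrix.mul_add, Matrix.add_mul, Matrix.add_mul]
    abel

/-- the homomorphism of groups -/
def Emb.hom (E : Emb F) : GL (Fin 4) ℤ →* GL (Fin m) ℚ := Units.map E.mat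

theorem Emb.hom_val (E : Emb F) (g : GL (Fin 4) ℤ) :
    (E.hom g : Matrix (Fin m) (Fin m) ℚ) = 1 + E.U * (mq (g : Matrix (Fin 4) (Fin 4) ℤ) - 1) * E.P := rfl

theorem Emb.P_hom (E : Emb F) (g : GL (Fin 4) ℤ) :
    E.P * (E.hom g : Matrix (Fin m) (Fin m) ℚ) = mq (g : Matrix (Fin 4) (Fin 4) ℤ) * E.P := by
  rw [E.hom_val, Matrix.mul_add, Matrix.mul_one, ← Matrix.mul_assoc, ← Matrix.mul_assoc, E.PU,
    Matrix.one_mul, Matrix.sub_mul, Matrix.one_mul]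
  abel

theorem Emb.hom_U (E : Emb F) (g : GL (Fin 4) ℤ) :
    (E.hom g : Matrix (Fin m) (Fin m) ℚ) * E.U = E.U * mq (g : Matrix (Fin 4) (Fin 4) ℤ) := by
  rw [E.hom_val, Matrix.add_mul, Matrix.one_mul, Matrix.mul_assoc, E.PU, Matrix.mul_one, Matrix.mul_sub,
    Matrix.mul_one]
  abel

theorem Emb.preserves (E : Emb F) (hF : F.IsSymm) (g : GL (Fin 4) ℤ)
    (hg : (mq (g : Matrix (Fin 4) (Fin 4) ℤ))ᵀ * q3 * mq (g : Matrix (Fin 4) (Fin 4) ℤ) = q3) :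
    (E.hom g : Matrix (Fin m) (Fin m) ℚ)ᵀ * F * (E.hom g : Matrix (Fin m) (Fin m) ℚ) = F := by
  rw [E.hom_val]
  set M := mq (g : Matrix (Fin 4) (Fin 4) ℤ)
  have h1 : (1 + E.U * (M - 1) * E.P)ᵀ = 1 + E.Pᵀ * (Mᵀ - 1) * E.Uᵀ := by
    simp [Matrix.transpose_mul, Matrix.mul_assoc]
  rw [h1]
  have h2 : (1 + E.Pᵀ * (Mᵀ - 1) * E.Uᵀ) * F = F + E.Pᵀ * ((Mᵀ - 1) * q3) * E.P := by
    rw [Matrix.add_mul, Matrix.one_mul, Matrix.mul_assoc (E.Pᵀ * (Mᵀ - 1)), E.UF]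
    simp only [Matrix.mul_assoc]
  rw [h2, Matrix.mul_add, Matrix.mul_one, Matrix.add_mul]
  have h3 : F * (E.U * (M - 1) * E.P) = E.Pᵀ * (q3 * (M - 1)) * E.P := by
    rw [← Matrix.mul_assoc, ← Matrix.mul_assoc, E.FU hF]; simp only [Matrix.mul_assoc]
  have h4 : E.Pᵀ * ((Mᵀ - 1) * q3) * E.P * (E.U * (M - 1) * E.P) =
      E.Pᵀ * ((Mᵀ - 1) * q3 * (M - 1)) * E.P := by
    calc _ = E.Pᵀ * ((Mᵀ - 1) * q3) * (E.P * E.U) * (M - 1) * E.P := by simp only [Matrix.mul_assoc]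
      _ = _ := by rw [E.PU]; simp only [Matrix.mul_assoc, Matrix.mul_one]
  rw [h3, h4]
  have h5 : (Mᵀ - 1) * q3 + q3 * (M - 1) + (Mᵀ - 1) * q3 * (M - 1) = 0 := by
    have : (Mᵀ - 1) * q3 + q3 * (M - 1) + (Mᵀ - 1) * q3 * (M - 1) = Mᵀ * q3 * M - q3 := by noncomm_ring
    rw [this, hg, sub_self]
  have h6 : E.Pᵀ * ((Mᵀ - 1) * q3) * E.P + E.Pᵀ * (q3 * (M - 1)) * E.P +
      E.Pᵀ * ((Mᵀ - 1) * q3 * (M - 1)) * E.P = 0 := by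
    rw [← Matrix.add_mul, ← Matrix.add_mul, ← Matrix.mul_add, ← Matrix.mul_add, h5]; simp
  rw [show ∀ a b c d : Matrix (Fin m) (Fin m) ℚ, a + b + (c + d) = a + (b + c + d) from fun a b c d => by abel,
    h6, add_zero]

/-- inclusion of integral matrices -/
def jz {k : ℕ} : GL (Fin k) ℤ →* GL (Fin k) ℚ := Units.map (mq (k := k)).toMonoidHom

theorem jz_inj {k : ℕ} : Function.Injective (jz (k := k)) := Units.map_injective mq_inj

theorem jz_val {k : ℕ} (g : GL (Fin k) ℤ) :
    (jz g : Matrix (Fin k) (Fin k) ℚ) = mq (g : Matrix (Fin k) (Fin k) ℤ) := rfl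

/-- principal congruence subgroup -/
def Gmod (N : ℕ) : Subgroup (GL (Fin 4) ℤ) :=
  (Units.map ((Int.castRingHom (ZMod N)).mapMatrix (m := Fin 4)).toMonoidHom).ker

theorem Gmod_index (N : ℕ) (hN : N ≠ 0) : (Gmod N).index ≠ 0 := by
  have : NeZero N := ⟨hN⟩
  have : Finite (GL (Fin 4) (ZMod N)) := inferInstance
  unfold Gmod
  rw [Subgroup.index_ker]
  exact Nat.card_pos.ne'

theorem Gmod_dvd {N : ℕ} {g : GL (Fin 4) ℤ} (hg : g ∈ Gmod N) (i j : Fin 4) :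
    (N : ℤ) ∣ ((g : Matrix (Fin 4) (Fin 4) ℤ) - 1) i j := by
  unfold Gmod at hg
  rw [MonoidHom.mem_ker] at hg
  have h : ((Int.castRingHom (ZMod N)).mapMatrix (m := Fin 4)) ((g : Matrix (Fin 4) (Fin 4) ℤ) - 1) = 0 := by
    rw [map_sub, map_one, sub_eq_zero]
    exact congrArg Units.val hg
  have := congrFun (congrFun h i) j
  rw [← ZMod.intCast_zmod_eq_zero_iff_dvd]
  simpa using this

theorem Emb.integral (E : Emb F) {N : ℕ}
    (hN : ∀ i j k l, ∃ z : ℤ, (N : ℚ) * E.U i j * E.P k l = z) {g : GL (Fin 4) ℤ} (hg : g ∈ Gmod N) :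
    ∃ X : Matrix (Fin m) (Fin m) ℤ, mq X = (E.hom g : Matrix (Fin m) (Fin m) ℚ) := by
  have : ∀ i j, ∃ z : ℤ,
      (E.U * (mq (g : Matrix (Fin 4) (Fin 4) ℤ) - 1) * E.P : Matrix (Fin m) (Fin m) ℚ) i j = z := by
    intro i j
    choose G' hG' using Gmod_dvd hg
    choose c hc using hN
    refine ⟨∑ k, ∑ l, c i l k j * G' l k, ?_⟩
    rw [Matrix.mul_apply]
    push_cast
    refine Finset.sum_congr rfl fun k _ => ?_
    rw [Matrix.mul_apply, Finset.sum_mul]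
    refine Finset.sum_congr rfl fun l _ => ?_
    have h1 : (mq (g : Matrix (Fin 4) (Fin 4) ℤ) - 1) l k = (N : ℚ) * G' l k := by
      rw [← map_one mq, ← map_sub]
      simp only [mq, RingHom.mapMatrix_apply, Matrix.map_apply, hG']
      simp
    rw [h1, ← hc]; ring
  choose z hz using this
  refine ⟨1 + Matrix.of z, ?_⟩
  rw [map_add, map_one, E.hom_val]
  congr 1
  ext i j
  rw [hz]; simp [mq]

theorem bl_mat (F M : Matrix (Fin m) (Fin m) ℚ) (x y : Fin m → ℚ) :
    (M *ᵥ x) ⬝ᵥ (F *ᵥ (M *ᵥ y)) = x ⬝ᵥ ((Mᵀ * F * M) *ᵥ y) := by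
  conv_rhs => rw [Matrix.mul_assoc, ← Matrix.mulVec_mulVec, Matrix.dotProduct_mulVec,
    Matrix.vecMul_transpose, ← Matrix.mulVec_mulVec]

theorem qeval_of {M : Matrix (Fin m) (Fin m) ℚ} (h : Mᵀ * F * M = F) (x : Fin m → ℚ) :
    qeval F (M *ᵥ x) = qeval F x := by
  unfold qeval
  rw [bl_mat, h]

theorem mem_OZ_of {X : GL (Fin m) ℤ}
    (h : (mq (X : Matrix (Fin m) (Fin m) ℤ))ᵀ * F * mq (X : Matrix (Fin m) (Fin m) ℤ) = F) : X ∈ OZ F := by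
  intro x
  exact qeval_of h x

theorem Emb.map_le (E : Emb F) (hF : F.IsSymm) {N : ℕ}
    (hN : ∀ i j k l, ∃ z : ℤ, (N : ℚ) * E.U i j * E.P k l = z) {B : Subgroup (GL (Fin 4) ℤ)}
    (hB : B ≤ Gmod N) (hB' : ∀ g ∈ B, (mq (g : Matrix (Fin 4) (Fin 4) ℤ))ᵀ * q3 *
      mq (g : Matrix (Fin 4) (Fin 4) ℤ) = q3) : B.map E.hom ≤ (OZ F).map jz := by
  rintro _ ⟨g, hg, rfl⟩
  obtain ⟨X, hX⟩ := E.integral hN (hB hg)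
  obtain ⟨Y, hY⟩ := E.integral hN (hB (inv_mem hg))
  have h1 : X * Y = 1 := mq_inj (by rw [map_mul, hX, hY, map_one, ← Units.val_mul, ← map_mul]; simp)
  have h2 : Y * X = 1 := mq_inj (by rw [map_mul, hX, hY, map_one, ← Units.val_mul, ← map_mul]; simp)
  refine ⟨⟨X, Y, h1, h2⟩, ?_, Units.ext ?_⟩
  · apply mem_OZ_of
    show (mq X)ᵀ * F * mq X = F
    rw [hX]; exact E.preserves hF g (hB' g hg)
  · rw [jz_val]; exact hX

/-- Lorentz over the integers gives the matrix identity -/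
theorem Lor.matrix {g : GL (Fin 4) ℤ} (hg : Lor g) : (mq (g : Matrix (Fin 4) (Fin 4) ℤ))ᵀ * q3 *
      mq (g : Matrix (Fin 4) (Fin 4) ℤ) = q3 := by
  ext i j
  have := hg (Pi.single i 1) (Pi.single j 1)
  simp only [act, Matrix.mulVec_single_one, lB, Matrix.col_apply] at this
  have h2 := congrArg (Int.cast : ℤ → ℚ) this
  push_cast at h2
  simp only [Matrix.mul_apply, Fin.sum_univ_four, q3, Matrix.transpose_apply, mq, RingHom.mapMatrix_apply,
    Matrix.map_apply, Matrix.diagonal_apply, Int.coe_castRingHom]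
  fin_cases i <;> fin_cases j <;> simp at h2 ⊢ <;> linarith

end Embedding

section PingPong

theorem aniso_e1 : ∀ (n : ℕ) (x a b : ℤ), x.natAbs = n → x ^ 2 = 2 * (a ^ 2 + a * b + b ^ 2) → x = 0 := by
  intro n
  induction n using Nat.strong_induction_on with
  | _ n ih =>
    intro x a b hx h
    by_contra h0
    have hx2 : x % 2 = 0 := by
      rcases Int.emod_two_eq_zero_or_one x with h' | h'
      · exact h'
      · exfalso
        obtain ⟨y, rfl⟩ : ∃ y, x = 2 * y + 1 := ⟨x / 2, by omega⟩
        have : (2 : ℤ) * (a ^ 2 + a * b + b ^ 2 - 2 * y ^ 2 - 2 * y) = 1 := by linarith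
        omega
    obtain ⟨y, rfl⟩ : ∃ y, x = 2 * y := ⟨x / 2, by omega⟩
    have h1 : a ^ 2 + a * b + b ^ 2 = 2 * y ^ 2 := by linarith
    have hab : a % 2 = 0 ∧ b % 2 = 0 := by
      rcases Int.emod_two_eq_zero_or_one a with ha | ha <;>
      rcases Int.emod_two_eq_zero_or_one b with hb | hb
      · exact ⟨ha, hb⟩
      all_goals
        exfalso
        have h2 : (a ^ 2 + a * b + b ^ 2) % 2 = 0 := by omega
        simp [Int.add_emod, Int.mul_emod, pow_two, ha, hb] at h2
    obtain ⟨c, rfl⟩ : ∃ c, a = 2 * c := ⟨a / 2, by omega⟩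
    obtain ⟨d, rfl⟩ : ∃ d, b = 2 * d := ⟨b / 2, by omega⟩
    have := ih y.natAbs (by omega) y c d rfl (by linarith)
    omega

theorem aniso_vec {w : Fin 4 → ℤ} (h1 : lB w e1 = 0) (h2 : lB w w = 0) : w = 0 := by
  simp only [lB, e1] at h1 h2
  simp at h1
  have h3 : w 3 = - w 1 - w 2 := by linarith
  have h0 := aniso_e1 _ (w 0) (w 1) (w 2) rfl (by rw [h3] at h2; linarith)
  rw [h0] at h2
  have hw : ∀ i, w i * w i = 0 := by
    intro i
    have e1 := mul_self_nonneg (w 1)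
    have e2 := mul_self_nonneg (w 2)
    have e3 := mul_self_nonneg (w 3)
    fin_cases i
    · simp [h0]
    all_goals (simp only [Fin.mk_one, Fin.reduceFinMk]; linarith)
  ext i
  exact mul_self_eq_zero.1 (hw i)

/-- rational Lorentz form -/
def lq (x y : Fin 4 → ℚ) : ℚ := -(x 0 * y 0) + x 1 * y 1 + x 2 * y 2 + x 3 * y 3

theorem lq_eq (x y : Fin 4 → ℚ) : x ⬝ᵥ (q3 *ᵥ y) = lq x y := by
  simp [q3, lq, Matrix.mulVec_diagonal, dotProduct, Fin.sum_univ_four]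

/-- cast of a vector -/
def vq (x : Fin 4 → ℤ) : Fin 4 → ℚ := fun i => x i

theorem lq_vq (x y : Fin 4 → ℤ) : lq (vq x) (vq y) = (lB x y : ℤ) := by
  simp [lq, vq, lB]

theorem mq_vq (g : GL (Fin 4) ℤ) (x : Fin 4 → ℤ) :
    mq (g : Matrix (Fin 4) (Fin 4) ℤ) *ᵥ vq x = vq (act g x) := by
  ext i
  simp [mq, vq, act, Matrix.mulVec, dotProduct]

theorem Lor.lq {g : GL (Fin 4) ℤ} (hg : Lor g) (x y : Fin 4 → ℚ) :
    lq (mq (g : Matrix (Fin 4) (Fin 4) ℤ) *ᵥ x) (mq (g : Matrix (Fin 4) (Fin 4) ℤ) *ᵥ y) = lq x y := by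
  rw [← lq_eq, bl_mat, hg.matrix, lq_eq]

theorem reverse_cs {y v : Fin 4 → ℚ} (hy : lq y y < 0) (hv : lq v v < 0) :
    lq y y * lq v v ≤ lq y v ^ 2 := by
  simp only [lq] at *
  generalize y 0 = y0 at *
  generalize y 1 = a at *
  generalize y 2 = b at *
  generalize y 3 = c at *
  generalize v 0 = v0 at *
  generalize v 1 = p at *
  generalize v 2 = q at *
  generalize v 3 = r at *
  set α := -(-(y0 * y0) + a * a + b * b + c * c) with hα
  set β := -(-(v0 * v0) + p * p + q * q + r * r) with hβ
  set B := -(y0 * v0) + a * p + b * q + c * r with hB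
  have hα0 : 0 < α := by rw [hα]; linarith
  have hβ0 : 0 < β := by rw [hβ]; linarith
  have hy0 : 0 < y0 ^ 2 := by linarith [mul_self_nonneg a, mul_self_nonneg b, mul_self_nonneg c]
  have hv0 : 0 < v0 ^ 2 := by linarith [mul_self_nonneg p, mul_self_nonneg q, mul_self_nonneg r]
  have h1 : 0 ≤ -(v0 ^ 2 * α) - 2 * (v0 * y0) * B - y0 ^ 2 * β := by
    have : -(v0 ^ 2 * α) - 2 * (v0 * y0) * B - y0 ^ 2 * β = (v0 * a - y0 * p) ^ 2 +
      (v0 * b - y0 * q) ^ 2 + (v0 * c - y0 * r) ^ 2 := by rw [hα, hβ, hB]; ring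
    rw [this]; positivity
  have h2 : (v0 ^ 2 * α + y0 ^ 2 * β) ^ 2 ≤ (-(2 * (v0 * y0) * B)) ^ 2 :=
    pow_le_pow_left₀ (by positivity) (by linarith) 2
  have h3 : 4 * (v0 ^ 2 * y0 ^ 2) * (α * β) ≤ 4 * (v0 ^ 2 * y0 ^ 2) * B ^ 2 := by
    linarith [sq_nonneg (v0 ^ 2 * α - y0 ^ 2 * β)]
  have h4 := le_of_mul_le_mul_left h3 (by positivity)
  linarith

theorem pp_step {N : ℕ} {κ : ℚ} (hκ : 0 < κ) (hN : 2 * κ + 6 ≤ N) {a : GL (Fin 4) ℤ} (hl : Lor a)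
    (ha : a ∈ Gmod N) (hne : act a e1 ≠ e1) {y : Fin 4 → ℚ}
    (hy : lq y (vq e1) ^ 2 < κ * (- lq y y)) :
    ¬ lq (mq (a : Matrix (Fin 4) (Fin 4) ℤ) *ᵥ y) (vq e1) ^ 2 <
      κ * (- lq (mq (a : Matrix (Fin 4) (Fin 4) ℤ) *ᵥ y) (mq (a : Matrix (Fin 4) (Fin 4) ℤ) *ᵥ y)) := by
  intro h
  rw [hl.lq] at h
  set e' := act a⁻¹ e1 with he'
  have h1 : vq e1 = mq (a : Matrix (Fin 4) (Fin 4) ℤ) *ᵥ vq e' := by rw [mq_vq, he', act_inv']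
  rw [h1, hl.lq] at h
  have hyy : lq y y < 0 := by
    by_contra hc
    push Not at hc
    have : κ * (- lq y y) ≤ 0 := by nlinarith
    linarith [sq_nonneg (lq y (vq e1))]
  set β := lB e1 e' with hβ
  have hdv : (N : ℤ) ∣ β - 3 := by
    have hd := Gmod_dvd (inv_mem ha)
    have hc : ∀ i, (N : ℤ) ∣ e' i - e1 i := by
      intro i
      have : e' i - e1 i = ∑ j, ((a⁻¹ : GL (Fin 4) ℤ) - 1 : Matrix (Fin 4) (Fin 4) ℤ) i j * e1 j := by
        have h3 : (((a⁻¹ : GL (Fin 4) ℤ) - 1 : Matrix (Fin 4) (Fin 4) ℤ) *ᵥ e1) i = e' i - e1 i := by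
          rw [Matrix.sub_mulVec, Matrix.one_mulVec]; rfl
        rw [← h3]; rfl
      rw [this]
      exact Finset.dvd_sum fun j _ => Dvd.dvd.mul_right (hd i j) _
    have : β - 3 = (e' 1 - e1 1) + (e' 2 - e1 2) + (e' 3 - e1 3) := by
      rw [hβ]; simp [lB, e1]; ring
    rw [this]
    exact dvd_add (dvd_add (hc 1) (hc 2)) (hc 3)
  have hq' : lB e' e' = 3 := by rw [he', hl.inv]; decide
  have hq1 : lB e1 e1 = 3 := by decide
  have hβ3 : β ≠ 3 := by
    intro h3
    apply hne
    have hw : e' - e1 = 0 := by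
      apply aniso_vec
      · rw [lB_sub_left, hq1, lB_comm, ← hβ, h3]; rfl
      · rw [lB_sub_left, lB_sub_right, lB_sub_right, hq', hq1, lB_comm e' e1, ← hβ, h3]; rfl
    have h4 : e' = e1 := sub_eq_zero.1 hw
    rw [← h4, he', act_inv', ← he', h4]
  obtain ⟨k, hk⟩ := hdv
  have hk0 : k ≠ 0 := by rintro rfl; apply hβ3; linarith
  have hB : (N : ℤ) - 3 ≤ |β| := by
    have h5 : (N : ℤ) ≤ |β - 3| := by
      rw [hk, abs_mul]
      have : (1 : ℤ) ≤ |k| := Int.one_le_abs hk0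
      rw [abs_of_nonneg (show (0 : ℤ) ≤ N by positivity)]
      nlinarith [show (0 : ℤ) ≤ N by positivity]
    have h6 : |β - 3| ≤ |β| + |3| := abs_sub _ _
    norm_num at h6
    linarith
  obtain ⟨ε, hε, hεβ⟩ : ∃ ε : ℤ, ε ^ 2 = 1 ∧ ε * β = |β| := by
    rcases abs_cases β with ⟨h, _⟩ | ⟨h, _⟩
    · exact ⟨1, by norm_num, by rw [h]; ring⟩
    · exact ⟨-1, by norm_num, by rw [h]; ring⟩
  set v := e' - ε • e1 with hv
  have hqv : lB v v = 6 - 2 * |β| := by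
    rw [hv, lB_sub_left, lB_sub_right, lB_sub_right, lB_smul_left, lB_smul_left, lB_smul_right,
      lB_smul_right, hq', hq1, lB_comm e' e1, ← hβ, ← hεβ]
    linear_combination 3 * hε
  have hB' : (N : ℚ) - 3 ≤ (|β| : ℤ) := by exact_mod_cast hB
  have hqv' : lq (vq v) (vq v) = 6 - 2 * ((|β| : ℤ) : ℚ) := by rw [lq_vq, hqv]; push_cast; rfl
  have hneg : lq (vq v) (vq v) < 0 := by rw [hqv']; linarith
  have hcs := reverse_cs hyy hneg
  have hyv : lq y (vq v) = lq y (vq e') - ε * lq y (vq e1) := by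
    simp [lq, vq, hv]; ring
  have hε' : (ε : ℚ) ^ 2 = 1 := by exact_mod_cast hε
  have h7 : lq y (vq v) ^ 2 ≤ 2 * lq y (vq e') ^ 2 + 2 * lq y (vq e1) ^ 2 := by
    rw [hyv]
    have := sq_nonneg (lq y (vq e') + ε * lq y (vq e1))
    have h8 : (ε * lq y (vq e1)) ^ 2 = lq y (vq e1) ^ 2 := by rw [mul_pow, hε', one_mul]
    linarith
  have h9 : 4 * κ ≤ - lq (vq v) (vq v) := by rw [hqv']; linarith
  nlinarith

theorem cover_arith {α κ ξ1 ξ2 Q t : ℚ} (hα : |α| < 1) (hκ : 0 < κ)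
    (hκα : 3 * (1 + |α|) ≤ κ * (1 - |α|)) (ht : t * (3 * (1 - α ^ 2)) = (ξ2 - α * ξ1) ^ 2)
    (hneg : -Q + ξ1 ^ 2 / 3 + t < 0) (h1 : κ * (Q - ξ1 ^ 2 / 3) ≤ ξ1 ^ 2)
    (h2 : κ * (Q - ξ2 ^ 2 / 3) ≤ ξ2 ^ 2) : False := by
  have hα0 := abs_nonneg α
  have hαα : α ^ 2 = |α| ^ 2 := (sq_abs α).symm
  set s := |α| with hs
  have h1s : 0 < 1 - s ^ 2 := by nlinarith
  have ht0 : 0 ≤ t := by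
    rw [hαα] at ht
    have : 0 ≤ t * (3 * (1 - s ^ 2)) := by rw [ht]; positivity
    exact nonneg_of_mul_nonneg_left this (by linarith)
  have hQ : 0 < Q := by linarith [sq_nonneg ξ1]
  have e1 : 3 * κ * Q ≤ (3 + κ) * ξ1 ^ 2 := by linarith
  have e2 : 3 * κ * Q ≤ (3 + κ) * ξ2 ^ 2 := by linarith
  have hcr : 2 * α * ξ1 * ξ2 ≤ s * (ξ1 ^ 2 + ξ2 ^ 2) := by
    have h3 : α * (2 * (ξ1 * ξ2)) ≤ |α| * |2 * (ξ1 * ξ2)| := by rw [← abs_mul]; exact le_abs_self _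
    have h4 : |2 * (ξ1 * ξ2)| ≤ ξ1 ^ 2 + ξ2 ^ 2 := by
      rw [abs_le]; constructor <;> linarith [sq_nonneg (ξ1 + ξ2), sq_nonneg (ξ1 - ξ2)]
    have h5 := mul_le_mul_of_nonneg_left h4 hα0
    linarith
  have e3 : (1 - s) * (ξ1 ^ 2 + ξ2 ^ 2) ≤ 3 * (1 - s ^ 2) * (ξ1 ^ 2 / 3 + t) := by
    have : 3 * (1 - s ^ 2) * (ξ1 ^ 2 / 3 + t) = ξ1 ^ 2 + ξ2 ^ 2 - 2 * α * ξ1 * ξ2 := by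
      rw [hαα] at ht
      linear_combination ht + ξ1 ^ 2 * hαα
    linarith
  have e4 : 3 * (1 - s ^ 2) * (ξ1 ^ 2 / 3 + t) < 3 * (1 - s ^ 2) * Q :=
    mul_lt_mul_of_pos_left (by linarith) (by linarith)
  have e5 : (1 - s) * (ξ1 ^ 2 + ξ2 ^ 2) < (1 - s) * (3 * (1 + s) * Q) := by
    calc _ < 3 * (1 - s ^ 2) * Q := lt_of_le_of_lt e3 e4
      _ = _ := by ring
  have e6 : ξ1 ^ 2 + ξ2 ^ 2 < 3 * (1 + s) * Q := lt_of_mul_lt_mul_left e5 (by linarith)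
  have e7 : (3 + κ) * (ξ1 ^ 2 + ξ2 ^ 2) < (3 + κ) * (3 * (1 + s) * Q) :=
    mul_lt_mul_of_pos_left e6 (by linarith)
  have e8 : 6 * κ * Q < (3 + κ) * (3 * (1 + s)) * Q := by linarith
  have e9 := lt_of_mul_lt_mul_right e8 hQ.le
  linarith

end PingPong

section Twist
variable {m : ℕ} {F : Matrix (Fin m) (Fin m) ℚ}

theorem q3_e1 : q3 *ᵥ vq e1 = vq e1 := by
  ext i
  fin_cases i <;> simp [q3, Matrix.mulVec_diagonal, vq, e1]

theorem Emb.lq_P (E : Emb F) (hF : F.IsSymm) (x : Fin m → ℚ) (u : Fin 4 → ℚ) :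
    lq (E.P *ᵥ x) u = x ⬝ᵥ (F *ᵥ (E.U *ᵥ u)) := by
  rw [Matrix.mulVec_mulVec, E.FU hF, ← lq_eq, ← Matrix.mulVec_mulVec, Matrix.dotProduct_mulVec x,
    Matrix.vecMul_transpose]

/-- twisted embedding -/
def Emb.tw (E : Emb F) (hF : F.IsSymm) (d : Fin m → ℚ) (s : ℚ) (hPd : E.P *ᵥ d = s • vq e1)
    (hdd : d ⬝ᵥ (F *ᵥ d) = - 2 * s) : Emb F where
  U := E.U + vecMulVec d (vq e1)
  P := E.P + vecMulVec (vq e1) (F *ᵥ d)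
  PU := by
    have h1 : (F *ᵥ d) ᵥ* E.U = s • vq e1 := by
      rw [← Matrix.mulVec_transpose, Matrix.mulVec_mulVec, E.UF, ← Matrix.mulVec_mulVec, hPd,
        Matrix.mulVec_smul, q3_e1]
    rw [Matrix.add_mul, Matrix.mul_add, Matrix.mul_add, E.PU, mul_vecMulVec, vecMulVec_mul, hPd,
      h1, vecMulVec_mul_vecMulVec, dotProduct_comm, hdd]
    ext i j
    simp only [Matrix.add_apply, vecMulVec_apply, Pi.smul_apply, smul_eq_mul]
    ring
  UF := by
    rw [Matrix.transpose_add, Matrix.add_mul, E.UF, Matrix.mul_add, mul_vecMulVec, q3_e1,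
      transpose_vecMulVec, vecMulVec_mul]
    congr 2
    rw [← Matrix.mulVec_transpose, hF.eq]

theorem Emb.tw_P (E : Emb F) (hF : F.IsSymm) (d : Fin m → ℚ) (s : ℚ) (hPd : E.P *ᵥ d = s • vq e1)
    (hdd : d ⬝ᵥ (F *ᵥ d) = - 2 * s) (x : Fin m → ℚ) :
    (E.tw hF d s hPd hdd).P *ᵥ x = E.P *ᵥ x + (x ⬝ᵥ (F *ᵥ d)) • vq e1 := by
  show (E.P + vecMulVec (vq e1) (F *ᵥ d)) *ᵥ x = _
  rw [Matrix.add_mulVec, vecMulVec_mulVec, dotProduct_comm]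
  ext i; simp

theorem Emb.tw_hom (E : Emb F) (hF : F.IsSymm) (d : Fin m → ℚ) (s : ℚ) (hPd : E.P *ᵥ d = s • vq e1)
    (hdd : d ⬝ᵥ (F *ᵥ d) = - 2 * s) {g : GL (Fin 4) ℤ} (hg : Lor g) (he : act g e1 = e1) :
    E.hom g = (E.tw hF d s hPd hdd).hom g := by
  apply Units.ext
  rw [Emb.hom_val, Emb.hom_val]
  show _ = 1 + (E.U + vecMulVec d (vq e1)) * (mq (g : Matrix (Fin 4) (Fin 4) ℤ) - 1) *
    (E.P + vecMulVec (vq e1) (F *ᵥ d))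
  have h1 : (mq (g : Matrix (Fin 4) (Fin 4) ℤ) - 1) *ᵥ vq e1 = 0 := by
    rw [Matrix.sub_mulVec, mq_vq, he, Matrix.one_mulVec, sub_self]
  have h2 : vq e1 ᵥ* (mq (g : Matrix (Fin 4) (Fin 4) ℤ) - 1) = 0 := by
    rw [Matrix.vecMul_sub, Matrix.vecMul_one, sub_eq_zero]
    have h := hg.matrix
    set M := mq (g : Matrix (Fin 4) (Fin 4) ℤ)
    have h3 : vq e1 ᵥ* q3 = vq e1 := by rw [← Matrix.mulVec_transpose, q3_symm, q3_e1]
    have h4 : M *ᵥ vq e1 = vq e1 := by rw [mq_vq, he]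
    have h5 : vq e1 ᵥ* (Mᵀ * q3 * M) = vq e1 ᵥ* M := by
      rw [← Matrix.vecMul_vecMul, ← Matrix.vecMul_vecMul, Matrix.vecMul_transpose, h4, h3]
    rw [← h5, h, h3]
  rw [Matrix.add_mul, vecMulVec_mul, h2, Matrix.mul_add]
  have : (vecMulVec d 0 : Matrix (Fin m) (Fin 4) ℚ) = 0 := by ext i j; simp [vecMulVec_apply]
  rw [this, add_zero, Matrix.mul_assoc E.U _ (vecMulVec _ _), mul_vecMulVec, h1]
  have : (vecMulVec 0 (F *ᵥ d) : Matrix (Fin 4) (Fin m) ℚ) = 0 := by ext i j; simp [vecMulVec_apply]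
  rw [this, Matrix.mul_zero, add_zero]

theorem lq_smul_add (c u : Fin 4 → ℚ) (k : ℚ) : lq (c + k • u) (c + k • u) =
    lq c c + 2 * k * lq c u + k ^ 2 * lq u u := by
  simp only [lq, Pi.add_apply, Pi.smul_apply, smul_eq_mul]; ring

theorem lq_add_left (c u v : Fin 4 → ℚ) (k : ℚ) : lq (c + k • u) v = lq c v + k * lq u v := by
  simp only [lq, Pi.add_apply, Pi.smul_apply, smul_eq_mul]; ring

theorem lq_e1 : lq (vq e1) (vq e1) = 3 := by rw [lq_vq, show lB e1 e1 = 3 by decide]; norm_num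

theorem bl_symm (hF : F.IsSymm) (x y : Fin m → ℚ) : x ⬝ᵥ (F *ᵥ y) = y ⬝ᵥ (F *ᵥ x) := by
  rw [Matrix.dotProduct_mulVec, ← Matrix.mulVec_transpose, hF.eq, dotProduct_comm]

theorem bl_add (x y z : Fin m → ℚ) (k : ℚ) :
    x ⬝ᵥ (F *ᵥ (y + k • z)) = x ⬝ᵥ (F *ᵥ y) + k * x ⬝ᵥ (F *ᵥ z) := by
  rw [Matrix.mulVec_add, Matrix.mulVec_smul, dotProduct_add, dotProduct_smul, smul_eq_mul]

theorem qeval_add_smul (hF : F.IsSymm) (x z : Fin m → ℚ) (k : ℚ) :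
    qeval F (x + k • z) = qeval F x + 2 * k * (x ⬝ᵥ (F *ᵥ z)) + k ^ 2 * qeval F z := by
  unfold qeval
  rw [bl_add, bl_symm hF, bl_symm hF (x + k • z), bl_add, bl_add, bl_symm hF z x]; ring

/-- lower bound on the value of a vector -/
theorem Emb.lower (E : Emb F) (hF : F.IsSymm)
    (hL : ∀ u w : Fin m → ℚ, qeval F u < 0 → u ⬝ᵥ (F *ᵥ w) = 0 → 0 ≤ qeval F w)
    {z : Fin m → ℚ} (hz : E.P *ᵥ z = 0) (hr : 0 < qeval F z) (x : Fin m → ℚ) :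
    lq (E.P *ᵥ x) (E.P *ᵥ x) + (x ⬝ᵥ (F *ᵥ z)) ^ 2 / qeval F z ≤ qeval F x := by
  set r := qeval F z with hrd
  set ζ := x ⬝ᵥ (F *ᵥ z)
  set c := E.P *ᵥ x with hc
  set w := x + (-1 : ℚ) • (E.U *ᵥ c) with hw
  have hPw : E.P *ᵥ w = 0 := by
    rw [hw, Matrix.mulVec_add, Matrix.mulVec_smul, Matrix.mulVec_mulVec, E.PU, Matrix.one_mulVec, ← hc]
    simp
  have hzU : ∀ u, (E.U *ᵥ u) ⬝ᵥ (F *ᵥ z) = 0 := by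
    intro u
    rw [bl_symm hF, ← E.lq_P hF, hz]; simp [lq]
  have hwU : ∀ u, (E.U *ᵥ u) ⬝ᵥ (F *ᵥ w) = 0 := by
    intro u
    rw [bl_symm hF, ← E.lq_P hF, hPw]; simp [lq]
  have hwz : w ⬝ᵥ (F *ᵥ z) = ζ := by
    rw [hw, bl_symm hF, bl_add, bl_symm hF, bl_symm hF z, hzU]; ring
  have hfU : ∀ u, qeval F (E.U *ᵥ u) = lq u u := by
    intro u
    unfold qeval
    rw [← E.lq_P hF, Matrix.mulVec_mulVec, E.PU, Matrix.one_mulVec]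
  have h0 : 0 ≤ qeval F (w + (-(ζ / r)) • z) := by
    apply hL (E.U *ᵥ vq xo)
    · rw [hfU, lq_vq, show lB xo xo = -1 by decide]; norm_num
    · rw [bl_add, hwU, hzU]; ring
  rw [qeval_add_smul hF, hwz, ← hrd] at h0
  have hfw : qeval F w = qeval F x - lq c c := by
    rw [hw, qeval_add_smul hF, hfU, ← E.lq_P hF, ← hc]; ring
  rw [hfw] at h0
  have : -(ζ/r) * ζ * 2 + (-(ζ/r))^2 * r = - (ζ^2/r) := by field_simp; ring
  linarith

end Twist

section Assembly
variable {m : ℕ} {F : Matrix (Fin m) (Fin m) ℚ}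

theorem common_den {ι : Type*} [Fintype ι] (f : ι → ℚ) : ∃ N : ℕ, N ≠ 0 ∧ ∀ i, ∃ z : ℤ, (N : ℚ) * f i = z := by
  classical
  refine ⟨∏ i, (f i).den, Finset.prod_ne_zero_iff.2 fun i _ => (f i).den_nz, fun i => ?_⟩
  refine ⟨(∏ j ∈ Finset.univ.erase i, ((f j).den : ℤ)) * (f i).num, ?_⟩
  rw [← Finset.mul_prod_erase _ _ (Finset.mem_univ i)]
  push_cast
  have := Rat.mul_den_eq_num (f i)
  linear_combination (∏ j ∈ Finset.univ.erase i, ((f j).den : ℚ)) * this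

theorem Emb.den (E : Emb F) : ∃ N : ℕ, N ≠ 0 ∧ ∀ i j k l, ∃ z : ℤ, (N : ℚ) * E.U i j * E.P k l = z := by
  obtain ⟨N, hN, h⟩ := common_den (fun p : (Fin m × Fin 4) × (Fin 4 × Fin m) => E.U p.1.1 p.1.2 * E.P p.2.1 p.2.2)
  refine ⟨N, hN, fun i j k l => ?_⟩
  obtain ⟨z, hz⟩ := h ((i, j), (k, l))
  exact ⟨z, by rw [← hz]; ring⟩

theorem Emb.hom_inj (E : Emb F) {g : GL (Fin 4) ℤ} (h : E.hom g = 1) : g = 1 := by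
  have h1 := E.P_hom g
  rw [h] at h1
  have h2 := congrArg (· * E.U) h1
  simp only [Units.val_one, Matrix.mul_one, Matrix.mul_assoc, E.PU] at h2
  apply Units.ext
  apply mq_inj
  rw [← h2, Units.val_one, map_one]

/-- the two embeddings -/
theorem two_emb (hF : F.IsSymm)
    (hL : ∀ u w : Fin m → ℚ, qeval F u < 0 → u ⬝ᵥ (F *ᵥ w) = 0 → 0 ≤ qeval F w)
    (E1 : Emb F) {z : Fin m → ℚ} (hz : E1.P *ᵥ z = 0) (hr : 0 < qeval F z) :
    ∃ (E : Bool → Emb F) (κ : ℕ) (x0 : Fin m → ℚ), 0 < κ ∧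
      (∀ g : GL (Fin 4) ℤ, Lor g → act g e1 = e1 → (E false).hom g = (E true).hom g) ∧
      qeval F x0 < 0 ∧ (∀ b, (E b).P *ᵥ x0 = vq xo) ∧
      ∀ x, qeval F x < 0 → ∃ b, lq ((E b).P *ᵥ x) (vq e1) ^ 2 <
        (κ : ℚ) * (- lq ((E b).P *ᵥ x) ((E b).P *ᵥ x)) := by
  set r := qeval F z with hrd
  set α := (r - 3) / (r + 3) with hα
  set β := -6 / (r + 3) with hβ
  have hr3 : r + 3 ≠ 0 := by positivity
  have hβr : β ^ 2 * r = 3 * (1 - α ^ 2) := by rw [hα, hβ]; field_simp; ring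
  have hα1 : |α| < 1 := by
    rw [abs_lt, hα, lt_div_iff₀ (by positivity), div_lt_iff₀ (by positivity)]
    constructor <;> linarith
  set p := E1.U *ᵥ vq e1 with hp
  set d := ((α - 1) / 3) • p + (β / 3) • z with hd
  have hPp : E1.P *ᵥ p = vq e1 := by rw [hp, Matrix.mulVec_mulVec, E1.PU, Matrix.one_mulVec]
  have hPd : E1.P *ᵥ d = ((α - 1) / 3) • vq e1 := by
    rw [hd, Matrix.mulVec_add, Matrix.mulVec_smul, Matrix.mulVec_smul, hPp, hz]; simp
  have hxd : ∀ x, x ⬝ᵥ (F *ᵥ d) = (α - 1) / 3 * lq (E1.P *ᵥ x) (vq e1) + β / 3 * (x ⬝ᵥ (F *ᵥ z)) := by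
    intro x
    rw [hd, bl_add, Matrix.mulVec_smul, dotProduct_smul, smul_eq_mul, E1.lq_P hF]
  have hdz : d ⬝ᵥ (F *ᵥ z) = β / 3 * r := by
    rw [bl_symm hF, hxd, hz]; rw [hrd]; simp [lq, qeval]
  have hdd : d ⬝ᵥ (F *ᵥ d) = -2 * ((α - 1) / 3) := by
    rw [hxd, hPd, hdz]
    have : lq (((α - 1) / 3) • vq e1) (vq e1) = ((α - 1) / 3) * 3 := by
      rw [← lq_e1]; simp only [lq, Pi.smul_apply, smul_eq_mul]; ring
    rw [this]
    linear_combination (1 / 9 : ℚ) * hβr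
  obtain ⟨κ, hκ⟩ := exists_nat_gt (3 * (1 + |α|) / (1 - |α|))
  have hκ0 : (0 : ℚ) < κ := lt_of_le_of_lt (div_nonneg (by positivity) (by linarith)) hκ
  have hκα : 3 * (1 + |α|) ≤ κ * (1 - |α|) := by
    rw [div_lt_iff₀ (by linarith)] at hκ; exact hκ.le
  have hP0 : E1.P *ᵥ (E1.U *ᵥ vq xo) = vq xo := by rw [Matrix.mulVec_mulVec, E1.PU, Matrix.one_mulVec]
  refine ⟨fun b => if b then E1.tw hF d _ hPd hdd else E1, κ, E1.U *ᵥ vq xo, by exact_mod_cast hκ0, ?_, ?_, ?_, ?_⟩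
  · intro g hg he
    exact E1.tw_hom hF d _ hPd hdd hg he
  · unfold qeval
    rw [← E1.lq_P hF, hP0, lq_vq, show lB xo xo = -1 by decide]; norm_num
  · intro b
    cases b
    · exact hP0
    · show (E1.tw hF d _ hPd hdd).P *ᵥ _ = _
      rw [E1.tw_P, hP0, bl_symm hF, ← E1.lq_P hF, hPd]
      have : lq (((α - 1) / 3) • vq e1) (vq xo) = 0 := by
        have h : lq (vq e1) (vq xo) = 0 := by rw [lq_vq, show lB e1 xo = 0 by decide]; norm_num
        have h2 : lq (((α - 1) / 3) • vq e1) (vq xo) = ((α - 1) / 3) * lq (vq e1) (vq xo) := by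
          simp only [lq, Pi.smul_apply, smul_eq_mul]; ring
        rw [h2, h, mul_zero]
      rw [this]; simp
  · intro x hx
    by_contra hcon
    push Not at hcon
    have h1 := hcon false
    have h2 := hcon true
    change (κ : ℚ) * (- lq (E1.P *ᵥ x) (E1.P *ᵥ x)) ≤ lq (E1.P *ᵥ x) (vq e1) ^ 2 at h1
    change (κ : ℚ) * (- lq ((E1.tw hF d _ hPd hdd).P *ᵥ x) ((E1.tw hF d _ hPd hdd).P *ᵥ x)) ≤
      lq ((E1.tw hF d _ hPd hdd).P *ᵥ x) (vq e1) ^ 2 at h2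
    rw [E1.tw_P, lq_smul_add, lq_add_left, lq_e1, hxd] at h2
    have h3 := E1.lower hF hL hz hr x
    rw [← hrd] at h3
    set ξ := lq (E1.P *ᵥ x) (vq e1)
    set ζ := x ⬝ᵥ (F *ᵥ z)
    set c := lq (E1.P *ᵥ x) (E1.P *ᵥ x)
    have e2 : ξ + ((α - 1) / 3 * ξ + β / 3 * ζ) * 3 = α * ξ + β * ζ := by ring
    rw [e2] at h2
    refine cover_arith (α := α) (κ := κ) (ξ1 := ξ) (ξ2 := α * ξ + β * ζ) (Q := - c + ξ ^ 2 / 3)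
      (t := ζ ^ 2 / r) hα1 hκ0 hκα ?_ ?_ ?_ ?_
    · rw [← hβr]; field_simp; ring
    · linarith
    · convert h1 using 2; ring
    · convert h2 using 2; ring

/-- action on rational vectors -/
def glAct (K : Subgroup (GL (Fin m) ℚ)) : MulAction K (Fin m → ℚ) where
  smul g x := ((g : GL (Fin m) ℚ) : Matrix (Fin m) (Fin m) ℚ) *ᵥ x
  one_smul x := Matrix.one_mulVec x
  mul_smul g h x := (Matrix.mulVec_mulVec x _ _).symm

theorem relIndex_mono_right {G : Type*} [Group G] {H K L : Subgroup G} (h : K ≤ L) (h0 : H.relIndex L ≠ 0) :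
    H.relIndex K ≠ 0 := fun h1 => h0 (Subgroup.relIndex_eq_zero_of_le_right h h1)

theorem partL (hF : F.IsSymm)
    (hL : ∀ u w : Fin m → ℚ, qeval F u < 0 → u ⬝ᵥ (F *ᵥ w) = 0 → 0 ≤ qeval F w)
    (E1 : Emb F) {z : Fin m → ℚ} (hz : E1.P *ᵥ z = 0) (hr : 0 < qeval F z)
    (H : Subgroup (GL (Fin m) ℤ)) (hH : H ≤ OZ F) (hidx : H.relIndex (OZ F) ≠ 0) :
    ∃ (A : Subgroup (GL (Fin 4) ℤ)) (C : Subgroup A) (f : Dbl C →* H), Group.FG A ∧ ¬ C.FG ∧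
      Function.Injective f := by
  obtain ⟨E, κ, x0, hκ, hE, hx0, hPx0, hcov⟩ := two_emb hF hL E1 hz hr
  obtain ⟨N1, hN1, hd1⟩ := (E false).den
  obtain ⟨N2, hN2, hd2⟩ := (E true).den
  set N := N1 * N2 * (2 * κ + 6) with hNd
  have hN0 : N ≠ 0 := by positivity
  have hNb : ∀ b i j k l, ∃ z : ℤ, (N : ℚ) * (E b).U i j * (E b).P k l = z := by
    intro b i j k l
    cases b
    · obtain ⟨z, hz⟩ := hd1 i j k l
      exact ⟨z * N2 * (2 * κ + 6), by rw [hNd]; push_cast; rw [← hz]; ring⟩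
    · obtain ⟨z, hz⟩ := hd2 i j k l
      exact ⟨z * N1 * (2 * κ + 6), by rw [hNd]; push_cast; rw [← hz]; ring⟩
  have hNκ : 2 * (κ : ℚ) + 6 ≤ N := by
    have : 1 * (2 * κ + 6) ≤ N := Nat.mul_le_mul_right _ (Nat.one_le_iff_ne_zero.2 (mul_ne_zero hN1 hN2))
    rw [one_mul] at this
    exact_mod_cast this
  set K := H.map jz with hK
  set B := A0 ⊓ Gmod N with hB
  set A' := B ⊓ (K.comap (E false).hom ⊓ K.comap (E true).hom) with hA'
  have hBA : B.relIndex A0 ≠ 0 := by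
    rw [hB, Subgroup.inf_relIndex_left]
    have : (Gmod N).Normal := by unfold Gmod; infer_instance
    exact ne_zero_of_dvd_ne_zero (Gmod_index N hN0) (Subgroup.relIndex_dvd_index_of_normal _ _)
  have hKO : K.relIndex ((OZ F).map jz) ≠ 0 := by
    rw [hK, Subgroup.relIndex_map_map_of_injective _ _ jz_inj]; exact hidx
  have hcom : ∀ b, (K.comap (E b).hom).relIndex B ≠ 0 := by
    intro b
    rw [Subgroup.relIndex_comap]
    refine relIndex_mono_right ?_ hKO
    exact (E b).map_le hF (hNb b) inf_le_right fun g hg => (Gc_lor g (A0_le_Gc hg.1)).matrix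
  have hAB : A'.relIndex B ≠ 0 := by
    rw [hA', Subgroup.inf_relIndex_left]
    exact Subgroup.relIndex_inf_ne_zero (hcom false) (hcom true)
  have hAA : A'.relIndex A0 ≠ 0 := Subgroup.relIndex_ne_zero_trans hAB hBA
  have hleA : A' ≤ A0 := inf_le_left.trans inf_le_left
  have hAfg : A'.FG := by
    have h0 : Group.FG A0 := (Group.fg_iff_subgroup_fg _).2 A0_fg
    have h1 : (A'.subgroupOf A0).FiniteIndex := ⟨hAA⟩
    have h2 := Subgroup.fg_of_index_ne_zero (A'.subgroupOf A0)
    have h3 := fg_map A0.subtype ((Group.fg_iff_subgroup_fg _).1 h2)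
    rwa [Subgroup.subgroupOf_map_subtype, inf_of_le_left hleA] at h3
  have hCnf : ¬ (C0.subgroupOf A').FG := by
    intro h
    have h3 := fg_map A'.subtype h
    rw [Subgroup.subgroupOf_map_subtype] at h3
    refine not_fg_of_finiteIndex C0 (C0 ⊓ A') inf_le_left ?_ C0_not_fg h3
    rw [Subgroup.inf_relIndex_left]
    exact relIndex_mono_right (fun g hg => hg.1) hAA
  have hmemK : ∀ b, ∀ a : A', (E b).hom a ∈ K := by
    intro b a
    cases b
    · exact a.2.2.1
    · exact a.2.2.2
  have hlor : ∀ a : A', Lor (a : GL (Fin 4) ℤ) := fun a => Gc_lor _ (A0_le_Gc (hleA a.2))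
  let ι : Bool → A' →* K := fun b => ((E b).hom.comp A'.subtype).codRestrict K (hmemK b)
  have hι : ∀ c ∈ C0.subgroupOf A', ι false c = ι true c := by
    intro c hc
    apply Subtype.ext
    exact hE c (hlor c) hc.2
  letI := glAct K
  have hKf : ∀ g : K, ∀ x, qeval F (g • x) = qeval F x := by
    rintro ⟨_, g, hg, rfl⟩ x
    exact hH hg x
  have hP : ∀ b (a : A') x, (E b).P *ᵥ (ι b a • x) = mq ((a : GL (Fin 4) ℤ) : Matrix (Fin 4) (Fin 4) ℤ) *ᵥ ((E b).P *ᵥ x) := by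
    intro b a x
    show (E b).P *ᵥ (((E b).hom a : Matrix (Fin m) (Fin m) ℚ) *ᵥ x) = _
    rw [Matrix.mulVec_mulVec, Emb.P_hom, Matrix.mulVec_mulVec]
  have hxo1 : lq (vq xo) (vq e1) = 0 := by rw [lq_vq, show lB xo e1 = 0 by decide]; norm_num
  have hxo2 : lq (vq xo) (vq xo) = -1 := by rw [lq_vq, show lB xo xo = -1 by decide]; norm_num
  have hκ' : (0 : ℚ) < κ := by exact_mod_cast hκ
  have hpp := Dbl.pingpong (C0.subgroupOf A') ι hι ?_ {x | qeval F x < 0} ?_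
    (fun b => {x | lq ((E b).P *ᵥ x) (vq e1) ^ 2 < (κ : ℚ) * (- lq ((E b).P *ᵥ x) ((E b).P *ᵥ x))}) ?_ x0 hx0 ?_ ?_ ?_
  · let e := (H.equivMapOfInjective jz jz_inj).symm
    exact ⟨A', C0.subgroupOf A', e.toMonoidHom.comp (Dbl.lift _ ι hι), (Group.fg_iff_subgroup_fg _).2 hAfg, hCnf,
      e.injective.comp hpp⟩
  · intro c _ h
    apply Subtype.ext
    exact (E false).hom_inj (congrArg Subtype.val h)
  · intro g x hx
    show qeval F (g • x) < 0
    rw [hKf]; exact hx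
  · intro x hx
    obtain ⟨b, hb⟩ := hcov x hx
    cases b
    · exact Or.inl hb
    · exact Or.inr hb
  · intro b
    show lq ((E b).P *ᵥ x0) (vq e1) ^ 2 < (κ : ℚ) * (- lq ((E b).P *ᵥ x0) ((E b).P *ᵥ x0))
    rw [hPx0, hxo1, hxo2]; linarith
  · intro c hc b
    show lq ((E b).P *ᵥ (ι b c • x0)) (vq e1) ^ 2 < (κ : ℚ) * (- lq ((E b).P *ᵥ (ι b c • x0)) ((E b).P *ᵥ (ι b c • x0)))
    have he : mq ((c : GL (Fin 4) ℤ) : Matrix (Fin 4) (Fin 4) ℤ) *ᵥ vq e1 = vq e1 := by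
      rw [mq_vq]; rw [show act (c : GL (Fin 4) ℤ) e1 = e1 from hc.2]
    rw [hP, hPx0, (hlor c).lq, hxo2]
    nth_rw 1 [← he]
    rw [(hlor c).lq, hxo1]; linarith
  · intro a ha b x _ hx
    show ¬ lq ((E b).P *ᵥ (ι b a • x)) (vq e1) ^ 2 < (κ : ℚ) * (- lq ((E b).P *ᵥ (ι b a • x)) ((E b).P *ᵥ (ι b a • x)))
    rw [hP]
    exact pp_step hκ' hNκ (hlor a) a.2.1.2 (fun h => ha ⟨hleA a.2, h⟩) hx

end Assembly

section Symbols

/-- parity of the valuation -/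
def vz (p : ℕ) (a : ℤ) : ZMod 2 := ((padicValInt p a : ℕ) : ZMod 2)

/-- unit part -/
def up (p : ℕ) (a : ℤ) : ℤ := a / (p : ℤ) ^ padicValInt p a

/-- residue symbol, additive -/
noncomputable def sgz (p : ℕ) (u : ℤ) : ZMod 2 := by
  classical exact if IsSquare (u : ZMod p) then 0 else 1

/-- residue symbol of the unit part -/
noncomputable def us (p : ℕ) (a : ℤ) : ZMod 2 := sgz p (up p a)

/-- tame symbol -/
noncomputable def hb (p : ℕ) (a b : ℤ) : ZMod 2 := vz p a * vz p b * sgz p (-1) + vz p b * us p a + vz p a * us p b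

theorem z2_cases (x : ZMod 2) : x = 0 ∨ x = 1 := by revert x; decide
theorem z2_add_self (x : ZMod 2) : x + x = 0 := by revert x; decide
theorem z2_mul_self (x : ZMod 2) : x * x = x := by revert x; decide

section
variable {p : ℕ} [hp : Fact p.Prime]

theorem up_spec (a : ℤ) : a = (p : ℤ) ^ padicValInt p a * up p a :=
  (Int.mul_ediv_cancel' (padicValInt_dvd a)).symm

theorem up_not_dvd {a : ℤ} (ha : a ≠ 0) : ¬ (p : ℤ) ∣ up p a := by
  intro h
  have h1 : (p : ℤ) ^ (padicValInt p a + 1) ∣ a := by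
    conv_rhs => rw [up_spec (p := p) a]
    rw [pow_succ]; exact mul_dvd_mul_left _ h
  rw [padicValInt_dvd_iff] at h1
  rcases h1 with h1 | h1
  · exact ha h1
  · omega

theorem pp_ne : (p : ℤ) ≠ 0 := by exact_mod_cast hp.out.ne_zero

theorem up_ne {a : ℤ} (ha : a ≠ 0) : up p a ≠ 0 := fun h => up_not_dvd (p := p) ha (h ▸ dvd_zero _)

theorem val_of {v : ℕ} {u : ℤ} (hu : ¬ (p : ℤ) ∣ u) : padicValInt p ((p : ℤ) ^ v * u) = v := by
  have hu0 : u ≠ 0 := fun h => hu (h ▸ dvd_zero _)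
  have h0 : (p : ℤ) ^ v ≠ 0 := pow_ne_zero _ pp_ne
  rw [padicValInt.mul h0 hu0, padicValInt.eq_zero_of_not_dvd hu, add_zero]
  unfold padicValInt
  rw [Int.natAbs_pow, Int.natAbs_natCast, padicValNat.prime_pow]

theorem vz_of {v : ℕ} {u : ℤ} (hu : ¬ (p : ℤ) ∣ u) : vz p ((p : ℤ) ^ v * u) = v := by
  rw [vz, val_of hu]

theorem up_of {v : ℕ} {u : ℤ} (hu : ¬ (p : ℤ) ∣ u) : up p ((p : ℤ) ^ v * u) = u := by
  rw [up, val_of hu, Int.mul_ediv_cancel_left _ (pow_ne_zero _ pp_ne)]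

theorem us_of {v : ℕ} {u : ℤ} (hu : ¬ (p : ℤ) ∣ u) : us p ((p : ℤ) ^ v * u) = sgz p u := by
  rw [us, up_of hu]

theorem vz_unit {u : ℤ} (hu : ¬ (p : ℤ) ∣ u) : vz p u = 0 := by
  have := vz_of (v := 0) hu; simpa using this

theorem up_unit {u : ℤ} (hu : ¬ (p : ℤ) ∣ u) : up p u = u := by
  have := up_of (v := 0) hu; simpa using this

theorem us_unit {u : ℤ} (hu : ¬ (p : ℤ) ∣ u) : us p u = sgz p u := by rw [us, up_unit hu]

theorem vz_mul {a b : ℤ} (ha : a ≠ 0) (hb : b ≠ 0) : vz p (a * b) = vz p a + vz p b := by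
  rw [vz, padicValInt.mul ha hb]; push_cast; rfl

theorem up_mul {a b : ℤ} (ha : a ≠ 0) (hb : b ≠ 0) : up p (a * b) = up p a * up p b := by
  have h : a * b = (p : ℤ) ^ (padicValInt p a + padicValInt p b) * (up p a * up p b) := by
    conv_lhs => rw [up_spec (p := p) a, up_spec (p := p) b]
    ring
  rw [h, up_of]
  intro hd
  rcases (Nat.prime_iff_prime_int.1 hp.out).dvd_or_dvd hd with h | h
  · exact up_not_dvd ha h
  · exact up_not_dvd hb h

theorem not_dvd_mul {a b : ℤ} (ha : ¬ (p : ℤ) ∣ a) (hb : ¬ (p : ℤ) ∣ b) : ¬ (p : ℤ) ∣ a * b := fun h =>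
  ((Nat.prime_iff_prime_int.1 hp.out).dvd_or_dvd h).elim ha hb

theorem cast_ne {u : ℤ} (hu : ¬ (p : ℤ) ∣ u) : (u : ZMod p) ≠ 0 := by
  rwa [Ne, ZMod.intCast_zmod_eq_zero_iff_dvd]

theorem sg_mul {a b : ℤ} (ha : ¬ (p : ℤ) ∣ a) (hb : ¬ (p : ℤ) ∣ b) :
    sgz p (a * b) = sgz p a + sgz p b := by
  have h1 : (b : ZMod p) ≠ 0 := cast_ne hb
  have h0 : (a : ZMod p) ≠ 0 := cast_ne ha
  have hm := quadraticCharFun_mul (a : ZMod p) (b : ZMod p)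
  unfold quadraticCharFun at hm
  unfold sgz
  push_cast
  simp only [mul_eq_zero, h0, h1, or_self, if_false] at hm
  split_ifs at hm ⊢ <;> first | rfl | (exfalso; revert hm; decide)

theorem us_mul {a b : ℤ} (ha : a ≠ 0) (hb : b ≠ 0) : us p (a * b) = us p a + us p b := by
  rw [us, up_mul ha hb, sg_mul (up_not_dvd ha) (up_not_dvd hb)]; rfl

theorem sg_congr {a b : ℤ} (h : (p : ℤ) ∣ a - b) : sgz p a = sgz p b := by
  have : (a : ZMod p) = (b : ZMod p) := by
    rw [← sub_eq_zero, ← Int.cast_sub, ZMod.intCast_zmod_eq_zero_iff_dvd]; exact h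
  unfold sgz; rw [this]

theorem sg_sq (a : ℤ) : sgz p (a * a) = 0 := by
  unfold sgz; rw [if_pos ⟨(a : ZMod p), by push_cast; rfl⟩]

theorem sg_one : sgz p 1 = 0 := by have := sg_sq (p := p) 1; simpa using this

theorem hb_comm (a b : ℤ) : hb p a b = hb p b a := by unfold hb; ring

theorem hb_mul {a b c : ℤ} (hb : b ≠ 0) (hc : c ≠ 0) : Paper.hb p a (b * c) = Paper.hb p a b + Paper.hb p a c := by
  unfold Paper.hb; rw [vz_mul hb hc, us_mul hb hc]; ring

theorem hb_mul' {a b c : ℤ} (hb : b ≠ 0) (hc : c ≠ 0) : Paper.hb p (b * c) a = Paper.hb p b a + Paper.hb p c a := by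
  rw [hb_comm, hb_mul hb hc, hb_comm a, hb_comm a]

theorem hb_unit {a b : ℤ} (ha : ¬ (p : ℤ) ∣ a) (hb : ¬ (p : ℤ) ∣ b) : Paper.hb p a b = 0 := by
  unfold Paper.hb; rw [vz_unit ha, vz_unit hb]; ring

theorem hb_sq {a b : ℤ} (hb : b ≠ 0) : Paper.hb p a (b * b) = 0 := by
  rw [hb_mul hb hb, z2_add_self]

theorem not_dvd_neg_one : ¬ (p : ℤ) ∣ -1 := by
  rw [dvd_neg]; exact_mod_cast hp.out.one_lt.ne' ∘ Nat.dvd_one.1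

theorem hb_neg {a : ℤ} (ha : a ≠ 0) : Paper.hb p a (-a) = 0 := by
  have h : (-a) = (-1) * a := by ring
  unfold Paper.hb
  rw [h, vz_mul (by norm_num) ha, us_mul (by norm_num) ha, vz_unit not_dvd_neg_one, us_unit not_dvd_neg_one,
    zero_add, z2_mul_self]
  have := z2_add_self (vz p a * sgz p (-1))
  have h2 := z2_add_self (vz p a * us p a)
  linear_combination this + h2

theorem hb_steinberg {a t : ℤ} (ha : a ≠ 0) (h : t * t - a ≠ 0) : Paper.hb p a (t * t - a) = 0 := by
  by_cases ht : t = 0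
  · rw [ht]; simpa using hb_neg ha
  have ea := up_spec (p := p) a
  have et := up_spec (p := p) t
  have na := up_not_dvd (p := p) ha
  have nt := up_not_dvd (p := p) ht
  set v := padicValInt p a
  set w := padicValInt p t
  set a' := up p a
  set t' := up p t
  rcases lt_trichotomy (2 * w) v with hlt | heq | hgt
  · obtain ⟨k, hk⟩ := Nat.exists_eq_add_of_lt hlt
    have hn : ¬ (p : ℤ) ∣ t' * t' - p ^ (k + 1) * a' := by
      intro hd
      have : (p : ℤ) ∣ t' * t' := by
        have h2 : (p : ℤ) ∣ p ^ (k + 1) * a' := Dvd.dvd.mul_right (dvd_pow_self _ (by omega)) _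
        have := dvd_add hd h2; simpa using this
      exact not_dvd_mul nt nt this
    have e : t * t - a = (p : ℤ) ^ (2 * w) * (t' * t' - p ^ (k + 1) * a') := by
      rw [ea, et, hk]; ring
    unfold Paper.hb
    rw [e, vz_of hn, us_of hn, sg_congr (a := t' * t' - p ^ (k + 1) * a') (b := t' * t') ?_, sg_sq]
    · have : ((2 * w : ℕ) : ZMod 2) = 0 := by push_cast; rw [show (2 : ZMod 2) = 0 from rfl, zero_mul]
      rw [this]; ring
    · rw [sub_sub_cancel_left]; exact (Dvd.dvd.mul_right (dvd_pow_self _ (by omega)) _).neg_right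
  · have hev : vz p a = 0 := by
      conv_lhs => rw [ea, ← heq]
      rw [vz_of na]; push_cast; rw [show (2 : ZMod 2) = 0 from rfl, zero_mul]
    by_cases hd : (p : ℤ) ∣ t' * t' - a'
    · have hus : us p a = 0 := by
        conv_lhs => rw [ea]
        rw [us_of na, ← sg_congr hd, sg_sq]
      unfold Paper.hb; rw [hev, hus]; ring
    · have e : t * t - a = (p : ℤ) ^ (2 * w) * (t' * t' - a') := by
        rw [ea, et, heq.symm]; ring
      unfold Paper.hb
      rw [e, vz_of hd, hev]
      push_cast; rw [show (2 : ZMod 2) = 0 from rfl]; ring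
  · obtain ⟨k, hk⟩ := Nat.exists_eq_add_of_lt hgt
    set y := a' - p ^ (k + 1) * (t' * t') with hy
    have hya : (p : ℤ) ∣ y - a' := by
      rw [hy, sub_sub_cancel_left]
      exact (Dvd.dvd.mul_right (dvd_pow_self _ (by omega)) _).neg_right
    have hyn : ¬ (p : ℤ) ∣ y := fun hd => na (by have := dvd_sub hd hya; simpa using this)
    have e : t * t - a = (-1) * ((p : ℤ) ^ v * y) := by
      rw [hy, mul_sub, ← mul_assoc, ← pow_add, show v + (k + 1) = 2 * w by omega, ea, et]; ring
    have hne : (p : ℤ) ^ v * y ≠ 0 := by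
      intro h0; rw [e, h0] at h; simp at h
    have h3 := hb_neg (p := p) ha
    rw [neg_eq_neg_one_mul, hb_mul (by norm_num) ha] at h3
    rw [e, hb_mul (by norm_num) hne, ← h3]
    congr 1
    conv_rhs => rw [ea]
    conv_lhs => rw [ea]
    unfold Paper.hb
    rw [vz_of na, vz_of hyn, us_of na, us_of hyn, sg_congr hya]

end
end Symbols

section Ternary

theorem sq_mod_squarefree (a : ℤ) : ∀ b : ℕ, Squarefree b → (∀ p : ℕ, p.Prime → p ∣ b → ∃ t : ℤ, (p : ℤ) ∣ t * t - a) →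
    ∃ t : ℤ, (b : ℤ) ∣ t * t - a := by
  intro b
  induction b using Nat.recOnPrimeCoprime with
  | zero => intro h; exact absurd h not_squarefree_zero
  | prime_pow p n hp =>
    intro hs h
    rcases Nat.eq_zero_or_pos n with h0 | h0
    · exact ⟨0, by simp [h0]⟩
    · have : n = 1 := by
        by_contra h1
        have h2 : p * p ∣ p ^ n := by rw [← pow_two]; exact pow_dvd_pow _ (by omega)
        exact hp.not_isUnit (hs p h2)
      rw [this, pow_one]
      exact h p hp (by rw [this, pow_one])
  | coprime x y hx hy hxy ihx ihy =>
    intro hs h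
    obtain ⟨t1, h1⟩ := ihx (hs.squarefree_of_dvd (dvd_mul_right _ _)) fun p hp hd => h p hp (hd.mul_right _)
    obtain ⟨t2, h2⟩ := ihy (hs.squarefree_of_dvd (dvd_mul_left _ _)) fun p hp hd => h p hp (hd.mul_left _)
    have hc : IsCoprime (x : ℤ) (y : ℤ) := Nat.isCoprime_iff_coprime.2 hxy
    obtain ⟨u, v, huv⟩ := hc
    refine ⟨t1 + u * x * (t2 - t1), ?_⟩
    push_cast
    refine IsCoprime.mul_dvd (Nat.isCoprime_iff_coprime.2 hxy) ?_ ?_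
    · obtain ⟨k, hk⟩ := h1
      exact ⟨k + 2 * t1 * u * (t2 - t1) + u * u * x * (t2 - t1) * (t2 - t1), by linear_combination hk⟩
    · obtain ⟨k, hk⟩ := h2
      have e : t1 + u * x * (t2 - t1) = t2 - v * y * (t2 - t1) := by linear_combination (t2 - t1) * huv
      rw [e]
      exact ⟨k - 2 * t2 * v * (t2 - t1) + v * v * y * (t2 - t1) * (t2 - t1), by linear_combination hk⟩

/-- solvability of the ternary equation -/
def Tern (a b : ℤ) : Prop := ∃ x y z : ℤ, (x ≠ 0 ∨ y ≠ 0 ∨ z ≠ 0) ∧ z * z = a * (x * x) + b * (y * y)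

theorem Tern.symm {a b : ℤ} (h : Tern a b) : Tern b a := by
  obtain ⟨x, y, z, h0, h⟩ := h
  exact ⟨y, x, z, by tauto, by linarith⟩

theorem Tern.sq {a b d : ℤ} (hd : d ≠ 0) (h : Tern a b) : Tern (d * d * a) b := by
  obtain ⟨x, y, z, h0, h⟩ := h
  refine ⟨x, d * y, d * z, ?_, by linear_combination d * d * h⟩
  rcases h0 with h0 | h0 | h0
  · exact Or.inl h0
  · exact Or.inr (Or.inl (mul_ne_zero hd h0))
  · exact Or.inr (Or.inr (mul_ne_zero hd h0))

theorem small_rep (b : ℕ) (hb : 0 < b) (t : ℤ) : ∃ t' : ℤ, (b : ℤ) ∣ t' - t ∧ 2 * t'.natAbs ≤ b := by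
  have hb' : (0 : ℤ) < b := by exact_mod_cast hb
  refine ⟨t.bmod b, ?_, ?_⟩
  · have := Int.bmod_emod (x := t) (m := b)
    exact Int.ModEq.dvd (this.symm)
  · have h1 := Int.le_bmod (x := t) hb
    have h2 := Int.bmod_le (x := t) hb
    omega

theorem size_bound {a b b' t : ℤ} (h : t * t - a = b * b') (ht : 2 * t.natAbs ≤ b.natAbs) (hab : a.natAbs ≤ b.natAbs)
    (hb : 2 ≤ b.natAbs) : b'.natAbs < b.natAbs := by
  by_contra hc
  push Not at hc
  have h1 : b.natAbs * b'.natAbs ≤ t.natAbs * t.natAbs + a.natAbs := by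
    rw [← Int.natAbs_mul, ← h, ← Int.natAbs_mul]; exact Int.natAbs_sub_le _ _
  have h2 : b.natAbs * b.natAbs ≤ b.natAbs * b'.natAbs := Nat.mul_le_mul_left _ hc
  have h3 : (2 * t.natAbs) * (2 * t.natAbs) ≤ b.natAbs * b.natAbs := Nat.mul_le_mul ht ht
  nlinarith

theorem tern_main : ∀ (n : ℕ) (a b : ℤ), a.natAbs + b.natAbs = n → a ≠ 0 → b ≠ 0 → (0 < a ∨ 0 < b) →
    (∀ p : ℕ, p.Prime → p ≠ 2 → hb p a b = 0) → Tern a b := by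
  intro n
  induction n using Nat.strong_induction_on with
  | _ n ih =>
  have key : ∀ a b : ℤ, a.natAbs + b.natAbs = n → a ≠ 0 → b ≠ 0 → (0 < a ∨ 0 < b) →
      (∀ p : ℕ, p.Prime → p ≠ 2 → hb p a b = 0) → a.natAbs ≤ b.natAbs → Tern a b := by
    intro a b hn ha hb hpos hloc hle
    by_cases hsq : Squarefree b.natAbs
    swap
    · rw [Int.squarefree_natAbs] at hsq
      unfold Squarefree at hsq
      push Not at hsq
      obtain ⟨d, ⟨c, hc⟩, hd⟩ := hsq
      have hd0 : d ≠ 0 := by rintro rfl; simp at hc; exact hb hc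
      have hc0 : c ≠ 0 := by rintro rfl; simp at hc; exact hb hc
      have hdd : 0 < d * d := mul_self_pos.2 hd0
      rw [hc]
      refine (Tern.sq hd0 (ih (a.natAbs + c.natAbs) ?_ a c rfl ha hc0 ?_ ?_).symm).symm
      · rw [← hn, hc, Int.natAbs_mul, Int.natAbs_mul]
        have h1 : 2 ≤ d.natAbs := by
          have h3 : d.natAbs ≠ 1 := fun h => hd (Int.isUnit_iff_natAbs_eq.2 h)
          have h4 : d.natAbs ≠ 0 := by simpa using hd0
          omega
        have h2 : 0 < c.natAbs := by omega
        have h3 : 2 * 2 ≤ d.natAbs * d.natAbs := Nat.mul_le_mul h1 h1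
        have h4 : 4 * c.natAbs ≤ d.natAbs * d.natAbs * c.natAbs := Nat.mul_le_mul_right _ h3
        omega
      · rcases hpos with h | h
        · exact Or.inl h
        · right; rw [hc] at h; exact (pos_iff_pos_of_mul_pos h).1 hdd
      · intro p hp hp2
        have : Fact p.Prime := ⟨hp⟩
        have := hloc p hp hp2
        rwa [hc, hb_mul (mul_ne_zero hd0 hd0) hc0, hb_sq hd0, zero_add] at this
    by_cases hb1 : b.natAbs < 2
    · have hb' : b.natAbs = 1 := by omega
      have ha' : a.natAbs = 1 := by omega
      rcases hpos with h | h
      · exact ⟨1, 0, 1, Or.inl one_ne_zero, by rw [show a = 1 by omega]; ring⟩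
      · exact ⟨0, 1, 1, Or.inr (Or.inl one_ne_zero), by rw [show b = 1 by omega]; ring⟩
    push Not at hb1
    obtain ⟨t, ht⟩ := sq_mod_squarefree a b.natAbs hsq (by
      intro p hp hd
      have : Fact p.Prime := ⟨hp⟩
      by_cases hp2 : p = 2
      · rcases Int.even_or_odd' a with ⟨k, hk | hk⟩
        · exact ⟨0, by rw [hp2, hk]; exact ⟨-k, by push_cast; ring⟩⟩
        · exact ⟨1, by rw [hp2, hk]; exact ⟨-k, by push_cast; ring⟩⟩
      by_cases hpa : (p : ℤ) ∣ a
      · exact ⟨0, by simpa using hpa⟩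
      have h0 := hloc p hp hp2
      obtain ⟨c, hc⟩ : (p : ℤ) ∣ b := by rw [← Int.natCast_dvd] at hd; exact hd
      have hpc : ¬ (p : ℤ) ∣ c := by
        rintro ⟨e, he⟩
        have : p * p ∣ b.natAbs := by
          rw [hc, he, ← mul_assoc, Int.natAbs_mul, Int.natAbs_mul, Int.natAbs_natCast]; exact dvd_mul_right _ _
        exact hp.not_isUnit (hsq p this)
      have hvb : vz p b = 1 := by
        have := vz_of (v := 1) hpc
        rw [hc]; simpa using this
      unfold Paper.hb at h0
      rw [vz_unit hpa, hvb, us_unit hpa] at h0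
      have h1 : sgz p a = 0 := by linear_combination h0
      unfold sgz at h1
      split_ifs at h1 with h2
      · obtain ⟨r, hr⟩ := h2
        obtain ⟨r, rfl⟩ := ZMod.intCast_surjective r
        refine ⟨r, ?_⟩
        rw [← ZMod.intCast_zmod_eq_zero_iff_dvd]
        push_cast; rw [hr, sub_self]
      · exact absurd h1 (by decide))
    obtain ⟨t', htt, hts⟩ := small_rep b.natAbs (by omega) t
    have hdiv : (b.natAbs : ℤ) ∣ t' * t' - a := by
      have : t' * t' - a = (t' - t) * (t' + t) + (t * t - a) := by ring
      rw [this]; exact dvd_add (htt.mul_right _) ht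
    obtain ⟨b', hb'⟩ : b ∣ t' * t' - a := by rwa [Int.natAbs_dvd] at hdiv
    by_cases hb0 : b' = 0
    · exact ⟨1, 0, t', Or.inl one_ne_zero, by rw [hb0] at hb'; linarith⟩
    have hlt := size_bound hb' hts hle hb1
    obtain ⟨x, y, z, hxyz, h⟩ := ih (a.natAbs + b'.natAbs) (by omega) a b' rfl ha hb0 (by
      by_cases hap : 0 < a
      · exact Or.inl hap
      right
      have hbp : 0 < b := hpos.resolve_left hap
      have : 0 < b * b' := by rw [← hb']; nlinarith [mul_self_nonneg t', lt_of_le_of_ne (not_lt.1 hap) ha]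
      exact (pos_iff_pos_of_mul_pos this).1 hbp) (by
      intro p hp hp2
      have : Fact p.Prime := ⟨hp⟩
      have h1 := hb_steinberg (p := p) ha (t := t') (by rw [hb']; exact mul_ne_zero hb hb0)
      rwa [hb', hb_mul hb hb0, hloc p hp hp2, zero_add] at h1)
    by_cases hy : y = 0
    · exact ⟨x, y, z, hxyz, by rw [hy] at h ⊢; linarith⟩
    · refine ⟨t' * x + z, b' * y, t' * z + a * x, Or.inr (Or.inl (mul_ne_zero hb0 hy)), ?_⟩
      linear_combination (t' * t' - a) * h + b' * (y * y) * hb'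
  intro a b hn ha hb hpos hloc
  rcases le_total a.natAbs b.natAbs with h | h
  · exact key a b hn ha hb hpos hloc h
  · refine (key b a (by omega) hb ha hpos.symm (fun p hp hp2 => ?_) h).symm
    have : Fact p.Prime := ⟨hp⟩
    rw [hb_comm]; exact hloc p hp hp2

end Ternary

section ProductFormula

/-- sign -/
def sn (a : ℤ) : ZMod 2 := if a < 0 then 1 else 0
/-- character mod four -/
def e4 (u : ℤ) : ZMod 2 := if u % 4 = 3 then 1 else 0
/-- character mod eight -/
def w8 (u : ℤ) : ZMod 2 := if u % 8 = 3 ∨ u % 8 = 5 then 1 else 0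
/-- dyadic symbol -/
def h2 (a b : ℤ) : ZMod 2 := e4 (up 2 a) * e4 (up 2 b) + vz 2 a * w8 (up 2 b) + vz 2 b * w8 (up 2 a)

theorem sn_mul {a b : ℤ} (ha : a ≠ 0) (hb : b ≠ 0) : sn (a * b) = sn a + sn b := by
  unfold sn
  rcases lt_or_gt_of_ne ha with h1 | h1 <;> rcases lt_or_gt_of_ne hb with h3 | h3
  · rw [if_neg (mul_pos_of_neg_of_neg h1 h3).not_gt, if_pos h1, if_pos h3]; rfl
  · rw [if_pos (mul_neg_of_neg_of_pos h1 h3), if_pos h1, if_neg h3.not_gt]; rfl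
  · rw [if_pos (mul_neg_of_pos_of_neg h1 h3), if_neg h1.not_gt, if_pos h3]; rfl
  · rw [if_neg (mul_pos h1 h3).not_gt, if_neg h1.not_gt, if_neg h3.not_gt]; rfl

theorem e4_mul {a b : ℤ} (ha : ¬ ((2 : ℕ) : ℤ) ∣ a) (hb : ¬ ((2 : ℕ) : ℤ) ∣ b) : e4 (a * b) = e4 a + e4 b := by
  have h1 : a % 4 = 1 ∨ a % 4 = 3 := by omega
  have h3 : b % 4 = 1 ∨ b % 4 = 3 := by omega
  unfold e4
  rw [Int.mul_emod]
  rcases h1 with h1 | h1 <;> rcases h3 with h3 | h3 <;> rw [h1, h3] <;> decide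

theorem w8_mul {a b : ℤ} (ha : ¬ ((2 : ℕ) : ℤ) ∣ a) (hb : ¬ ((2 : ℕ) : ℤ) ∣ b) : w8 (a * b) = w8 a + w8 b := by
  have h1 : a % 8 = 1 ∨ a % 8 = 3 ∨ a % 8 = 5 ∨ a % 8 = 7 := by omega
  have h3 : b % 8 = 1 ∨ b % 8 = 3 ∨ b % 8 = 5 ∨ b % 8 = 7 := by omega
  unfold w8
  rw [Int.mul_emod]
  rcases h1 with h1 | h1 | h1 | h1 <;> rcases h3 with h3 | h3 | h3 | h3 <;> rw [h1, h3] <;> decide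

theorem h2_comm (a b : ℤ) : h2 a b = h2 b a := by unfold h2; ring

theorem h2_mul {a b c : ℤ} (hb : b ≠ 0) (hc : c ≠ 0) : h2 a (b * c) = h2 a b + h2 a c := by
  unfold h2
  rw [up_mul hb hc, vz_mul hb hc, e4_mul (up_not_dvd hb) (up_not_dvd hc), w8_mul (up_not_dvd hb) (up_not_dvd hc)]
  ring

/-- the total symbol -/
noncomputable def tot (T : Finset ℕ) (a b : ℤ) : ZMod 2 := sn a * sn b + h2 a b + ∑ p ∈ T, hb p a b

theorem tot_comm (T : Finset ℕ) (hT : ∀ p ∈ T, p.Prime ∧ p ≠ 2) (a b : ℤ) : tot T a b = tot T b a := by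
  unfold tot
  rw [h2_comm, mul_comm, Finset.sum_congr rfl fun p hp => ?_]
  have : Fact p.Prime := ⟨(hT p hp).1⟩
  exact hb_comm a b

theorem tot_mul (T : Finset ℕ) (hT : ∀ p ∈ T, p.Prime ∧ p ≠ 2) {a b c : ℤ} (hb : b ≠ 0) (hc : c ≠ 0) :
    tot T a (b * c) = tot T a b + tot T a c := by
  unfold tot
  rw [h2_mul hb hc, sn_mul hb hc]
  have : ∑ p ∈ T, Paper.hb p a (b * c) = ∑ p ∈ T, Paper.hb p a b + ∑ p ∈ T, Paper.hb p a c := by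
    rw [← Finset.sum_add_distrib]
    refine Finset.sum_congr rfl fun p hp => ?_
    have : Fact p.Prime := ⟨(hT p hp).1⟩
    exact hb_mul hb hc
  rw [this]; ring

theorem mul_induct (T : Finset ℕ) (P : ℤ → Prop) (hneg : P (-1)) (h2 : P 2)
    (hmul : ∀ a b, a ≠ 0 → b ≠ 0 → P a → P b → P (a * b)) (hpr : ∀ p ∈ T, P (p : ℤ)) (a : ℤ) (ha : a ≠ 0)
    (hT : ∀ p : ℕ, p.Prime → p ≠ 2 → (p : ℤ) ∣ a → p ∈ T) : P a := by
  have h1 : P 1 := by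
    have := hmul (-1) (-1) (by norm_num) (by norm_num) hneg hneg
    simpa using this
  have key : ∀ n : ℕ, n ≠ 0 → (∀ p : ℕ, p.Prime → p ≠ 2 → p ∣ n → p ∈ T) → P (n : ℤ) := by
    intro n
    induction n using Nat.recOnMul with
    | zero => intro h; exact absurd rfl h
    | one => intro _ _; exact_mod_cast h1
    | prime p hp =>
      intro _ h
      by_cases hp2 : p = 2
      · rw [hp2]; exact_mod_cast h2
      · exact hpr p (h p hp hp2 dvd_rfl)
    | mul a b iha ihb =>
      intro h0 h
      have ha0 : a ≠ 0 := left_ne_zero_of_mul h0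
      have hb0 : b ≠ 0 := right_ne_zero_of_mul h0
      push_cast
      exact hmul _ _ (by exact_mod_cast ha0) (by exact_mod_cast hb0)
        (iha ha0 fun p hp hp2 hd => h p hp hp2 (hd.mul_right _)) (ihb hb0 fun p hp hp2 hd => h p hp hp2 (hd.mul_left _))
  have h3 := key a.natAbs (by simpa using ha) fun p hp hp2 hd => hT p hp hp2 (by rwa [Int.natCast_dvd])
  rcases Int.natAbs_eq a with h | h
  · rw [h]; exact h3
  · rw [h, neg_eq_neg_one_mul]
    exact hmul _ _ (by norm_num) (by simpa using ha) hneg h3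

theorem pr_not_dvd {p l : ℕ} (hp : p.Prime) (hl : l.Prime) (h : p ≠ l) : ¬ (p : ℤ) ∣ (l : ℤ) := by
  intro hd
  exact h ((Nat.prime_dvd_prime_iff_eq hp hl).1 (by exact_mod_cast hd))

theorem vz_self {p : ℕ} [hp : Fact p.Prime] : vz p p = 1 := by
  have := vz_of (p := p) (v := 1) (u := 1) (by exact_mod_cast hp.out.one_lt.ne' ∘ Nat.dvd_one.1)
  simpa using this

theorem us_self {p : ℕ} [hp : Fact p.Prime] : us p p = 0 := by
  have := us_of (p := p) (v := 1) (u := 1) (by exact_mod_cast hp.out.one_lt.ne' ∘ Nat.dvd_one.1)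
  rw [sg_one] at this
  simpa using this

theorem hb_self_left {p : ℕ} [hp : Fact p.Prime] {b : ℤ} (hb : ¬ (p : ℤ) ∣ b) : Paper.hb p p b = sgz p b := by
  unfold Paper.hb; rw [vz_self, us_self, vz_unit hb, us_unit hb]; ring

theorem sg_neg_one {p : ℕ} [hp : Fact p.Prime] (h2 : p ≠ 2) : sgz p (-1) = e4 p := by
  have h := ZMod.exists_sq_eq_neg_one_iff (p := p)
  have ho := hp.out.eq_two_or_odd.resolve_left h2
  unfold sgz e4
  push_cast
  by_cases h3 : p % 4 = 3
  · rw [if_neg (fun hc => (h.1 hc) h3), if_pos (by omega)]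
  · rw [if_pos (h.2 h3), if_neg (by omega)]

theorem sg_two {p : ℕ} [hp : Fact p.Prime] (h2 : p ≠ 2) : sgz p 2 = w8 p := by
  have h := ZMod.exists_sq_eq_two_iff (p := p) h2
  have ho := hp.out.eq_two_or_odd.resolve_left h2
  unfold sgz w8
  push_cast
  by_cases h3 : p % 8 = 1 ∨ p % 8 = 7
  · rw [if_pos (h.2 h3), if_neg (by omega)]
  · rw [if_neg (fun hc => h3 (h.1 hc)), if_pos (by omega)]

theorem sg_qr {p q : ℕ} [hp : Fact p.Prime] [hq : Fact q.Prime] (h2 : p ≠ 2) (h2' : q ≠ 2) (hpq : p ≠ q) :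
    e4 p * e4 q + (sgz p q + sgz q p) = 0 := by
  have ho := hp.out.eq_two_or_odd.resolve_left h2
  have ho' := hq.out.eq_two_or_odd.resolve_left h2'
  unfold sgz e4
  push_cast
  by_cases h1 : p % 4 = 1
  · have h := ZMod.exists_sq_eq_prime_iff_of_mod_four_eq_one (p := p) (q := q) h1 h2'
    rw [if_neg (by omega)]
    by_cases h3 : IsSquare (q : ZMod p)
    · rw [if_pos h3, if_pos (h.1 h3)]; ring
    · rw [if_neg h3, if_neg (fun hc => h3 (h.2 hc))]; ring_nf; rfl
  by_cases h1' : q % 4 = 1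
  · have h := ZMod.exists_sq_eq_prime_iff_of_mod_four_eq_one (p := q) (q := p) h1' h2
    rw [if_neg (c := ((q : ℤ) % 4 = 3)) (by omega)]
    by_cases h3 : IsSquare (q : ZMod p)
    · rw [if_pos h3, if_pos (h.2 h3)]; ring
    · rw [if_neg h3, if_neg (fun hc => h3 (h.1 hc))]; ring_nf; rfl
  have h := ZMod.exists_sq_eq_prime_iff_of_mod_four_eq_three (p := p) (q := q) (by omega) (by omega) hpq
  rw [if_pos (c := ((q : ℤ) % 4 = 3)) (by omega), if_pos (c := ((p : ℤ) % 4 = 3)) (by omega)]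
  by_cases h3 : IsSquare (q : ZMod p)
  · rw [if_pos h3, if_neg (h.1 h3)]; decide
  · rw [if_neg h3, if_pos (by by_contra hc; exact h3 (h.2 hc))]; decide

theorem odd_nd {l : ℕ} (hl : l.Prime) (h2 : l ≠ 2) : ¬ ((2 : ℕ) : ℤ) ∣ (l : ℤ) := pr_not_dvd Nat.prime_two hl h2.symm

theorem up2_neg_one : up 2 (-1) = -1 := up_unit (p := 2) (by decide)
theorem up2_two : up 2 2 = 1 := by
  have := up_of (p := 2) (v := 1) (u := 1) (by decide); simpa using this
theorem vz2_neg_one : vz 2 (-1) = 0 := vz_unit (p := 2) (by decide)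
theorem vz2_two : vz 2 2 = 1 := by
  have := vz_of (p := 2) (v := 1) (u := 1) (by decide); simpa using this

theorem tot_zero (T : Finset ℕ) (hT : ∀ p ∈ T, p.Prime ∧ p ≠ 2) (a b : ℤ) (ha : a ≠ 0) (hb : b ≠ 0)
    (hTa : ∀ p : ℕ, p.Prime → p ≠ 2 → (p : ℤ) ∣ a → p ∈ T)
    (hTb : ∀ p : ℕ, p.Prime → p ≠ 2 → (p : ℤ) ∣ b → p ∈ T) : tot T a b = 0 := by
  have hm : ∀ c x y : ℤ, x ≠ 0 → y ≠ 0 → tot T c x = 0 → tot T c y = 0 → tot T c (x * y) = 0 := by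
    intro c x y hx hy h1 h3
    rw [tot_mul T hT hx hy, h1, h3, add_zero]
  have hm' : ∀ c x y : ℤ, x ≠ 0 → y ≠ 0 → tot T x c = 0 → tot T y c = 0 → tot T (x * y) c = 0 := by
    intro c x y hx hy h1 h3
    rw [tot_comm T hT] at h1 h3 ⊢
    exact hm c x y hx hy h1 h3
  have s0 : ∀ l : ℕ, sn l = 0 := fun l => if_neg (by omega)
  have nn : ∀ p ∈ T, ¬ (p : ℤ) ∣ -1 := fun p hp => by
    have : Fact p.Prime := ⟨(hT p hp).1⟩
    exact not_dvd_neg_one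
  have n2 : ∀ p ∈ T, ¬ (p : ℤ) ∣ 2 := fun p hp => by
    have := pr_not_dvd (hT p hp).1 Nat.prime_two (hT p hp).2
    exact_mod_cast this
  have z0 : ∀ x y : ℤ, (∀ p ∈ T, ¬ (p : ℤ) ∣ x) → (∀ p ∈ T, ¬ (p : ℤ) ∣ y) → ∑ p ∈ T, Paper.hb p x y = 0 := by
    intro x y hx hy
    refine Finset.sum_eq_zero fun p hp => ?_
    have : Fact p.Prime := ⟨(hT p hp).1⟩
    exact hb_unit (hx p hp) (hy p hp)
  have z1 : ∀ l ∈ T, ∀ y : ℤ, (∀ p ∈ T, ¬ (p : ℤ) ∣ y) → ∑ p ∈ T, Paper.hb p l y = sgz l y := by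
    intro l hl y hy
    have : Fact l.Prime := ⟨(hT l hl).1⟩
    rw [Finset.sum_eq_single l, hb_self_left (hy l hl)]
    · intro p hp hne
      have : Fact p.Prime := ⟨(hT p hp).1⟩
      exact hb_unit (pr_not_dvd (hT p hp).1 (hT l hl).1 hne) (hy p hp)
    · intro h; exact absurd hl h
  have b11 : tot T (-1) (-1) = 0 := by
    unfold tot h2; rw [z0 _ _ nn nn, up2_neg_one, vz2_neg_one]; decide
  have b12 : tot T (-1) 2 = 0 := by
    unfold tot h2; rw [z0 _ _ nn n2, up2_neg_one, vz2_neg_one, up2_two, vz2_two]; decide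
  have b22 : tot T 2 2 = 0 := by
    unfold tot h2; rw [z0 _ _ n2 n2, up2_two, vz2_two]; decide
  have bl1 : ∀ l ∈ T, tot T l (-1) = 0 := by
    intro l hl
    have : Fact l.Prime := ⟨(hT l hl).1⟩
    have hnd := odd_nd (hT l hl).1 (hT l hl).2
    unfold tot h2
    rw [z1 l hl _ nn, up2_neg_one, vz2_neg_one, vz_unit hnd, up_unit hnd, sg_neg_one (hT l hl).2, s0,
      show e4 (-1) = 1 by decide]
    linear_combination z2_add_self (e4 l)
  have bl2 : ∀ l ∈ T, tot T l 2 = 0 := by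
    intro l hl
    have : Fact l.Prime := ⟨(hT l hl).1⟩
    have hnd := odd_nd (hT l hl).1 (hT l hl).2
    unfold tot h2
    rw [z1 l hl _ n2, up2_two, vz2_two, vz_unit hnd, up_unit hnd, sg_two (hT l hl).2, s0,
      show e4 1 = 0 by decide]
    linear_combination z2_add_self (w8 l)
  have bll : ∀ l ∈ T, ∀ m ∈ T, tot T l m = 0 := by
    intro l hl m hm
    have : Fact l.Prime := ⟨(hT l hl).1⟩
    have : Fact m.Prime := ⟨(hT m hm).1⟩
    have hnd := odd_nd (hT l hl).1 (hT l hl).2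
    have hnd' := odd_nd (hT m hm).1 (hT m hm).2
    unfold tot h2
    rw [up_unit hnd, vz_unit hnd, up_unit hnd', vz_unit hnd', s0, s0]
    by_cases hlm : l = m
    · subst hlm
      rw [Finset.sum_eq_single l]
      · unfold Paper.hb
        rw [vz_self, us_self, sg_neg_one (hT l hl).2]
        linear_combination z2_add_self (e4 l) + z2_mul_self (e4 l)
      · intro p hp hne
        have : Fact p.Prime := ⟨(hT p hp).1⟩
        exact hb_unit (pr_not_dvd (hT p hp).1 (hT l hl).1 hne) (pr_not_dvd (hT p hp).1 (hT l hl).1 hne)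
      · intro h; exact absurd hl h
    · rw [Finset.sum_eq_add l m hlm]
      · rw [hb_self_left (pr_not_dvd (hT l hl).1 (hT m hm).1 hlm), hb_comm,
          hb_self_left (pr_not_dvd (hT m hm).1 (hT l hl).1 (Ne.symm hlm))]
        linear_combination sg_qr (hT l hl).2 (hT m hm).2 hlm
      · intro p hp hne
        have : Fact p.Prime := ⟨(hT p hp).1⟩
        exact hb_unit (pr_not_dvd (hT p hp).1 (hT l hl).1 hne.1) (pr_not_dvd (hT p hp).1 (hT m hm).1 hne.2)
      · intro h; exact absurd hl h
      · intro h; exact absurd hm h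
  refine mul_induct T (fun x => tot T a x = 0) ?_ ?_ (hm a) ?_ b hb hTb
  · exact mul_induct T (fun x => tot T x (-1) = 0) b11 (by rw [tot_comm T hT]; exact b12) (hm' _) bl1 a ha hTa
  · exact mul_induct T (fun x => tot T x 2 = 0) b12 b22 (hm' _) bl2 a ha hTa
  · intro l hl
    exact mul_induct T (fun x => tot T x l = 0) (by rw [tot_comm T hT]; exact bl1 l hl)
      (by rw [tot_comm T hT]; exact bl2 l hl) (hm' _) (fun m hm => bll m hm l hl) a ha hTa

/-- one place can be dropped -/
theorem drop_one {a b : ℤ} (ha : a ≠ 0) (hb : b ≠ 0) (hs : sn a * sn b = 0) (h2' : h2 a b = 0) (q : ℕ)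
    (h : ∀ p : ℕ, p.Prime → p ≠ 2 → p ≠ q → Paper.hb p a b = 0) : Tern a b := by
  have hpos : 0 < a ∨ 0 < b := by
    by_contra hc
    push Not at hc
    unfold sn at hs
    rw [if_pos (lt_of_le_of_ne hc.1 ha), if_pos (lt_of_le_of_ne hc.2 hb)] at hs
    exact absurd hs (by decide)
  refine tern_main _ a b rfl ha hb hpos fun p hp hp2 => ?_
  by_cases hpq : p = q
  swap
  · exact h p hp hp2 hpq
  set T := insert q (((a * b).natAbs.primeFactors).erase 2) with hT
  have hab : (a * b).natAbs ≠ 0 := by simpa using ⟨ha, hb⟩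
  have hTp : ∀ p ∈ T, p.Prime ∧ p ≠ 2 := by
    intro l hl
    rw [hT, Finset.mem_insert] at hl
    rcases hl with rfl | hl
    · rw [← hpq]; exact ⟨hp, hp2⟩
    · rw [Finset.mem_erase, Nat.mem_primeFactors] at hl
      exact ⟨hl.2.1, hl.1⟩
  have ht := tot_zero T hTp a b ha hb
    (fun l hl hl2 hd => Finset.mem_insert_of_mem (Finset.mem_erase.2 ⟨hl2, Nat.mem_primeFactors.2
      ⟨hl, by rw [← Int.natCast_dvd]; exact hd.mul_right _, hab⟩⟩))
    (fun l hl hl2 hd => Finset.mem_insert_of_mem (Finset.mem_erase.2 ⟨hl2, Nat.mem_primeFactors.2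
      ⟨hl, by rw [← Int.natCast_dvd]; exact hd.mul_left _, hab⟩⟩))
  unfold tot at ht
  rw [hs, h2', Finset.sum_eq_single q] at ht
  · rw [hpq]; simpa using ht
  · intro l hl hne
    exact h l (hTp l hl).1 (hTp l hl).2 hne
  · intro hq; exact absurd (Finset.mem_insert_self _ _) hq

end ProductFormula

section Approx

theorem sg_natCongr {p a b : ℕ} [hp : Fact p.Prime] (h : a ≡ b [MOD p]) : sgz p a = sgz p b := by
  have : (a : ZMod p) = (b : ZMod p) := (ZMod.natCast_eq_natCast_iff _ _ _).2 h
  unfold sgz; push_cast; rw [this]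

theorem e4_natCongr {a b : ℕ} (h : a ≡ b [MOD 8]) : e4 a = e4 b := by
  unfold Nat.ModEq at h
  have : (a : ℤ) % 4 = (b : ℤ) % 4 := by omega
  unfold e4; rw [this]

theorem w8_natCongr {a b : ℕ} (h : a ≡ b [MOD 8]) : w8 a = w8 b := by
  unfold Nat.ModEq at h
  have : (a : ℤ) % 8 = (b : ℤ) % 8 := by omega
  unfold w8; rw [this]

theorem exists_residue {p : ℕ} (hp : p.Prime) (h2 : p ≠ 2) (y : ZMod 2) : ∃ k : ℕ, k.Coprime p ∧ sgz p k = y := by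
  have : Fact p.Prime := ⟨hp⟩
  rcases z2_cases y with rfl | rfl
  · exact ⟨1, Nat.coprime_one_left p, by simpa using sg_one (p := p)⟩
  · obtain ⟨a, ha⟩ := FiniteField.exists_nonsquare (F := ZMod p) (by rwa [ZMod.ringChar_zmod_n])
    refine ⟨a.val, ?_, ?_⟩
    · rw [Nat.coprime_comm, hp.coprime_iff_not_dvd]
      intro hd
      apply ha
      rw [← ZMod.natCast_eq_zero_iff, ZMod.natCast_zmod_val] at hd
      rw [hd]; exact IsSquare.zero
    · unfold sgz; push_cast; rw [ZMod.natCast_zmod_val, if_neg ha]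

theorem exists_crt (y : ℕ → ZMod 2) (e w : ZMod 2) (S : Finset ℕ) : (∀ p ∈ S, p.Prime ∧ p ≠ 2) →
    ∃ r : ℕ, r.Coprime (8 * ∏ p ∈ S, p) ∧ (∀ p ∈ S, sgz p r = y p) ∧ e4 r = e ∧ w8 r = w := by
  classical
  induction S using Finset.induction_on with
  | empty =>
    intro _
    have : ∃ r : ℕ, r.Coprime 8 ∧ e4 r = e ∧ w8 r = w := by
      rcases z2_cases e with rfl | rfl <;> rcases z2_cases w with rfl | rfl
      · exact ⟨1, by decide, by decide, by decide⟩
      · exact ⟨5, by decide, by decide, by decide⟩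
      · exact ⟨7, by decide, by decide, by decide⟩
      · exact ⟨3, by decide, by decide, by decide⟩
    obtain ⟨r, h1, h3, h4⟩ := this
    exact ⟨r, by simpa using h1, by simp, h3, h4⟩
  | insert p S hpS ih =>
    intro hS
    obtain ⟨r, hr, hy, he, hw⟩ := ih fun l hl => hS l (Finset.mem_insert_of_mem hl)
    have hp := hS p (Finset.mem_insert_self _ _)
    obtain ⟨k, hk, hky⟩ := exists_residue hp.1 hp.2 (y p)
    have hcop : (8 * ∏ l ∈ S, l).Coprime p := by
      refine Nat.Coprime.mul_left ?_ (Nat.Coprime.prod_left fun l hl => ?_)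
      · have : Nat.Coprime 2 p := (Nat.coprime_primes Nat.prime_two hp.1).2 hp.2.symm
        exact Nat.Coprime.pow_left 3 this
      · exact (Nat.coprime_primes (hS l (Finset.mem_insert_of_mem hl)).1 hp.1).2 (fun h => hpS (h ▸ hl))
    obtain ⟨r', h1, h3⟩ := Nat.chineseRemainder hcop r k
    have h8 : r' ≡ r [MOD 8] := h1.of_mul_right _
    have hpr : Fact p.Prime := ⟨hp.1⟩
    refine ⟨r', ?_, ?_, ?_, ?_⟩
    · rw [Finset.prod_insert hpS, show 8 * (p * ∏ l ∈ S, l) = (8 * ∏ l ∈ S, l) * p by ring]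
      refine Nat.Coprime.mul_right ?_ ?_
      · unfold Nat.Coprime; rw [h1.gcd_eq]; exact hr
      · unfold Nat.Coprime; rw [h3.gcd_eq]; exact hk
    · intro l hl
      rcases Finset.mem_insert.1 hl with rfl | hl'
      · rw [sg_natCongr h3, hky]
      · have : Fact l.Prime := ⟨(hS l hl).1⟩
        rw [sg_natCongr (h1.of_dvd ((Finset.dvd_prod_of_mem _ hl').mul_left _)), hy l hl']
    · rw [e4_natCongr h8, he]
    · rw [w8_natCongr h8, hw]

theorem exists_prime (y : ℕ → ZMod 2) (e w : ZMod 2) (S : Finset ℕ) (hS : ∀ p ∈ S, p.Prime ∧ p ≠ 2) :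
    ∃ q : ℕ, q.Prime ∧ q ∉ S ∧ q ≠ 2 ∧ (∀ p ∈ S, sgz p q = y p) ∧ e4 q = e ∧ w8 q = w := by
  obtain ⟨r, hr, hy, he, hw⟩ := exists_crt y e w S hS
  set M := 8 * ∏ p ∈ S, p with hM
  have hM0 : M ≠ 0 := mul_ne_zero (by norm_num) (Finset.prod_ne_zero_iff.2 fun p hp => (hS p hp).1.ne_zero)
  obtain ⟨q, hq, hqp, hqr⟩ := Nat.forall_exists_prime_gt_and_modEq M hM0 hr
  have hc : q.Coprime M := by unfold Nat.Coprime; rw [hqr.gcd_eq]; exact hr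
  have h8 : q ≡ r [MOD 8] := hqr.of_mul_right _
  refine ⟨q, hqp, ?_, ?_, ?_, ?_, ?_⟩
  · intro h
    have : q ∣ M := (Finset.dvd_prod_of_mem _ h).mul_left _
    exact hqp.one_lt.ne' (Nat.Coprime.eq_one_of_dvd hc this)
  · intro h
    have : q ∣ M := by rw [h, hM]; exact (by norm_num : 2 ∣ 8).mul_right _
    exact hqp.one_lt.ne' (Nat.Coprime.eq_one_of_dvd hc this)
  · intro l hl
    have : Fact l.Prime := ⟨(hS l hl).1⟩
    rw [sg_natCongr (hqr.of_dvd ((Finset.dvd_prod_of_mem _ hl).mul_left _)), hy l hl]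
  · rw [e4_natCongr h8, he]
  · rw [w8_natCongr h8, hw]

theorem exists_val (v : ℕ → ZMod 2) (j s : ZMod 2) (S : Finset ℕ) : (∀ p ∈ S, p.Prime ∧ p ≠ 2) →
    ∃ c : ℤ, c ≠ 0 ∧ sn c = s ∧ vz 2 c = j ∧ (∀ p ∈ S, vz p c = v p) ∧
      ∀ p : ℕ, p.Prime → p ≠ 2 → (p : ℤ) ∣ c → p ∈ S := by
  classical
  induction S using Finset.induction_on with
  | empty =>
    intro _
    have h1 : ∀ p : ℕ, p.Prime → ∀ x : ℤ, x ∣ 2 → (p : ℤ) ∣ x → p ≠ 2 → False := by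
      intro p hp x hx hd hne
      have : (p : ℤ) ∣ ((2 : ℕ) : ℤ) := hd.trans hx
      exact pr_not_dvd hp Nat.prime_two hne this
    have h3 : vz 2 (1 : ℤ) = 0 := vz_unit (p := 2) (by decide)
    have h4 : vz 2 (-2 : ℤ) = 1 := by
      rw [show (-2 : ℤ) = (-1) * 2 by norm_num, vz_mul (by norm_num) (by norm_num), vz2_neg_one, vz2_two]; rfl
    rcases z2_cases j with rfl | rfl <;> rcases z2_cases s with rfl | rfl
    · exact ⟨1, by decide, by decide, h3, by simp, fun p hp h2 hd => (h1 p hp _ (by norm_num) hd h2).elim⟩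
    · exact ⟨-1, by decide, by decide, vz2_neg_one, by simp, fun p hp h2 hd => (h1 p hp _ (by norm_num) hd h2).elim⟩
    · exact ⟨2, by decide, by decide, vz2_two, by simp, fun p hp h2 hd => (h1 p hp _ (by norm_num) hd h2).elim⟩
    · exact ⟨-2, by decide, by decide, h4, by simp, fun p hp h2 hd => (h1 p hp _ (by norm_num) hd h2).elim⟩
  | insert l S hlS ih =>
    intro hS
    obtain ⟨c, hc, hs, hj, hv, hd⟩ := ih fun p hp => hS p (Finset.mem_insert_of_mem hp)
    have hl := hS l (Finset.mem_insert_self _ _)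
    have : Fact l.Prime := ⟨hl.1⟩
    have hl0 : (l : ℤ) ≠ 0 := pp_ne
    have hcl : vz l c = 0 := vz_unit fun h => hlS (hd l hl.1 hl.2 h)
    rcases z2_cases (v l) with h0 | h0
    · refine ⟨c, hc, hs, hj, ?_, fun p hp h2 h => Finset.mem_insert_of_mem (hd p hp h2 h)⟩
      intro p hp
      rcases Finset.mem_insert.1 hp with rfl | hp
      · rw [hcl, h0]
      · exact hv p hp
    · refine ⟨c * l, mul_ne_zero hc hl0, ?_, ?_, ?_, ?_⟩
      · rw [sn_mul hc hl0, hs]; unfold sn; rw [if_neg (by omega), add_zero]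
      · rw [vz_mul hc hl0, hj, vz_unit (odd_nd hl.1 hl.2), add_zero]
      · intro p hp
        have hpp : Fact p.Prime := ⟨(hS p hp).1⟩
        rw [vz_mul hc hl0]
        rcases Finset.mem_insert.1 hp with rfl | hp'
        · rw [hcl, h0, vz_self, zero_add]
        · rw [hv p hp', vz_unit (pr_not_dvd hpp.out hl.1 (by rintro rfl; exact hlS hp')), add_zero]
      · intro p hp h2 h
        rcases (Nat.prime_iff_prime_int.1 hp).dvd_or_dvd h with h | h
        · exact Finset.mem_insert_of_mem (hd p hp h2 h)
        · by_cases hpl : p = l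
          · rw [hpl]; exact Finset.mem_insert_self _ _
          · exact absurd h (pr_not_dvd hp hl.1 hpl)

/-- approximation with one extra prime -/
theorem approx (v y : ℕ → ZMod 2) (j e w s : ZMod 2) (S : Finset ℕ) (hS : ∀ p ∈ S, p.Prime ∧ p ≠ 2) :
    ∃ (c : ℤ) (q : ℕ), c ≠ 0 ∧ q.Prime ∧ q ∉ S ∧ q ≠ 2 ∧ sn c = s ∧ vz 2 c = j ∧ e4 (up 2 c) = e ∧ w8 (up 2 c) = w ∧
      (∀ p ∈ S, vz p c = v p ∧ us p c = y p) ∧ ∀ p : ℕ, p.Prime → p ≠ 2 → (p : ℤ) ∣ c → p ∈ S ∨ p = q := by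
  obtain ⟨c, hc, hs, hj, hv, hd⟩ := exists_val v j s S hS
  obtain ⟨q, hq, hqS, hq2, hy, he, hw⟩ := exists_prime (fun p => y p - us p c) (e - e4 (up 2 c)) (w - w8 (up 2 c)) S hS
  have hqo := odd_nd hq hq2
  have hq0 : (q : ℤ) ≠ 0 := by exact_mod_cast hq.ne_zero
  refine ⟨c * q, q, mul_ne_zero hc hq0, hq, hqS, hq2, ?_, ?_, ?_, ?_, ?_, ?_⟩
  · rw [sn_mul hc hq0, hs]; unfold sn; rw [if_neg (by omega), add_zero]
  · rw [vz_mul hc hq0, hj, vz_unit hqo, add_zero]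
  · rw [up_mul hc hq0, up_unit hqo, e4_mul (up_not_dvd hc) hqo, he]; ring
  · rw [up_mul hc hq0, up_unit hqo, w8_mul (up_not_dvd hc) hqo, hw]; ring
  · intro p hp
    have hpp : Fact p.Prime := ⟨(hS p hp).1⟩
    have hnd := pr_not_dvd hpp.out hq (by rintro rfl; exact hqS hp)
    rw [vz_mul hc hq0, us_mul hc hq0, vz_unit hnd, us_unit hnd, hy p hp, hv p hp]
    exact ⟨by ring, by ring⟩
  · intro p hp h2 h
    rcases (Nat.prime_iff_prime_int.1 hp).dvd_or_dvd h with h | h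
    · exact Or.inl (hd p hp h2 h)
    · right; by_contra hne; exact pr_not_dvd hp hq hne h

end Approx

section Meyer

theorem loc_gen {V : Type*} [AddCommGroup V] [Fintype V] [DecidableEq V] (B : V → V → ZMod 2) (k : ℕ) (hk : 1 ≤ k)
    (h1 : ∀ a b : V, k + 1 ≤ (Finset.univ.filter fun s => B (a + s) (b + s) = 0).card)
    (h3 : ∀ x x' : V, x ≠ x' → (Finset.univ.filter fun y => B x y ≠ 0 ∧ B x' y ≠ 0).card ≤ k)
    (a1 a2 a3 a4 a5 : V) : ∃ s1 s2 : V, B (a1 + s1) (a2 + s1) = 0 ∧ B (a3 + s2) (a4 + s2) = 0 ∧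
      B (a5 + s1) (a5 + s2) = 0 := by
  obtain ⟨x, hx, x', hx', hne⟩ := Finset.one_lt_card.1 (lt_of_lt_of_le (by omega) (h1 a1 a2))
  set Y := (Finset.univ.filter fun s => B (a3 + s) (a4 + s) = 0).image (fun s => a5 + s) with hY
  have hYc : k + 1 ≤ Y.card := by
    rw [hY, Finset.card_image_of_injective _ (add_right_injective a5)]; exact h1 a3 a4
  have hlt := lt_of_le_of_lt (h3 (a5 + x) (a5 + x') (fun h => hne (add_right_injective a5 h))) hYc
  obtain ⟨y, hy, hy'⟩ := Finset.exists_mem_notMem_of_card_lt_card hlt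
  rw [hY, Finset.mem_image] at hy
  obtain ⟨s, hs, rfl⟩ := hy
  rw [Finset.mem_filter] at hs hx hx' hy'
  by_cases h : B (a5 + x) (a5 + s) = 0
  · exact ⟨x, s, hx.2, hs.2, h⟩
  · refine ⟨x', s, hx'.2, hs.2, ?_⟩
    by_contra hc
    exact hy' ⟨Finset.mem_univ _, h, hc⟩

/-- form at odd places -/
def Bo (e : ZMod 2) (x y : ZMod 2 × ZMod 2) : ZMod 2 := x.1 * y.1 * e + y.1 * x.2 + x.1 * y.2
/-- form at two -/
def Bt (x y : ZMod 2 × ZMod 2 × ZMod 2) : ZMod 2 := x.2.1 * y.2.1 + x.1 * y.2.2 + y.1 * x.2.2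

theorem loc_odd (e : ZMod 2) (a1 a2 a3 a4 a5 : ZMod 2 × ZMod 2) : ∃ s1 s2, Bo e (a1 + s1) (a2 + s1) = 0 ∧
    Bo e (a3 + s2) (a4 + s2) = 0 ∧ Bo e (a5 + s1) (a5 + s2) = 0 :=
  loc_gen (Bo e) 1 le_rfl (by revert e; decide +kernel) (by revert e; decide +kernel) a1 a2 a3 a4 a5

theorem loc_two (a1 a2 a3 a4 a5 : ZMod 2 × ZMod 2 × ZMod 2) : ∃ s1 s2, Bt (a1 + s1) (a2 + s1) = 0 ∧
    Bt (a3 + s2) (a4 + s2) = 0 ∧ Bt (a5 + s1) (a5 + s2) = 0 :=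
  loc_gen Bt 2 (by norm_num) (by decide +kernel) (by decide +kernel) a1 a2 a3 a4 a5

theorem loc_real (a1 a2 a3 a4 a5 : ZMod 2) : (a1 = a5 ∨ a2 = a5 ∨ a3 = a5 ∨ a4 = a5) →
    ∃ s1 s2, (a1 + s1) * (a2 + s1) = 0 ∧
    (a3 + s2) * (a4 + s2) = 0 ∧ (a5 + s1) * (a5 + s2) = 0 := by
  revert a1 a2 a3 a4 a5; decide

/-- class at an odd prime -/
noncomputable def cl (p : ℕ) (a : ℤ) : ZMod 2 × ZMod 2 := (vz p a, us p a)
/-- class at two -/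
def clt (a : ℤ) : ZMod 2 × ZMod 2 × ZMod 2 := (vz 2 a, e4 (up 2 a), w8 (up 2 a))

theorem hb_cl (p : ℕ) (a b : ℤ) : hb p a b = Bo (sgz p (-1)) (cl p a) (cl p b) := rfl
theorem h2_cl (a b : ℤ) : h2 a b = Bt (clt a) (clt b) := rfl

theorem cl_mul {p : ℕ} (hp : p.Prime) {a b : ℤ} (ha : a ≠ 0) (hb : b ≠ 0) : cl p (a * b) = cl p a + cl p b := by
  have : Fact p.Prime := ⟨hp⟩
  unfold cl; rw [vz_mul ha hb, us_mul ha hb]; rfl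

theorem clt_mul {a b : ℤ} (ha : a ≠ 0) (hb : b ≠ 0) : clt (a * b) = clt a + clt b := by
  unfold clt; rw [vz_mul ha hb, up_mul ha hb, e4_mul (up_not_dvd ha) (up_not_dvd hb),
    w8_mul (up_not_dvd ha) (up_not_dvd hb)]; rfl

theorem three_tern {a1 a2 a3 a4 a5 : ℤ} (h1 : a1 ≠ 0) (h2' : a2 ≠ 0) (h3 : a3 ≠ 0) (h4 : a4 ≠ 0) (h5 : a5 ≠ 0)
    (hs : sn a1 = sn a5 ∨ sn a2 = sn a5 ∨ sn a3 = sn a5 ∨ sn a4 = sn a5) :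
    ∃ c1 c2 : ℤ, c1 ≠ 0 ∧ c2 ≠ 0 ∧ Tern (a1 * c1) (a2 * c1) ∧ Tern (a3 * c2) (a4 * c2) ∧ Tern (a5 * c1) (a5 * c2) := by
  classical
  set S := ((a1 * a2 * a3 * a4 * a5).natAbs.primeFactors).erase 2 with hSd
  have hprod : a1 * a2 * a3 * a4 * a5 ≠ 0 := by simp [*]
  have hS : ∀ p ∈ S, p.Prime ∧ p ≠ 2 := by
    intro p hp
    rw [hSd, Finset.mem_erase, Nat.mem_primeFactors] at hp
    exact ⟨hp.2.1, hp.1⟩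
  have hmem : ∀ p : ℕ, p.Prime → p ≠ 2 → (p : ℤ) ∣ a1 * a2 * a3 * a4 * a5 → p ∈ S := by
    intro p hp h2 hd
    rw [hSd, Finset.mem_erase, Nat.mem_primeFactors]
    exact ⟨h2, hp, by rw [← Int.natCast_dvd]; exact hd, by simpa using hprod⟩
  have hn : ∀ p : ℕ, p.Prime → p ≠ 2 → p ∉ S → ¬ (p : ℤ) ∣ a1 ∧ ¬ (p : ℤ) ∣ a2 ∧ ¬ (p : ℤ) ∣ a3 ∧ ¬ (p : ℤ) ∣ a4 ∧
      ¬ (p : ℤ) ∣ a5 := by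
    intro p hp h2 hpS
    have hc := fun h => hpS (hmem p hp h2 h)
    refine ⟨fun h => hc ?_, fun h => hc ?_, fun h => hc ?_, fun h => hc ?_, fun h => hc ?_⟩
    · exact (((h.mul_right _).mul_right _).mul_right _).mul_right _
    · exact (((h.mul_left _).mul_right _).mul_right _).mul_right _
    · exact ((h.mul_left _).mul_right _).mul_right _
    · exact (h.mul_left _).mul_right _
    · exact h.mul_left _
  have hlo := fun p : ℕ => loc_odd (sgz p (-1)) (cl p a1) (cl p a2) (cl p a3) (cl p a4) (cl p a5)
  choose s1 s2 ho1 ho2 ho3 using hlo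
  obtain ⟨t1, t2, ht1, ht2, ht3⟩ := loc_two (clt a1) (clt a2) (clt a3) (clt a4) (clt a5)
  obtain ⟨r1, r2, hr1, hr2, hr3⟩ := loc_real (sn a1) (sn a2) (sn a3) (sn a4) (sn a5) hs
  obtain ⟨c1, q1, hc1, hq1, hq1S, hq12, hsn1, hj1, he1, hw1, hv1, hd1⟩ :=
    approx (fun p => (s1 p).1) (fun p => (s1 p).2) t1.1 t1.2.1 t1.2.2 r1 S hS
  have hS' : ∀ p ∈ insert q1 S, p.Prime ∧ p ≠ 2 := by
    intro p hp
    rcases Finset.mem_insert.1 hp with rfl | hp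
    · exact ⟨hq1, hq12⟩
    · exact hS p hp
  obtain ⟨c2, q2, hc2, hq2, hq2S, hq22, hsn2, hj2, he2, hw2, hv2, hd2⟩ :=
    approx (fun p => if p = q1 then vz q1 a5 else (s2 p).1) (fun p => if p = q1 then us q1 a5 else (s2 p).2)
      t2.1 t2.2.1 t2.2.2 r2 (insert q1 S) hS'
  have hcl1 : ∀ p ∈ S, cl p c1 = s1 p := fun p hp => Prod.ext (hv1 p hp).1 (hv1 p hp).2
  have hcl2 : ∀ p ∈ S, cl p c2 = s2 p := fun p hp => by
    have := hv2 p (Finset.mem_insert_of_mem hp)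
    have hne : p ≠ q1 := by rintro rfl; exact hq1S hp
    rw [if_neg hne, if_neg hne] at this
    exact Prod.ext this.1 this.2
  have hclq : cl q1 c2 = cl q1 a5 := by
    have := hv2 q1 (Finset.mem_insert_self _ _)
    rw [if_pos rfl, if_pos rfl] at this
    exact Prod.ext this.1 this.2
  have hct1 : clt c1 = t1 := Prod.ext hj1 (Prod.ext he1 hw1)
  have hct2 : clt c2 = t2 := Prod.ext hj2 (Prod.ext he2 hw2)
  have hu1 : ∀ p : ℕ, p.Prime → p ≠ 2 → p ∉ S → p ≠ q1 → ¬ (p : ℤ) ∣ c1 := fun p hp h2 hpS hne hd =>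
    (hd1 p hp h2 hd).elim hpS hne
  have hu2 : ∀ p : ℕ, p.Prime → p ≠ 2 → p ∉ S → p ≠ q1 → p ≠ q2 → ¬ (p : ℤ) ∣ c2 := fun p hp h2 hpS hne hne' hd =>
    (hd2 p hp h2 hd).elim (fun h => (Finset.mem_insert.1 h).elim hne hpS) hne'
  obtain ⟨-, -, hqa3, hqa4, hqa5⟩ := hn q1 hq1 hq12 hq1S
  have hF1 : Fact q1.Prime := ⟨hq1⟩
  refine ⟨c1, c2, hc1, hc2, ?_, ?_, ?_⟩
  · refine drop_one (mul_ne_zero h1 hc1) (mul_ne_zero h2' hc1) ?_ ?_ q1 ?_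
    · rw [sn_mul h1 hc1, sn_mul h2' hc1, hsn1]; exact hr1
    · rw [h2_cl, clt_mul h1 hc1, clt_mul h2' hc1, hct1]; exact ht1
    · intro p hp hp2 hpq
      by_cases hpS : p ∈ S
      · rw [hb_cl, cl_mul hp h1 hc1, cl_mul hp h2' hc1, hcl1 p hpS]; exact ho1 p
      · have : Fact p.Prime := ⟨hp⟩
        have hu := hu1 p hp hp2 hpS hpq
        have hh := hn p hp hp2 hpS
        exact hb_unit (not_dvd_mul hh.1 hu) (not_dvd_mul hh.2.1 hu)
  · refine drop_one (mul_ne_zero h3 hc2) (mul_ne_zero h4 hc2) ?_ ?_ q2 ?_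
    · rw [sn_mul h3 hc2, sn_mul h4 hc2, hsn2]; exact hr2
    · rw [h2_cl, clt_mul h3 hc2, clt_mul h4 hc2, hct2]; exact ht2
    · intro p hp hp2 hpq
      by_cases hpS : p ∈ S
      · rw [hb_cl, cl_mul hp h3 hc2, cl_mul hp h4 hc2, hcl2 p hpS]; exact ho2 p
      · by_cases hp1 : p = q1
        · have hv : vz q1 c2 = 0 := by
            have := congrArg Prod.fst hclq
            change vz q1 c2 = vz q1 a5 at this
            rw [this, vz_unit hqa5]
          subst hp1
          unfold Paper.hb
          rw [vz_mul h3 hc2, vz_mul h4 hc2, hv, vz_unit hqa3, vz_unit hqa4]; ring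
        · have : Fact p.Prime := ⟨hp⟩
          have hu := hu2 p hp hp2 hpS hp1 hpq
          have hh := hn p hp hp2 hpS
          exact hb_unit (not_dvd_mul hh.2.2.1 hu) (not_dvd_mul hh.2.2.2.1 hu)
  · refine drop_one (mul_ne_zero h5 hc1) (mul_ne_zero h5 hc2) ?_ ?_ q2 ?_
    · rw [sn_mul h5 hc1, sn_mul h5 hc2, hsn1, hsn2]; exact hr3
    · rw [h2_cl, clt_mul h5 hc1, clt_mul h5 hc2, hct1, hct2]; exact ht3
    · intro p hp hp2 hpq
      by_cases hpS : p ∈ S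
      · rw [hb_cl, cl_mul hp h5 hc1, cl_mul hp h5 hc2, hcl1 p hpS, hcl2 p hpS]; exact ho3 p
      · by_cases hp1 : p = q1
        · subst hp1
          have hz : ∀ x : ZMod 2 × ZMod 2, x + x = 0 := by decide
          rw [hb_cl, cl_mul hp h5 hc2, hclq, hz]
          unfold Bo; simp
        · have : Fact p.Prime := ⟨hp⟩
          have hu := hu1 p hp hp2 hpS hp1
          have hu' := hu2 p hp hp2 hpS hp1 hpq
          have hh := hn p hp hp2 hpS
          exact hb_unit (not_dvd_mul hh.2.2.2.2 hu) (not_dvd_mul hh.2.2.2.2 hu')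

theorem tern_rat {a b c : ℤ} (hc : c ≠ 0) (h : Tern (a * c) (b * c)) : ∃ x y z : ℚ, (x ≠ 0 ∨ y ≠ 0 ∨ z ≠ 0) ∧
    (a : ℚ) * x ^ 2 + b * y ^ 2 = c * z ^ 2 := by
  obtain ⟨x, y, z, h0, h⟩ := h
  have hc' : (c : ℚ) ≠ 0 := by exact_mod_cast hc
  refine ⟨x, y, z / c, ?_, ?_⟩
  · simpa [hc'] using h0
  · have h' : (z : ℚ) * z = a * c * (x * x) + b * c * (y * y) := by exact_mod_cast h
    field_simp
    linear_combination -h'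

/-- isotropy of quinary forms, with the last sign reversed -/
theorem meyer {a1 a2 a3 a4 a5 : ℤ} (h1 : 0 < a1) (h2' : 0 < a2) (h3 : 0 < a3) (h4 : 0 < a4) (h5 : 0 < a5) :
    ∃ x1 x2 x3 x4 : ℚ, (a1 : ℚ) * x1 ^ 2 + a2 * x2 ^ 2 + a3 * x3 ^ 2 + a4 * x4 ^ 2 = a5 := by
  have s0 : ∀ a : ℤ, 0 < a → sn a = 0 := fun a h => if_neg (by omega)
  obtain ⟨c1, c2, hc1, hc2, t1, t2, t3⟩ := three_tern h1.ne' h2'.ne' h3.ne' h4.ne' h5.ne'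
    (Or.inl (by rw [s0 _ h1, s0 _ h5]))
  obtain ⟨x, y, z, hxyz, h⟩ := tern_rat hc1 t1
  obtain ⟨x', y', z', hxyz', h'⟩ := tern_rat hc2 t2
  obtain ⟨U, V, W, h0, hU⟩ := t3
  have p1 : (0 : ℚ) < a1 := by exact_mod_cast h1
  have p2 : (0 : ℚ) < a2 := by exact_mod_cast h2'
  have p3 : (0 : ℚ) < a3 := by exact_mod_cast h3
  have p4 : (0 : ℚ) < a4 := by exact_mod_cast h4
  have p5 : (0 : ℚ) < a5 := by exact_mod_cast h5
  have pos : ∀ a b x y : ℚ, 0 < a → 0 < b → a * x ^ 2 + b * y ^ 2 = 0 → x = 0 ∧ y = 0 := by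
    intro a b x y ha hb h
    have k1 : 0 ≤ a * x ^ 2 := by positivity
    have k2 : 0 ≤ b * y ^ 2 := by positivity
    have k3 : a * x ^ 2 = 0 := by linarith
    have k4 : b * y ^ 2 = 0 := by linarith
    exact ⟨by simpa [ha.ne'] using k3, by simpa [hb.ne'] using k4⟩
  have hz : z ≠ 0 := by
    rintro rfl
    have := pos _ _ _ _ p1 p2 (by rw [h]; ring)
    simp [this] at hxyz
  have hz' : z' ≠ 0 := by
    rintro rfl
    have := pos _ _ _ _ p3 p4 (by rw [h']; ring)
    simp [this] at hxyz'
  have hU' : (W : ℚ) ^ 2 = a5 * (c1 * U ^ 2 + c2 * V ^ 2) := by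
    have : (W : ℚ) * W = a5 * c1 * (U * U) + a5 * c2 * (V * V) := by exact_mod_cast hU
    linear_combination this
  have hA : (c1 : ℚ) * U ^ 2 = a1 * (x * U / z) ^ 2 + a2 * (y * U / z) ^ 2 := by
    field_simp; linear_combination - U ^ 2 * h
  have hB : (c2 : ℚ) * V ^ 2 = a3 * (x' * V / z') ^ 2 + a4 * (y' * V / z') ^ 2 := by
    field_simp; linear_combination - V ^ 2 * h'
  have hW : (W : ℚ) ≠ 0 := by
    intro hW
    rw [hW] at hU'
    have k0 : (c1 : ℚ) * U ^ 2 + c2 * V ^ 2 = 0 := by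
      have : (a5 : ℚ) * (c1 * U ^ 2 + c2 * V ^ 2) = 0 := by rw [← hU']; ring
      exact (mul_eq_zero.1 this).resolve_left p5.ne'
    have k1 : 0 ≤ (c1 : ℚ) * U ^ 2 := by rw [hA]; positivity
    have k2 : 0 ≤ (c2 : ℚ) * V ^ 2 := by rw [hB]; positivity
    have k3 : (c1 : ℚ) * U ^ 2 = 0 := by linarith
    have k4 : (c2 : ℚ) * V ^ 2 = 0 := by linarith
    have k5 : U = 0 := by simpa [hc1] using k3
    have k6 : V = 0 := by simpa [hc2] using k4
    have k7 : W = 0 := by exact_mod_cast hW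
    simp [k5, k6, k7] at h0
  refine ⟨x * U / z * (a5 / W), y * U / z * (a5 / W), x' * V / z' * (a5 / W), y' * V / z' * (a5 / W), ?_⟩
  have e : (a1 : ℚ) * (x * U / z * (a5 / W)) ^ 2 + a2 * (y * U / z * (a5 / W)) ^ 2 + a3 * (x' * V / z' * (a5 / W)) ^ 2 +
      a4 * (y' * V / z' * (a5 / W)) ^ 2 = (c1 * U ^ 2 + c2 * V ^ 2) * (a5 / W) ^ 2 := by
    rw [hA, hB]; ring
  rw [e]
  field_simp
  linear_combination -hU'

theorem meyer_rat {a1 a2 a3 a4 : ℚ} (h1 : 0 < a1) (h2' : 0 < a2) (h3 : 0 < a3) (h4 : 0 < a4) :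
    ∃ x1 x2 x3 x4 : ℚ, a1 * x1 ^ 2 + a2 * x2 ^ 2 + a3 * x3 ^ 2 + a4 * x4 ^ 2 = 1 := by
  have key : ∀ a : ℚ, 0 < a → 0 < a.num * a.den ∧ a = (a.num * a.den : ℤ) / (a.den : ℚ) ^ 2 := by
    intro a ha
    refine ⟨mul_pos (Rat.num_pos.2 ha) (by exact_mod_cast a.den_pos), ?_⟩
    have hd : (a.den : ℚ) ≠ 0 := by exact_mod_cast a.den_nz
    have := Rat.mul_den_eq_num a
    push_cast
    field_simp
    linear_combination this
  obtain ⟨k1, e1⟩ := key a1 h1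
  obtain ⟨k2, e2⟩ := key a2 h2'
  obtain ⟨k3, e3⟩ := key a3 h3
  obtain ⟨k4, e4⟩ := key a4 h4
  obtain ⟨x1, x2, x3, x4, h⟩ := meyer k1 k2 k3 k4 (a5 := 1) one_pos
  have hd1 : (a1.den : ℚ) ≠ 0 := by exact_mod_cast a1.den_nz
  have hd2 : (a2.den : ℚ) ≠ 0 := by exact_mod_cast a2.den_nz
  have hd3 : (a3.den : ℚ) ≠ 0 := by exact_mod_cast a3.den_nz
  have hd4 : (a4.den : ℚ) ≠ 0 := by exact_mod_cast a4.den_nz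
  refine ⟨a1.den * x1, a2.den * x2, a3.den * x3, a4.den * x4, ?_⟩
  push_cast at h
  rw [← h]
  have f : ∀ a x : ℚ, 0 < a → a * (a.den * x) ^ 2 = a.num * a.den * x ^ 2 := by
    intro a x _
    have := Rat.mul_den_eq_num a
    linear_combination a.den * x ^ 2 * this
  rw [f _ _ h1, f _ _ h2', f _ _ h3, f _ _ h4]

end Meyer

section Final

theorem qeval_cast {m : ℕ} (F : Matrix (Fin m) (Fin m) ℚ) (x : Fin m → ℚ) :
    qeval (F.map (Rat.cast : ℚ → ℝ)) (fun i => (x i : ℝ)) = ((qeval F x : ℚ) : ℝ) := by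
  simp [qeval, dotProduct, Matrix.mulVec]

theorem lor_arith {a b s t : ℝ} (h : (s * t) ^ 2 ≤ a * b) (ha : a < s ^ 2) 
    (hbt : b ≤ t ^ 2) (ha0 : 0 ≤ a) : t = 0 := by
  by_contra ht
  have h1 : 0 < t ^ 2 := by positivity
  have h2 : a * b ≤ a * t ^ 2 := mul_le_mul_of_nonneg_left hbt ha0
  have h3 : a * t ^ 2 < s ^ 2 * t ^ 2 := mul_lt_mul_of_pos_right ha h1
  nlinarith

theorem sig_def {n : ℕ} {F : Matrix (Fin (n + 1)) (Fin (n + 1)) ℚ} (hF : F.IsSymm)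
    (hsig : HasSignature F n 1) (v x : Fin (n + 1) → ℚ) (hv : qeval F v < 0)
    (hvx : v ⬝ᵥ (F *ᵥ x) = 0) (hx : qeval F x ≤ 0) : x = 0 := by
  obtain ⟨_, T, hT, hq⟩ := hsig
  have hTu : IsUnit T.det := isUnit_iff_ne_zero.2 hT
  have key : ∀ y : Fin (n + 1) → ℚ, ((qeval F y : ℚ) : ℝ) =
      ∑ i : Fin n, ((T⁻¹ *ᵥ (fun i => (y i : ℝ))) i.castSucc) ^ 2 -
        ((T⁻¹ *ᵥ (fun i => (y i : ℝ))) (Fin.last n)) ^ 2 := by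
    intro y
    have h := hq (T⁻¹ *ᵥ (fun i => (y i : ℝ)))
    rw [Matrix.mulVec_mulVec, Matrix.mul_nonsing_inv _ hTu, Matrix.one_mulVec, qeval_cast] at h
    rw [h, Fin.sum_univ_castSucc]
    simp [sub_eq_add_neg]
  have hsum := qeval_add_smul hF v x 1
  rw [hvx, one_smul] at hsum
  have hs : (fun i => (((v + x) i : ℚ) : ℝ)) = (fun i => (v i : ℝ)) + (fun i => (x i : ℝ)) := by
    ext i; simp
  have k1 := key v
  have k2 := key x
  have k3 := key (v + x)
  rw [hs, Matrix.mulVec_add] at k3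
  set V := T⁻¹ *ᵥ (fun i => (v i : ℝ)) with hV
  set X := T⁻¹ *ᵥ (fun i => (x i : ℝ)) with hX
  have hsumR : ((qeval F (v + x) : ℚ) : ℝ) = (qeval F v : ℚ) + (qeval F x : ℚ) := by
    rw [hsum]; push_cast; ring
  rw [k1, k2, k3] at hsumR
  have e : ∑ i : Fin n, ((V + X) i.castSucc) ^ 2 = ∑ i : Fin n, (V i.castSucc) ^ 2 +
      2 * ∑ i : Fin n, V i.castSucc * X i.castSucc + ∑ i : Fin n, (X i.castSucc) ^ 2 := by
    rw [Finset.mul_sum, ← Finset.sum_add_distrib, ← Finset.sum_add_distrib]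
    refine Finset.sum_congr rfl fun i _ => ?_
    simp only [Pi.add_apply]; ring
  rw [e] at hsumR
  have e2 : ∑ i : Fin n, V i.castSucc * X i.castSucc = V (Fin.last n) * X (Fin.last n) := by
    simp only [Pi.add_apply] at hsumR
    linarith
  have cs := Finset.sum_mul_sq_le_sq_mul_sq Finset.univ (fun i : Fin n => V i.castSucc)
    (fun i : Fin n => X i.castSucc)
  rw [e2] at cs
  have hvR : ((qeval F v : ℚ) : ℝ) < 0 := by exact_mod_cast hv
  have hxR : ((qeval F x : ℚ) : ℝ) ≤ 0 := by exact_mod_cast hx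
  have p1 : 0 ≤ ∑ i : Fin n, (V i.castSucc) ^ 2 := Finset.sum_nonneg fun i _ => sq_nonneg _
  have p2 : 0 ≤ ∑ i : Fin n, (X i.castSucc) ^ 2 := Finset.sum_nonneg fun i _ => sq_nonneg _
  have t0 : X (Fin.last n) = 0 :=
    lor_arith cs (by linarith) (by linarith) p1
  have s0 : ∑ i : Fin n, (X i.castSucc) ^ 2 = 0 := by
    rw [t0] at k2
    refine le_antisymm ?_ p2
    linarith [k2, hxR, (by norm_num : (0 : ℝ) ^ 2 = 0)]
  have hX0 : X = 0 := by
    ext i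
    refine Fin.lastCases t0 (fun j => ?_) i
    have := (Finset.sum_eq_zero_iff_of_nonneg (fun i _ => sq_nonneg _)).1 s0 j (Finset.mem_univ _)
    simpa using this
  have hx0 : (fun i => (x i : ℝ)) = 0 := by
    have h := congrArg (fun y => T *ᵥ y) hX0
    simp only [hX] at h
    rwa [Matrix.mulVec_mulVec, Matrix.mul_nonsing_inv _ hTu, Matrix.one_mulVec,
      Matrix.mulVec_zero] at h
  ext i
  have := congrFun hx0 i
  simpa using this

theorem sig_neg {n : ℕ} {F : Matrix (Fin (n + 1)) (Fin (n + 1)) ℚ}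
    (hsig : HasSignature F n 1) : ∃ v, qeval F v < 0 := by
  obtain ⟨_, T, hT, hq⟩ := hsig
  have hc : Continuous fun x : Fin (n + 1) → ℝ => qeval (F.map (Rat.cast : ℚ → ℝ)) x := by
    simp only [qeval, dotProduct, Matrix.mulVec]
    fun_prop
  have hd : DenseRange (fun (x : Fin (n + 1) → ℚ) (i : Fin (n + 1)) => (x i : ℝ)) := by
    have := DenseRange.piMap (fun _ : Fin (n + 1) => Rat.denseRange_cast (𝕜 := ℝ))
    exact this
  have ho : IsOpen {x : Fin (n + 1) → ℝ | qeval (F.map (Rat.cast : ℚ → ℝ)) x < 0} :=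
    isOpen_lt hc continuous_const
  obtain ⟨v, hv⟩ := hd.exists_mem_open ho ⟨T *ᵥ Pi.single (Fin.last n) 1, by
    show qeval (F.map (Rat.cast : ℚ → ℝ)) _ < 0
    rw [hq, Fin.sum_univ_castSucc]
    simp⟩
  refine ⟨v, ?_⟩
  have h : qeval (F.map (Rat.cast : ℚ → ℝ)) (fun i => (v i : ℝ)) < 0 := hv
  rw [qeval_cast] at h
  exact_mod_cast h

variable {m : ℕ} {F : Matrix (Fin m) (Fin m) ℚ}

theorem exists_orth (L : List (Fin m → ℚ)) (hL : L.length < m) :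
    ∃ w : Fin m → ℚ, w ≠ 0 ∧ ∀ u ∈ L, u ⬝ᵥ (F *ᵥ w) = 0 := by
  let φ : (Fin m → ℚ) →ₗ[ℚ] (Fin L.length → ℚ) :=
    Matrix.mulVecLin ((Matrix.of fun i : Fin L.length => L.get i) * F)
  have h : LinearMap.ker φ ≠ ⊥ := LinearMap.ker_ne_bot_of_finrank_lt (by simpa using hL)
  obtain ⟨w, hw, hw0⟩ := (Submodule.ne_bot_iff _).1 h
  refine ⟨w, hw0, fun u hu => ?_⟩
  obtain ⟨i, rfl⟩ := List.mem_iff_get.1 hu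
  have := congrFun (LinearMap.mem_ker.1 hw) i
  rw [Matrix.mulVecLin_apply, ← Matrix.mulVec_mulVec] at this
  exact this

theorem exists_unit (hF : F.IsSymm) {v0 : Fin m → ℚ}
    (hpos : ∀ w, v0 ⬝ᵥ (F *ᵥ w) = 0 → w ≠ 0 → 0 < qeval F w)
    (L : List (Fin m → ℚ)) (hv : v0 ∈ L) (hL : L.length + 3 < m) :
    ∃ w : Fin m → ℚ, qeval F w = 1 ∧ ∀ u ∈ L, u ⬝ᵥ (F *ᵥ w) = 0 := by
  obtain ⟨w1, n1, o1⟩ := exists_orth (F := F) L (by omega)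
  obtain ⟨w2, n2, o2⟩ := exists_orth (F := F) (w1 :: L) (by simp; omega)
  obtain ⟨w3, n3, o3⟩ := exists_orth (F := F) (w2 :: w1 :: L) (by simp; omega)
  obtain ⟨w4, n4, o4⟩ := exists_orth (F := F) (w3 :: w2 :: w1 :: L) (by simp; omega)
  simp only [List.forall_mem_cons] at o2 o3 o4
  obtain ⟨o12, o2⟩ := o2
  obtain ⟨o23, o13, o3⟩ := o3
  obtain ⟨o34, o24, o14, o4⟩ := o4
  obtain ⟨x1, x2, x3, x4, hx⟩ := meyer_rat (hpos _ (o1 _ hv) n1) (hpos _ (o2 _ hv) n2)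
    (hpos _ (o3 _ hv) n3) (hpos _ (o4 _ hv) n4)
  refine ⟨0 + x1 • w1 + x2 • w2 + x3 • w3 + x4 • w4, ?_, fun u hu => ?_⟩
  · rw [qeval_add_smul hF, qeval_add_smul hF, qeval_add_smul hF, qeval_add_smul hF]
    have r : ∀ (a b c : Fin m → ℚ) (k : ℚ), (a + k • b) ⬝ᵥ (F *ᵥ c) =
        a ⬝ᵥ (F *ᵥ c) + k * (b ⬝ᵥ (F *ᵥ c)) := by
      intro a b c k; rw [add_dotProduct, smul_dotProduct, smul_eq_mul]
    simp only [r, o12, o13, o14, o23, o24, o34, zero_dotProduct]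
    have : qeval F 0 = 0 := by simp [qeval]
    rw [this, ← hx]; ring
  · simp only [bl_add, o1 u hu, o2 u hu, o3 u hu, o4 u hu]
    simp

theorem setup_emb (hF : F.IsSymm) (hm : 7 ≤ m) {v0 : Fin m → ℚ} (hv : qeval F v0 = -1)
    (hpos : ∀ w, v0 ⬝ᵥ (F *ᵥ w) = 0 → w ≠ 0 → 0 < qeval F w) :
    ∃ (E : Emb F) (z : Fin m → ℚ), E.P *ᵥ z = 0 ∧ 0 < qeval F z := by
  obtain ⟨w1, n1, o1⟩ := exists_unit hF hpos [v0] (by simp) (by simp; omega)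
  obtain ⟨w2, n2, o2⟩ := exists_unit hF hpos [v0, w1] (by simp) (by simp; omega)
  obtain ⟨w3, n3, o3⟩ := exists_unit hF hpos [v0, w1, w2] (by simp) (by simp; omega)
  obtain ⟨z, nz, oz⟩ := exists_orth (F := F) [v0, w1, w2, w3] (by simp; omega)
  simp only [List.forall_mem_cons, List.not_mem_nil, false_imp_iff, implies_true, and_true] at o1 o2 o3 oz
  obtain ⟨o02, o12⟩ := o2
  obtain ⟨o03, o13, o23⟩ := o3
  obtain ⟨z0, z1, z2, z3⟩ := oz
  have s1 := (bl_symm hF w1 v0).trans o1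
  have s2 := (bl_symm hF w2 v0).trans o02
  have s3 := (bl_symm hF w3 v0).trans o03
  have s4 := (bl_symm hF w2 w1).trans o12
  have s5 := (bl_symm hF w3 w1).trans o13
  have s6 := (bl_symm hF w3 w2).trans o23
  unfold qeval at hv n1 n2 n3
  let R : Matrix (Fin 4) (Fin m) ℚ := Matrix.of ![v0, w1, w2, w3]
  have hent : ∀ i j, (R * F * Rᵀ : Matrix _ _ ℚ) i j =
      (![v0, w1, w2, w3] : Fin 4 → Fin m → ℚ) i ⬝ᵥ (F *ᵥ (![v0, w1, w2, w3] : Fin 4 → Fin m → ℚ) j) := by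
    intro i j
    rw [Matrix.mul_assoc]
    rfl
  have hU : (Rᵀ)ᵀ * F * Rᵀ = q3 := by
    ext i j
    rw [Matrix.transpose_transpose, hent]
    fin_cases i <;> fin_cases j <;> simp [q3, Matrix.diagonal, *]
  refine ⟨Emb.mk' Rᵀ hU, z, ?_, hpos z z0 nz⟩
  show (q3 * (Rᵀ)ᵀ * F) *ᵥ z = 0
  rw [Matrix.transpose_transpose, Matrix.mul_assoc, ← Matrix.mulVec_mulVec, ← Matrix.mulVec_mulVec]
  have : R *ᵥ (F *ᵥ z) = 0 := by
    ext i
    show (![v0, w1, w2, w3] : Fin 4 → Fin m → ℚ) i ⬝ᵥ (F *ᵥ z) = 0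
    fin_cases i <;> simp [*]
  rw [this, Matrix.mulVec_zero]

theorem qeval_smul_mat (l : ℚ) (x : Fin m → ℚ) : qeval (l • F) x = l * qeval F x := by
  simp [qeval, Matrix.smul_mulVec]

theorem OZ_smul {l : ℚ} (hl : l ≠ 0) : OZ (l • F) = OZ F := by
  ext g
  show (∀ x, qeval (l • F) _ = qeval (l • F) x) ↔ (∀ x, qeval F _ = qeval F x)
  simp only [qeval_smul_mat]
  exact forall_congr' fun x => mul_right_inj' hl

theorem partFinal {n : ℕ} (hn : 6 ≤ n) {F : Matrix (Fin (n + 1)) (Fin (n + 1)) ℚ} (hF : F.IsSymm)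
    (hsig : HasSignature F n 1) (H : Subgroup (GL (Fin (n + 1)) ℤ)) (hH : H ≤ OZ F)
    (hidx : H.relIndex (OZ F) ≠ 0) :
    ∃ (A : Subgroup (GL (Fin 4) ℤ)) (C : Subgroup A) (f : Dbl C →* H),
      Group.FG A ∧ ¬ C.FG ∧ Function.Injective f := by
  obtain ⟨v0, hv0⟩ := sig_neg hsig
  have hl : 0 < (-qeval F v0)⁻¹ := inv_pos.2 (by linarith)
  obtain ⟨l, hle⟩ : ∃ l, l = (-qeval F v0)⁻¹ := ⟨_, rfl⟩
  rw [← hle] at hl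
  have hl1 : l * qeval F v0 = -1 := by
    rw [hle, inv_neg, neg_mul, inv_mul_cancel₀ hv0.ne]
  have hF' : (l • F).IsSymm := hF.smul l
  have hb : ∀ u w : Fin (n + 1) → ℚ, u ⬝ᵥ ((l • F) *ᵥ w) = 0 → u ⬝ᵥ (F *ᵥ w) = 0 := by
    intro u w h
    rw [Matrix.smul_mulVec, dotProduct_smul, smul_eq_mul] at h
    exact (mul_eq_zero.1 h).resolve_left hl.ne'
  have hpos : ∀ u w : Fin (n + 1) → ℚ, qeval (l • F) u < 0 → u ⬝ᵥ ((l • F) *ᵥ w) = 0 → w ≠ 0 →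
      0 < qeval (l • F) w := by
    intro u w hu huw hw
    rw [qeval_smul_mat] at hu ⊢
    have hu' : qeval F u < 0 := by
      by_contra hc
      push Not at hc
      have := mul_nonneg hl.le hc
      linarith
    refine mul_pos hl ?_
    by_contra hc
    push Not at hc
    exact hw (sig_def hF hsig u w hu' (hb u w huw) hc)
  obtain ⟨E, z, hz, hr⟩ := setup_emb hF' (by omega) (v0 := v0) (by rw [qeval_smul_mat, hl1])
    (fun w => hpos v0 w (by rw [qeval_smul_mat, hl1]; norm_num))
  rw [← OZ_smul hl.ne'] at hH hidx
  refine partL hF' ?_ E hz hr H hH hidx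
  intro u w hu huw
  by_cases hw : w = 0
  · rw [hw]; simp [qeval]
  · exact (hpos u w hu huw hw).le

end Final

/-- Theorem B. For `n ≥ 6` and any rational quadratic form `f` of signature
`(n,1)` in `n+1` variables, every group abstractly commensurable with `O(f, ℤ)` is noncoherent;
in particular `O(f, ℤ)` itself is noncoherent. -/
theorem noncoherent_of_commensurable_arithmetic (n : ℕ) (hn : 6 ≤ n)
    (F : Matrix (Fin (n + 1)) (Fin (n + 1)) ℚ) (hFsymm : F.IsSymm)
    (hsig : HasSignature F n 1) :
    (∀ (G : Type u) [Group G], AbstractlyCommensurable G ↥(OZ F) → ¬ IsCoherent G) ∧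
      ¬ IsCoherent ↥(OZ F) := by
  constructor
  · rintro G _ ⟨G', H', _, hH', ⟨e⟩⟩
    have hle : H'.map (OZ F).subtype ≤ OZ F := Subgroup.map_subtype_le H'
    obtain ⟨A, C, f, hA, hC, hf⟩ := partFinal hn hFsymm hsig (H'.map (OZ F).subtype) hle (by
      rw [Subgroup.relIndex, Subgroup.subgroupOf, Subgroup.comap_map_eq_self_of_injective
        (Subgroup.subtype_injective _)]
      exact hH'.index_ne_zero)
    let e2 := H'.equivMapOfInjective (OZ F).subtype (Subgroup.subtype_injective _)
    refine not_coherent_of_double hA C hC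
      (((G'.subtype.comp e.symm.toMonoidHom).comp e2.symm.toMonoidHom).comp f) ?_
    exact ((Subgroup.subtype_injective _).comp e.symm.injective).comp e2.symm.injective |>.comp hf
  · obtain ⟨A, C, f, hA, hC, hf⟩ := partFinal hn hFsymm hsig (OZ F) le_rfl (by simp)
    exact not_coherent_of_double hA C hC f hf

end Paper
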